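/- arXiv:1802.02564 — 18 statements merged into one kernel-verified Lean document; each statement's English description precedes it below -/
import Mathlib

section
/- Let e ≥ 4, n ≥ 5 and q ≥ 0 be integers, and define m_i = n² + (e-2)n + q + i for 0 ≤ i ≤ e-3, m_{e-2} = n² + (e-1)n + q + (e-3), and m_{e-1} = n² + (e-1)n + q + (e-2). Then {m_0, …, m_{e-1}} is a minimal generating set for the additive submonoid 𝔖_{(n,e,q)} of ℕ that it generates; that is, for every index j, the element m_j does not lie in the additive submonoid of ℕ generated by the remaining elements {m_i : i ≠ j}. -/
theorem statement0 (e n q : ℕ) (he : 4 ≤ e) (hn : 5 ≤ n)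
    (m : Fin e → ℕ)
    (hm1 : ∀ i : Fin e, (i : ℕ) ≤ e - 3 → m i = n ^ 2 + (e - 2) * n + q + (i : ℕ))
    (hm2 : ∀ i : Fin e, (i : ℕ) = e - 2 → m i = n ^ 2 + (e - 1) * n + q + (e - 3))
    (hm3 : ∀ i : Fin e, (i : ℕ) = e - 1 → m i = n ^ 2 + (e - 1) * n + q + (e - 2)) :
    ∀ j : Fin e, m j ∉ AddSubmonoid.closure {x : ℕ | ∃ i : Fin e, i ≠ j ∧ m i = x} := by
  obtain ⟨A, hA⟩ : ∃ A, A = n ^ 2 + (e - 2) * n + q := ⟨_, rfl⟩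
  have hB : n ^ 2 + (e - 1) * n + q = A + n := by
    have : e - 1 = (e - 2) + 1 := by omega
    rw [hA, this]; ring
  have hAbig : n + e < A := by
    obtain ⟨k, rfl⟩ : ∃ k, e = k + 2 := ⟨e - 2, by omega⟩
    have h2 : k + 2 - 2 = k := by omega
    rw [hA, h2]
    nlinarith [Nat.zero_le (k * (n - 1)), Nat.mul_le_mul_left k hn]
  rw [hB] at hm2 hm3
  rw [← hA] at hm1
  have hlow : ∀ i, A ≤ m i := by
    intro i
    have := hm1 i; have := hm2 i; have := hm3 i; have := i.2
    omega
  have hup : ∀ i, m i < 2 * A := by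
    intro i
    have := hm1 i; have := hm2 i; have := hm3 i; have := i.2
    omega
  have hinj : ∀ i j, m i = m j → i = j := by
    intro i j h
    have := hm1 i; have := hm2 i; have := hm3 i; have := i.2
    have := hm1 j; have := hm2 j; have := hm3 j; have := j.2
    apply Fin.ext
    omega
  intro j hj
  have key : ∀ x ∈ AddSubmonoid.closure {x : ℕ | ∃ i : Fin e, i ≠ j ∧ m i = x},
      x = 0 ∨ (A ≤ x ∧ x ≠ m j) := by
    intro x hx
    induction hx using AddSubmonoid.closure_induction with
    | mem x hx =>
      obtain ⟨i, hi, rfl⟩ := hx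
      exact Or.inr ⟨hlow i, fun h => hi (hinj i j h)⟩
    | zero => exact Or.inl rfl
    | add x y _ _ h1 h2 =>
      have := hup j
      omega
  have h1 := hlow j
  have h2 := key _ hj
  omega
end

section
/- Let k be a field, e ≥ 4 and n ≥ 5 integers, and for 0 ≤ i ≤ n+1 let 𝔥_i = x_0^i x_1^{n+2-i} − x_{e-2}^i x_{e-1}^{n+1-i} ∈ k[x_0, …, x_{e-1}]. Then the set {𝔥_0, …, 𝔥_{n+1}} is minimal: for every i with 0 ≤ i ≤ n+1, the polynomial 𝔥_i does not belong to the ideal of k[x_0, …, x_{e-1}] generated by the remaining polynomials {𝔥_j : 0 ≤ j ≤ n+1, j ≠ i}. -/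
theorem statement2 (k : Type*) [Field k] (e n : ℕ) (he : 4 ≤ e) (hn : 5 ≤ n)
    (h : ℕ → MvPolynomial (Fin e) k)
    (hh : ∀ i : ℕ, i ≤ n + 1 →
      h i = (MvPolynomial.X (⟨0, by omega⟩ : Fin e)) ^ i *
          (MvPolynomial.X (⟨1, by omega⟩ : Fin e)) ^ (n + 2 - i) -
        (MvPolynomial.X (⟨e - 2, by omega⟩ : Fin e)) ^ i *
          (MvPolynomial.X (⟨e - 1, by omega⟩ : Fin e)) ^ (n + 1 - i)) :
    ∀ i : ℕ, i ≤ n + 1 →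
      h i ∉ Ideal.span {p : MvPolynomial (Fin e) k | ∃ j : ℕ, j ≤ n + 1 ∧ j ≠ i ∧ p = h j} := by
  intro i hi hmem
  generalize ha : (⟨0, by omega⟩ : Fin e) = a at hh
  generalize hb : (⟨1, by omega⟩ : Fin e) = b at hh
  generalize hc : (⟨e - 2, by omega⟩ : Fin e) = c at hh
  generalize hd : (⟨e - 1, by omega⟩ : Fin e) = d at hh
  have hbc : c ≠ b := by rw [← hb, ← hc]; intro H; simp at H; omega
  have hbd : d ≠ b := by rw [← hb, ← hd]; intro H; simp at H; omega
  have hcd : c ≠ d := by rw [← hc, ← hd]; intro H; simp at H; omega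
  let m : ℕ → (Fin e →₀ ℕ) := fun j => Finsupp.single c j + Finsupp.single d (n + 1 - j)
  have hm : ∀ j, (MvPolynomial.X c : MvPolynomial (Fin e) k) ^ j * MvPolynomial.X d ^ (n + 1 - j)
      = MvPolynomial.monomial (m j) 1 := by
    intro j
    simp [m, MvPolynomial.X_pow_eq_monomial, MvPolynomial.monomial_mul]
  let S : Set (Fin e →₀ ℕ) := insert (Finsupp.single b 1) {s | ∃ j, j ≤ n + 1 ∧ j ≠ i ∧ s = m j}
  let I : Ideal (MvPolynomial (Fin e) k) :=
    Ideal.span ((fun s => MvPolynomial.monomial s (1 : k)) '' S)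
  have hX : ∀ j, j ≤ n + 1 → (MvPolynomial.X a : MvPolynomial (Fin e) k) ^ j *
      MvPolynomial.X b ^ (n + 2 - j) ∈ I := by
    intro j hj
    apply Ideal.mul_mem_left
    apply Ideal.pow_mem_of_mem _ _ _ (by omega)
    exact Ideal.subset_span ⟨_, Set.mem_insert _ _, rfl⟩
  have hle : Ideal.span {p : MvPolynomial (Fin e) k | ∃ j : ℕ, j ≤ n + 1 ∧ j ≠ i ∧ p = h j} ≤ I := by
    rw [Ideal.span_le]
    rintro p ⟨j, hj, hji, rfl⟩
    rw [hh j hj, hm]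
    exact I.sub_mem (hX j hj) (Ideal.subset_span ⟨m j, Set.mem_insert_of_mem _ ⟨j, hj, hji, rfl⟩, rfl⟩)
  have h1 := hle hmem
  rw [hh i hi, hm] at h1
  have h2 : MvPolynomial.monomial (m i) (1 : k) ∈ I := by
    have := I.sub_mem (hX i hi) h1
    simpa using this
  rw [MvPolynomial.mem_ideal_span_monomial_image] at h2
  obtain ⟨s, hs, hsm⟩ := h2 (m i) (by simp [MvPolynomial.mem_support_iff])
  rcases hs with rfl | ⟨j, hj, hji, rfl⟩
  · have := hsm b
    simp [m, hbc, hbd] at this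
  · have e1 := hsm c
    have e2 := hsm d
    simp [m, hcd, hcd.symm] at e1 e2
    omega
end

section
/- Let k be a field and n ≥ 5 an integer. Let φ : k[x_0, x_1, x_2, x_3] → k[t] be the k-algebra homomorphism with φ(x_0) = t^{n²+2n}, φ(x_1) = t^{n²+2n+1}, φ(x_2) = t^{n²+3n+1}, φ(x_3) = t^{n²+3n+2}, and let 𝒬_{(n,4,0)} = ker φ. Define A_1 = {f_μ = x_2^{n+1-μ} x_3^μ − x_0^{n+1-μ} x_1^{μ+1} : 0 ≤ μ ≤ n+1}, A_2 = {h_t = x_1^{n+1-t} x_3^t − x_0^{n-t} x_2^{t+1} : 0 ≤ t ≤ n}, g_1 = x_0^{n+1} − x_3^n, g_2 = x_1 x_2 − x_0 x_3. Then J = A_1 ∪ A_2 ∪ {g_1, g_2} generates the ideal 𝒬_{(n,4,0)}. -/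
open MvPolynomial

namespace St3

/-- The weight of the exponent vector. -/
def wt (n a b c d : ℕ) : ℕ :=
  a * (n ^ 2 + 2 * n) + b * (n ^ 2 + 2 * n + 1) + c * (n ^ 2 + 3 * n + 1) +
    d * (n ^ 2 + 3 * n + 2)

/-- Normal exponent vectors. -/
def Nrm (n b c d : ℕ) : Prop :=
  (b = 0 ∨ c = 0) ∧ d < n ∧ b + d ≤ n ∧ c + d ≤ n

lemma dm {m q r q' r' : ℕ} (h : m * q + r = m * q' + r') (hr : r < m) (hr' : r' < m) :
    q = q' ∧ r = r' := by
  have hm : 0 < m := by omega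
  have h1 : (m * q + r) / m = q := by
    rw [Nat.mul_add_div hm, Nat.div_eq_of_lt hr, add_zero]
  have h2 : (m * q' + r') / m = q' := by
    rw [Nat.mul_add_div hm, Nat.div_eq_of_lt hr', add_zero]
  have hq : q = q' := by rw [← h1, ← h2, h]
  subst hq
  exact ⟨rfl, by omega⟩

lemma wt_form (n a b c d : ℕ) (h : Nrm n b c d) :
    ∃ q r D, wt n a b c d = (n + 2) * (n * D + q) + r ∧ q < n ∧ r < n + 2 ∧
      D = a + b + c + d ∧
      ((c = 0 ∧ q = d ∧ r = b) ∨ (0 < c ∧ b = 0 ∧ q + 1 = c + d ∧ r + c = n + 2)) := by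
  obtain ⟨h1, h2, h3, h4⟩ := h
  rcases Nat.eq_zero_or_pos c with hc | hc
  · subst hc
    refine ⟨d, b, a + b + 0 + d, ?_, h2, by omega, rfl, Or.inl ⟨rfl, rfl, rfl⟩⟩
    unfold wt; ring
  · have hb : b = 0 := by omega
    subst hb
    obtain ⟨c, rfl⟩ : ∃ c', c = c' + 1 := ⟨c - 1, by omega⟩
    obtain ⟨r, hr⟩ : ∃ r, n + 2 = r + (c + 1) := ⟨n + 2 - (c + 1), by omega⟩
    refine ⟨c + d, r, a + 0 + (c + 1) + d, ?_, by omega, by omega, rfl,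
      Or.inr ⟨hc, rfl, by omega, by omega⟩⟩
    unfold wt
    zify at hr ⊢
    have : (r : ℤ) = n + 2 - (c + 1) := by linarith
    rw [this]; ring

lemma nrm_unique (n a b c d a' b' c' d' : ℕ) (h : Nrm n b c d) (h' : Nrm n b' c' d')
    (e : wt n a b c d = wt n a' b' c' d') : a = a' ∧ b = b' ∧ c = c' ∧ d = d' := by
  obtain ⟨q, r, D, e1, hq, hr, hD, hh⟩ := wt_form n a b c d h
  obtain ⟨q', r', D', e1', hq', hr', hD', hh'⟩ := wt_form n a' b' c' d' h'
  rw [e1, e1'] at e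
  obtain ⟨e2, e3⟩ := dm e hr hr'
  obtain ⟨e4, e5⟩ := dm e2 hq hq'
  obtain ⟨_, _, _, _⟩ := h
  obtain ⟨_, _, _, _⟩ := h'
  omega

lemma le_wt (n a b c d : ℕ) (hn : 0 < n) : a ≤ wt n a b c d := by
  have : a * 1 ≤ a * (n ^ 2 + 2 * n) := Nat.mul_le_mul_left _ (by nlinarith)
  unfold wt
  have := Nat.zero_le (b * (n ^ 2 + 2 * n + 1))
  have := Nat.zero_le (c * (n ^ 2 + 3 * n + 1))
  have := Nat.zero_le (d * (n ^ 2 + 3 * n + 2))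
  omega

section ring
variable {R : Type*} [CommRing R] (x : Fin 4 → R) (n : ℕ)

/-- Monomial in four ring elements. -/
def M (a b c d : ℕ) : R := x 0 ^ a * x 1 ^ b * x 2 ^ c * x 3 ^ d

lemma reduce (hn : 0 < n)
    (hf : ∀ m, m ≤ n + 1 → x 2 ^ (n + 1 - m) * x 3 ^ m = x 0 ^ (n + 1 - m) * x 1 ^ (m + 1))
    (hh : ∀ t, t ≤ n → x 1 ^ (n + 1 - t) * x 3 ^ t = x 0 ^ (n - t) * x 2 ^ (t + 1))
    (hg1 : x 0 ^ (n + 1) = x 3 ^ n) (hg2 : x 1 * x 2 = x 0 * x 3) (W : ℕ) (j : ℕ) :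
    ∀ a b c d, wt n a b c d = W → W < a + j →
      ∃ a' b' c' d', Nrm n b' c' d' ∧ wt n a' b' c' d' = W ∧ M x a b c d = M x a' b' c' d' := by
  induction j with
  | zero =>
    intro a b c d h1 h2
    have := le_wt n a b c d hn
    omega
  | succ j ih =>
    intro a b c d h1 h2
    by_cases c1 : 0 < b ∧ 0 < c
    · obtain ⟨b, rfl⟩ : ∃ b', b = b' + 1 := ⟨b - 1, by omega⟩
      obtain ⟨c, rfl⟩ : ∃ b', c = b' + 1 := ⟨c - 1, by omega⟩
      obtain ⟨a', b', c', d', p1, p2, p3⟩ := ih (a + 1) b c (d + 1)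
        (by rw [← h1]; unfold wt; ring) (by omega)
      refine ⟨a', b', c', d', p1, p2, ?_⟩
      rw [← p3]; unfold M
      linear_combination (x 0 ^ a * x 1 ^ b * x 2 ^ c * x 3 ^ d) * hg2
    by_cases c2 : n ≤ d
    · obtain ⟨d, rfl⟩ := Nat.exists_eq_add_of_le c2
      obtain ⟨a', b', c', d', p1, p2, p3⟩ := ih (a + (n + 1)) b c d
        (by rw [← h1]; unfold wt; ring) (by omega)
      refine ⟨a', b', c', d', p1, p2, ?_⟩
      rw [← p3]; unfold M
      rw [pow_add, pow_add (x 0)]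
      linear_combination (-(x 0 ^ a * x 1 ^ b * x 2 ^ c * x 3 ^ d)) * hg1
    obtain ⟨e, rfl⟩ : ∃ e, n = d + e := Nat.exists_eq_add_of_le (by omega)
    by_cases c3 : d + e < b + d
    · have h := hh d (by omega)
      rw [show d + e + 1 - d = e + 1 by omega, show d + e - d = e by omega] at h
      obtain ⟨b, rfl⟩ : ∃ b', b = b' + (e + 1) := ⟨b - (e + 1), by omega⟩
      obtain ⟨a', b', c', d', p1, p2, p3⟩ := ih (a + e) b (c + (d + 1)) 0
        (by rw [← h1]; unfold wt; ring) (by omega)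
      refine ⟨a', b', c', d', p1, p2, ?_⟩
      rw [← p3]; unfold M
      rw [pow_add (x 1), pow_add (x 0), pow_add (x 2) c]
      linear_combination (x 0 ^ a * x 1 ^ b * x 2 ^ c) * h
    by_cases c4 : d + e < c + d
    · have h := hf d (by omega)
      rw [show d + e + 1 - d = e + 1 by omega] at h
      obtain ⟨c, rfl⟩ : ∃ b', c = b' + (e + 1) := ⟨c - (e + 1), by omega⟩
      obtain ⟨a', b', c', d', p1, p2, p3⟩ := ih (a + (e + 1)) (b + (d + 1)) c 0
        (by rw [← h1]; unfold wt; ring) (by omega)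
      refine ⟨a', b', c', d', p1, p2, ?_⟩
      rw [← p3]; unfold M
      rw [pow_add (x 1), pow_add (x 0), pow_add (x 2) c]
      linear_combination (x 0 ^ a * x 1 ^ b * x 2 ^ c) * h
    exact ⟨a, b, c, d, ⟨by omega, by omega, by omega, by omega⟩, h1, rfl⟩

lemma same (hn : 0 < n)
    (hf : ∀ m, m ≤ n + 1 → x 2 ^ (n + 1 - m) * x 3 ^ m = x 0 ^ (n + 1 - m) * x 1 ^ (m + 1))
    (hh : ∀ t, t ≤ n → x 1 ^ (n + 1 - t) * x 3 ^ t = x 0 ^ (n - t) * x 2 ^ (t + 1))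
    (hg1 : x 0 ^ (n + 1) = x 3 ^ n) (hg2 : x 1 * x 2 = x 0 * x 3)
    (a b c d a' b' c' d' : ℕ) (e : wt n a b c d = wt n a' b' c' d') :
    M x a b c d = M x a' b' c' d' := by
  obtain ⟨a1, b1, c1, d1, p1, p2, p3⟩ := reduce x n hn hf hh hg1 hg2 _ (wt n a b c d + 1)
    a b c d rfl (by omega)
  obtain ⟨a2, b2, c2, d2, q1, q2, q3⟩ := reduce x n hn hf hh hg1 hg2 _ (wt n a' b' c' d' + 1)
    a' b' c' d' rfl (by omega)
  obtain ⟨rfl, rfl, rfl, rfl⟩ := nrm_unique n _ _ _ _ _ _ _ _ p1 q1 (by rw [p2, q2, e])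
  rw [p3, q3]

end ring

lemma ker_le {k : Type*} [Field k] (n : ℕ) (w : (Fin 4 →₀ ℕ) → ℕ)
    (φ : MvPolynomial (Fin 4) k →ₐ[k] Polynomial k)
    (hφ : ∀ m, φ (monomial m 1) = Polynomial.X ^ (w m))
    (I : Ideal (MvPolynomial (Fin 4) k))
    (hI : ∀ m m', w m = w m' →
      Ideal.Quotient.mk I (monomial m 1) = Ideal.Quotient.mk I (monomial m' 1)) :
    RingHom.ker φ ≤ I := by
  classical
  let rep : ℕ → (MvPolynomial (Fin 4) k ⧸ I) := fun j =>
    if h : ∃ m, w m = j then Ideal.Quotient.mk I (monomial h.choose 1) else 0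
  let Ψ : Polynomial k →ₗ[k] (MvPolynomial (Fin 4) k ⧸ I) :=
    (Polynomial.basisMonomials k).constr k rep
  have hΨ : ∀ j, Ψ (Polynomial.X ^ j) = rep j := by
    intro j
    have := (Polynomial.basisMonomials k).constr_basis k rep j
    rw [Polynomial.coe_basisMonomials] at this
    rw [← Polynomial.monomial_one_right_eq_X_pow]
    exact this
  have key : Ψ ∘ₗ φ.toLinearMap = (Ideal.Quotient.mkₐ k I).toLinearMap := by
    refine (basisMonomials (Fin 4) k).ext fun m => ?_
    simp only [coe_basisMonomials, LinearMap.comp_apply, AlgHom.toLinearMap_apply, hφ, hΨ,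
      Ideal.Quotient.mkₐ_eq_mk]
    have h : ∃ m', w m' = w m := ⟨m, rfl⟩
    simp only [rep, dif_pos h]
    exact hI _ _ h.choose_spec
  intro p hp
  rw [RingHom.mem_ker] at hp
  have := LinearMap.congr_fun key p
  simp only [LinearMap.comp_apply, AlgHom.toLinearMap_apply, Ideal.Quotient.mkₐ_eq_mk] at this
  have hp' : φ p = 0 := hp
  rw [hp', map_zero] at this
  exact Ideal.Quotient.eq_zero_iff_mem.mp this.symm

end St3

theorem statement3 (k : Type*) [Field k] (n : ℕ) (hn : 5 ≤ n) :
    Ideal.span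
        ({p : MvPolynomial (Fin 4) k | ∃ μ : ℕ, μ ≤ n + 1 ∧
            p = X 2 ^ (n + 1 - μ) * X 3 ^ μ - X 0 ^ (n + 1 - μ) * X 1 ^ (μ + 1)} ∪
          {p : MvPolynomial (Fin 4) k | ∃ t : ℕ, t ≤ n ∧
            p = X 1 ^ (n + 1 - t) * X 3 ^ t - X 0 ^ (n - t) * X 2 ^ (t + 1)} ∪
          {X 0 ^ (n + 1) - X 3 ^ n, X 1 * X 2 - X 0 * X 3}) =
      RingHom.ker
        (aeval (![(Polynomial.X : Polynomial k) ^ (n ^ 2 + 2 * n),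
            Polynomial.X ^ (n ^ 2 + 2 * n + 1), Polynomial.X ^ (n ^ 2 + 3 * n + 1),
            Polynomial.X ^ (n ^ 2 + 3 * n + 2)]) :
          MvPolynomial (Fin 4) k →ₐ[k] Polynomial k) := by
  apply le_antisymm
  · rw [Ideal.span_le]
    rintro p ((⟨m, hm, rfl⟩ | ⟨t, ht, rfl⟩) | (rfl | rfl)) <;>
      rw [SetLike.mem_coe, RingHom.mem_ker, map_sub, sub_eq_zero] <;>
      simp only [map_mul, map_pow, aeval_X, Matrix.cons_val, ← pow_mul, ← pow_add] <;>
      congr 1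
    · obtain ⟨e, he⟩ := Nat.exists_eq_add_of_le hm
      rw [he, Nat.add_sub_cancel_left]
      zify at he ⊢
      have : (e : ℤ) = n + 1 - m := by linarith
      rw [this]; ring
    · obtain ⟨e, rfl⟩ := Nat.exists_eq_add_of_le ht
      rw [show t + e + 1 - t = e + 1 by omega, show t + e - t = e by omega]
      ring
    · ring
    · ring
  · refine St3.ker_le n (fun m => St3.wt n (m 0) (m 1) (m 2) (m 3)) _ ?_ _ ?_
    · intro m
      rw [aeval_monomial, map_one, one_mul, Finsupp.prod_fintype _ _ (fun i => pow_zero _)]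
      simp only [Fin.prod_univ_four, Matrix.cons_val, ← pow_mul, ← pow_add]
      congr 1
      unfold St3.wt; ring
    · intro m m' h
      set I := Ideal.span
        ({p : MvPolynomial (Fin 4) k | ∃ μ : ℕ, μ ≤ n + 1 ∧
            p = X 2 ^ (n + 1 - μ) * X 3 ^ μ - X 0 ^ (n + 1 - μ) * X 1 ^ (μ + 1)} ∪
          {p : MvPolynomial (Fin 4) k | ∃ t : ℕ, t ≤ n ∧
            p = X 1 ^ (n + 1 - t) * X 3 ^ t - X 0 ^ (n - t) * X 2 ^ (t + 1)} ∪
          {X 0 ^ (n + 1) - X 3 ^ n, X 1 * X 2 - X 0 * X 3}) with hI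
      let x : Fin 4 → (MvPolynomial (Fin 4) k ⧸ I) := fun i => Ideal.Quotient.mk I (X i)
      have hM : ∀ m : Fin 4 →₀ ℕ, Ideal.Quotient.mk I (monomial m 1) =
          St3.M x (m 0) (m 1) (m 2) (m 3) := by
        intro m
        rw [monomial_eq, map_one, one_mul, Finsupp.prod_fintype _ _ (fun i => pow_zero _)]
        simp only [Fin.prod_univ_four, map_mul, map_pow, St3.M, x]
      rw [hM, hM]
      refine St3.same x n (by omega) ?_ ?_ ?_ ?_ _ _ _ _ _ _ _ _ h
      · intro m hm
        simp only [x, ← map_pow, ← map_mul]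
        exact Ideal.Quotient.eq.mpr (Ideal.subset_span (Or.inl (Or.inl ⟨m, hm, rfl⟩)))
      · intro m hm
        simp only [x, ← map_pow, ← map_mul]
        exact Ideal.Quotient.eq.mpr (Ideal.subset_span (Or.inl (Or.inr ⟨m, hm, rfl⟩)))
      · simp only [x, ← map_pow]
        exact Ideal.Quotient.eq.mpr (Ideal.subset_span (Or.inr (Or.inl rfl)))
      · simp only [x, ← map_mul]
        exact Ideal.Quotient.eq.mpr (Ideal.subset_span (Or.inr (Or.inr rfl)))
end

section
/- Let k be a field and n ≥ 5 an integer, and let J' ⊂ k[x_1, x_2, x_3] be the ideal generated by x_1^{n+1}, x_2^{n+1}, the monomials x_2^{n+1-s} x_3^s for 1 ≤ s ≤ n−1, the monomials x_1^{n+1-s} x_3^s for 1 ≤ s ≤ n−1, x_3^n, and x_1 x_2. Then the quotient ring k[x_1, x_2, x_3]/J' is a k-vector space of dimension n² + 2n. -/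
open MvPolynomial

/-- The exponent vector `(a, b, c)`. -/
noncomputable def expVec (a b c : ℕ) : Fin 3 →₀ ℕ :=
  Finsupp.single 0 a + Finsupp.single 1 b + Finsupp.single 2 c

theorem expVec_zero (a b c : ℕ) : expVec a b c 0 = a := by simp [expVec]
theorem expVec_one (a b c : ℕ) : expVec a b c 1 = b := by simp [expVec]
theorem expVec_two (a b c : ℕ) : expVec a b c 2 = c := by simp [expVec]

theorem expVec_le (a b c : ℕ) (m : Fin 3 →₀ ℕ) :
    expVec a b c ≤ m ↔ a ≤ m 0 ∧ b ≤ m 1 ∧ c ≤ m 2 := by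
  rw [Finsupp.le_def]
  simp [Fin.forall_fin_succ, expVec_zero, expVec_one, expVec_two]

theorem expVec_eq (a b c : ℕ) (m : Fin 3 →₀ ℕ) :
    expVec a b c = m ↔ a = m 0 ∧ b = m 1 ∧ c = m 2 := by
  rw [Finsupp.ext_iff]
  simp [Fin.forall_fin_succ, expVec_zero, expVec_one, expVec_two]

theorem monomial_expVec (k : Type*) [Field k] (a b c : ℕ) :
    monomial (expVec a b c) (1 : k) = X 0 ^ a * X 1 ^ b * X 2 ^ c := by
  simp [expVec, X_pow_eq_monomial, monomial_mul]

/-- Exponents of the generators. -/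
def genExp (n : ℕ) : Set (Fin 3 →₀ ℕ) :=
  ({expVec (n + 1) 0 0, expVec 0 (n + 1) 0, expVec 0 0 n, expVec 1 1 0} ∪
    {m | ∃ s : ℕ, 1 ≤ s ∧ s ≤ n - 1 ∧ m = expVec 0 (n + 1 - s) s}) ∪
    {m | ∃ s : ℕ, 1 ≤ s ∧ s ≤ n - 1 ∧ m = expVec (n + 1 - s) 0 s}

theorem image_genExp (k : Type*) [Field k] (n : ℕ) :
    (fun m => monomial m (1 : k)) '' genExp n =
      ({X 0 ^ (n + 1), X 1 ^ (n + 1), X 2 ^ n, X 0 * X 1} ∪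
            {p : MvPolynomial (Fin 3) k | ∃ s : ℕ, 1 ≤ s ∧ s ≤ n - 1 ∧
              p = X 1 ^ (n + 1 - s) * X 2 ^ s} ∪
            {p : MvPolynomial (Fin 3) k | ∃ s : ℕ, 1 ≤ s ∧ s ≤ n - 1 ∧
              p = X 0 ^ (n + 1 - s) * X 2 ^ s}) := by
  rw [genExp, Set.image_union, Set.image_union]
  congr 1
  · congr 1
    · simp only [Set.image_insert_eq, Set.image_singleton, monomial_expVec]
      simp
    · ext p
      constructor
      · rintro ⟨_, ⟨s, h1, h2, rfl⟩, rfl⟩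
        exact ⟨s, h1, h2, by simp [monomial_expVec]⟩
      · rintro ⟨s, h1, h2, rfl⟩
        exact ⟨_, ⟨s, h1, h2, rfl⟩, by simp [monomial_expVec]⟩
  · ext p
    constructor
    · rintro ⟨_, ⟨s, h1, h2, rfl⟩, rfl⟩
      exact ⟨s, h1, h2, by simp [monomial_expVec]⟩
    · rintro ⟨s, h1, h2, rfl⟩
      exact ⟨_, ⟨s, h1, h2, rfl⟩, by simp [monomial_expVec]⟩

theorem genExp_le (n : ℕ) (m : Fin 3 →₀ ℕ) :
    (∃ e ∈ genExp n, e ≤ m) ↔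
      ¬ (m 2 < n ∧ (m 0 = 0 ∨ m 1 = 0) ∧ m 0 + m 2 ≤ n ∧ m 1 + m 2 ≤ n) := by
  constructor
  · rintro ⟨e, he, hle⟩
    rcases he with (((rfl | rfl | rfl | rfl) | ⟨s, h1, h2, rfl⟩) | ⟨s, h1, h2, rfl⟩) <;>
    · rw [expVec_le] at hle
      omega
  · intro h
    by_cases h1 : n ≤ m 2
    · exact ⟨expVec 0 0 n, by simp [genExp], by rw [expVec_le]; omega⟩
    by_cases h2 : 1 ≤ m 0 ∧ 1 ≤ m 1
    · exact ⟨expVec 1 1 0, by simp [genExp], by rw [expVec_le]; omega⟩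
    by_cases h3 : n + 1 ≤ m 0
    · exact ⟨expVec (n + 1) 0 0, by simp [genExp], by rw [expVec_le]; omega⟩
    by_cases h4 : n + 1 ≤ m 1
    · exact ⟨expVec 0 (n + 1) 0, by simp [genExp], by rw [expVec_le]; omega⟩
    by_cases h5 : n + 1 ≤ m 0 + m 2
    · exact ⟨expVec (n + 1 - m 2) 0 (m 2), Or.inr ⟨m 2, by omega, by omega, rfl⟩,
        by rw [expVec_le]; omega⟩
    · exact ⟨expVec 0 (n + 1 - m 2) (m 2), Or.inl (Or.inr ⟨m 2, by omega, by omega, rfl⟩),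
        by rw [expVec_le]; omega⟩

/-- Index type of the standard monomials. -/
abbrev StdIdx (n : ℕ) : Type := Σ c : Fin n, Fin (2 * (n - c) + 1)

/-- The standard monomials. -/
noncomputable def stdExp (n : ℕ) (t : StdIdx n) : Fin 3 →₀ ℕ :=
  if t.2.1 ≤ n - t.1.1 then expVec t.2.1 0 t.1.1 else expVec 0 (t.2.1 - (n - t.1.1)) t.1.1

theorem stdExp_inj (n : ℕ) : Function.Injective (stdExp n) := by
  rintro ⟨⟨c, hc⟩, ⟨i, hi⟩⟩ ⟨⟨d, hd⟩, ⟨j, hj⟩⟩ h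
  simp only [stdExp] at h hi hj
  have : c = d ∧ i = j := by
    split_ifs at h <;> rw [expVec_eq] at h <;>
      simp only [expVec_zero, expVec_one, expVec_two] at h <;> 
      (obtain ⟨h1, h2, rfl⟩ := h; omega)
  obtain ⟨rfl, rfl⟩ := this
  rfl

theorem stdExp_range (n : ℕ) (m : Fin 3 →₀ ℕ) :
    (∃ t, stdExp n t = m) ↔
      (m 2 < n ∧ (m 0 = 0 ∨ m 1 = 0) ∧ m 0 + m 2 ≤ n ∧ m 1 + m 2 ≤ n) := by
  constructor
  · rintro ⟨⟨⟨c, hc⟩, ⟨i, hi⟩⟩, rfl⟩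
    simp only [stdExp] at hi ⊢
    split_ifs <;> simp only [expVec_zero, expVec_one, expVec_two] <;>
      exact ⟨by omega, by simp, by omega, by omega⟩
  · rintro ⟨h1, h2, h3, h4⟩
    by_cases hb : m 1 = 0
    · refine ⟨⟨⟨m 2, h1⟩, ⟨m 0, by simp only; omega⟩⟩, ?_⟩
      simp only [stdExp]
      rw [if_pos (by omega), expVec_eq]
      omega
    · refine ⟨⟨⟨m 2, h1⟩, ⟨m 1 + (n - m 2), by simp only; omega⟩⟩, ?_⟩
      simp only [stdExp]
      rw [if_neg (by omega), expVec_eq]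
      omega

theorem sum_aux (n : ℕ) : ∑ c : Fin n, (2 * (n - (c : ℕ)) + 1) = n ^ 2 + 2 * n := by
  rw [Fin.sum_univ_eq_sum_range (fun c => 2 * (n - c) + 1) n,
    ← Finset.sum_range_reflect]
  have h : ∀ j ∈ Finset.range n, 2 * (n - (n - 1 - j)) + 1 = 2 * j + 3 := by
    intro j hj
    rw [Finset.mem_range] at hj
    omega
  rw [Finset.sum_congr rfl h]
  clear h
  induction n with
  | zero => simp
  | succ n ih => rw [Finset.sum_range_succ, ih]; ring

/-- Coefficients at the standard monomials. -/
noncomputable def coeffMap (k : Type*) [Field k] (n : ℕ) :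
    MvPolynomial (Fin 3) k →ₗ[k] (StdIdx n → k) :=
  LinearMap.pi fun t => lcoeff k (stdExp n t)

theorem coeffMap_surj (k : Type*) [Field k] (n : ℕ) : Function.Surjective (coeffMap k n) := by
  classical
  intro v
  refine ⟨∑ t, monomial (stdExp n t) (v t), ?_⟩
  funext t
  simp [coeffMap, coeff_sum, coeff_monomial, (stdExp_inj n).eq_iff]

theorem ker_coeffMap (k : Type*) [Field k] (n : ℕ) :
    (Ideal.span ((fun m => monomial m (1 : k)) '' genExp n)).restrictScalars k =
      LinearMap.ker (coeffMap k n) := by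
  ext p
  rw [Submodule.restrictScalars_mem, mem_ideal_span_monomial_image, LinearMap.mem_ker]
  simp only [genExp_le, ← stdExp_range]
  constructor
  · intro h
    funext t
    by_contra hne
    exact h (stdExp n t) (mem_support_iff.mpr hne) ⟨t, rfl⟩
  · rintro h m hm ⟨t, rfl⟩
    exact mem_support_iff.mp hm (congrFun h t)

/-- Here the variables `X 0, X 1, X 2` of `MvPolynomial (Fin 3) k` play the roles of
`x₁, x₂, x₃` respectively. -/
theorem statement4 (k : Type*) [Field k] (n : ℕ) (hn : 5 ≤ n) :
    Module.finrank k
      (MvPolynomial (Fin 3) k ⧸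
        Ideal.span
          ({X 0 ^ (n + 1), X 1 ^ (n + 1), X 2 ^ n, X 0 * X 1} ∪
            {p : MvPolynomial (Fin 3) k | ∃ s : ℕ, 1 ≤ s ∧ s ≤ n - 1 ∧
              p = X 1 ^ (n + 1 - s) * X 2 ^ s} ∪
            {p : MvPolynomial (Fin 3) k | ∃ s : ℕ, 1 ≤ s ∧ s ≤ n - 1 ∧
              p = X 0 ^ (n + 1 - s) * X 2 ^ s})) = n ^ 2 + 2 * n := by
  rw [← image_genExp]
  have e1 := (Submodule.Quotient.restrictScalarsEquiv k
    (Ideal.span ((fun m => monomial m (1 : k)) '' genExp n))).symm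
  have e2 := Submodule.quotEquivOfEq _ _ (ker_coeffMap k n)
  have e3 := (coeffMap k n).quotKerEquivOfSurjective (coeffMap_surj k n)
  refine ((e1.trans e2).trans e3).finrank_eq.trans ?_
  rw [Module.finrank_fintype_fun_eq_card, Fintype.card_sigma]
  simp only [Fintype.card_fin]
  exact sum_aux n
end

section
/- Let k be a field and n ≥ 5 an integer, and let 𝒬_{(n,4,0)} ⊂ k[x_0, x_1, x_2, x_3] be the kernel of the k-algebra homomorphism φ with φ(x_i) = t^{n_i} for n_0 = n²+2n, n_1 = n²+2n+1, n_2 = n²+3n+1, n_3 = n²+3n+2. Define A'_1 = {f_μ = x_2^{n+1-μ} x_3^μ − x_0^{n+1-μ} x_1^{μ+1} : 1 ≤ μ ≤ n−1}, A_2 = {h_t = x_1^{n+1-t} x_3^t − x_0^{n-t} x_2^{t+1} : 0 ≤ t ≤ n}, g_1 = x_0^{n+1} − x_3^n, g_2 = x_1 x_2 − x_0 x_3. Then A'_1 ∪ A_2 ∪ {g_1, g_2} is a minimal generating set of 𝒬_{(n,4,0)}: it generates the ideal 𝒬_{(n,4,0)}, and no element of this set belongs to the ideal generated by the remaining elements.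 -/
open MvPolynomial

/-- The monomial `x_0^a x_1^b x_2^c x_3^d`. -/
noncomputable def mon (k : Type*) [Field k] (a b c d : ℕ) : MvPolynomial (Fin 4) k :=
  X 0 ^ a * X 1 ^ b * X 2 ^ c * X 3 ^ d

/-- The exponent vector. -/
noncomputable def ex (a b c d : ℕ) : Fin 4 →₀ ℕ :=
  Finsupp.equivFunOnFinite.symm ![a, b, c, d]

theorem mon_eq (k : Type*) [Field k] (a b c d : ℕ) :
    mon k a b c d = monomial (ex a b c d) 1 := by
  rw [monomial_eq, Finsupp.prod_fintype _ _ (by simp)]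
  simp [mon, ex, Fin.prod_univ_four]

theorem mon_mul (k : Type*) [Field k] (a b c d a' b' c' d' : ℕ) :
    mon k a b c d * mon k a' b' c' d' = mon k (a + a') (b + b') (c + c') (d + d') := by
  simp only [mon]; ring

/-- Ideal spanned by monomials not dividing `u`. -/
noncomputable def nd (k : Type*) [Field k] (u : Fin 4 →₀ ℕ) : Ideal (MvPolynomial (Fin 4) k) :=
  Ideal.span ((fun s => monomial s (1 : k)) '' {s | ¬ s ≤ u})

theorem ex_le (a b c d a' b' c' d' : ℕ) :
    ex a b c d ≤ ex a' b' c' d' ↔ (a ≤ a' ∧ b ≤ b' ∧ c ≤ c' ∧ d ≤ d') := by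
  rw [Finsupp.le_def, Fin.forall_fin_succ, Fin.forall_fin_succ, Fin.forall_fin_succ,
    Fin.forall_fin_one]
  simp [ex]

theorem mon_mem_nd (k : Type*) [Field k] (a b c d a' b' c' d' : ℕ)
    (h : ¬ (a ≤ a' ∧ b ≤ b' ∧ c ≤ c' ∧ d ≤ d')) :
    mon k a b c d ∈ nd k (ex a' b' c' d') := by
  rw [mon_eq]
  exact Ideal.subset_span ⟨_, by simpa [ex_le] using h, rfl⟩

theorem mon_not_mem_nd (k : Type*) [Field k] (a b c d : ℕ) :
    mon k a b c d ∉ nd k (ex a b c d) := by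
  rw [mon_eq, nd, mem_ideal_span_monomial_image]
  intro h
  obtain ⟨s, hs, hle⟩ := h (ex a b c d) (by simp)
  exact hs hle

theorem notin (k : Type*) [Field k] (G : Set (MvPolynomial (Fin 4) k)) (p) (a b c d a' b' c' d' : ℕ)
    (hp : p = mon k a b c d - mon k a' b' c' d')
    (h' : ¬ (a' ≤ a ∧ b' ≤ b ∧ c' ≤ c ∧ d' ≤ d))
    (hG : ∀ q ∈ G, q ≠ p → q ∈ nd k (ex a b c d)) : p ∉ Ideal.span (G \ {p}) := by
  intro h
  have h1 : Ideal.span (G \ {p}) ≤ nd k (ex a b c d) :=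
    Ideal.span_le.2 fun q hq => hG q hq.1 hq.2
  have h2 := h1 h
  rw [hp] at h2
  apply mon_not_mem_nd k a b c d
  have := Ideal.add_mem _ h2 (mon_mem_nd k a' b' c' d' a b c d h')
  simpa using this

theorem notin' (k : Type*) [Field k] (G : Set (MvPolynomial (Fin 4) k)) (p)
    (a b c d a' b' c' d' : ℕ)
    (hp : p = mon k a' b' c' d' - mon k a b c d)
    (h' : ¬ (a' ≤ a ∧ b' ≤ b ∧ c' ≤ c ∧ d' ≤ d))
    (hG : ∀ q ∈ G, q ≠ p → q ∈ nd k (ex a b c d)) : p ∉ Ideal.span (G \ {p}) := by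
  intro h
  have h1 : Ideal.span (G \ {p}) ≤ nd k (ex a b c d) :=
    Ideal.span_le.2 fun q hq => hG q hq.1 hq.2
  have h2 := h1 h
  rw [hp] at h2
  apply mon_not_mem_nd k a b c d
  have := sub_mem (mon_mem_nd k a' b' c' d' a b c d h') h2
  simpa using this

/-- The weight of a monomial. -/
def wt (n a b c d : ℕ) : ℕ :=
  (n ^ 2 + 2 * n) * a + (n ^ 2 + 2 * n + 1) * b + (n ^ 2 + 3 * n + 1) * c
    + (n ^ 2 + 3 * n + 2) * d

def Nrm (n b c d : ℕ) : Prop := (b = 0 ∨ c = 0) ∧ b + d ≤ n ∧ c + d ≤ n ∧ d + 1 ≤ n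

theorem divuniq {N q r q' r' : ℕ} (h : N * q + r = N * q' + r') (hr : r < N) (hr' : r' < N) :
    q = q' ∧ r = r' := by
  have hq : q = q' := by
    rcases lt_trichotomy q q' with h1 | h1 | h1
    · nlinarith [Nat.mul_le_mul_left N (Nat.succ_le_of_lt h1)]
    · exact h1
    · nlinarith [Nat.mul_le_mul_left N (Nat.succ_le_of_lt h1)]
  subst hq
  exact ⟨rfl, by omega⟩

theorem nrm_lt {n b c d : ℕ} (h : Nrm n b c d) : (n + 1) * (c + d) + (b + d) < n ^ 2 + 2 * n := by
  obtain ⟨h1, h2, h3, h4⟩ := h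
  rcases h1 with h1 | h1
  · nlinarith [Nat.mul_le_mul_left (n + 1) h3]
  · have : c + d + 1 ≤ n := by omega
    nlinarith [Nat.mul_le_mul_left (n + 1) this]

theorem nrm_uniq {n a b c d a' b' c' d' : ℕ} (h : Nrm n b c d) (h' : Nrm n b' c' d')
    (hw : wt n a b c d = wt n a' b' c' d') : a = a' ∧ b = b' ∧ c = c' ∧ d = d' := by
  have e : ∀ a b c d, wt n a b c d =
      (n ^ 2 + 2 * n) * (a + b + c + d) + ((n + 1) * (c + d) + (b + d)) := by
    intros; simp only [wt]; ring
  rw [e, e] at hw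
  obtain ⟨h1, h2⟩ := divuniq hw (nrm_lt h) (nrm_lt h')
  obtain ⟨g1, g2, g3, g4⟩ := h
  obtain ⟨g1', g2', g3', g4'⟩ := h'
  obtain ⟨h3, h4⟩ := divuniq h2 (by omega) (by omega)
  omega

section
variable {k : Type*} [Field k] {n : ℕ} {I : Ideal (MvPolynomial (Fin 4) k)}

theorem shift {a b c d a' b' c' d' : ℕ} (h : mon k a b c d - mon k a' b' c' d' ∈ I)
    (e f g i : ℕ) :
    mon k (e + a) (f + b) (g + c) (i + d) - mon k (e + a') (f + b') (g + c') (i + d') ∈ I := by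
  rw [← mon_mul, ← mon_mul, ← mul_sub]
  exact Ideal.mul_mem_left _ _ h

theorem exists_nrm (hn : 5 ≤ n)
    (hf : ∀ μ, μ + 1 ≤ n → mon k 0 0 (n + 1 - μ) μ - mon k (n + 1 - μ) (μ + 1) 0 0 ∈ I)
    (hh : ∀ t, t ≤ n → mon k 0 (n + 1 - t) 0 t - mon k (n - t) 0 (t + 1) 0 ∈ I)
    (hg1 : mon k 0 0 0 n - mon k (n + 1) 0 0 0 ∈ I)
    (hg2 : mon k 0 1 1 0 - mon k 1 0 0 1 ∈ I) :
    ∀ M a b c d, 3 * b + 4 * c + 4 * d = M → ∃ a' b' c' d', Nrm n b' c' d' ∧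
      wt n a b c d = wt n a' b' c' d' ∧ mon k a b c d - mon k a' b' c' d' ∈ I := by
  intro M
  induction M using Nat.strong_induction_on with
  | _ M ih =>
  intro a b c d hM
  have key : ∀ a₁ b₁ c₁ d₁, 3 * b₁ + 4 * c₁ + 4 * d₁ < M → wt n a b c d = wt n a₁ b₁ c₁ d₁ →
      mon k a b c d - mon k a₁ b₁ c₁ d₁ ∈ I → ∃ a' b' c' d', Nrm n b' c' d' ∧
      wt n a b c d = wt n a' b' c' d' ∧ mon k a b c d - mon k a' b' c' d' ∈ I := by
    intro a₁ b₁ c₁ d₁ hlt hw hm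
    obtain ⟨a', b', c', d', h1, h2, h3⟩ := ih _ hlt a₁ b₁ c₁ d₁ rfl
    refine ⟨a', b', c', d', h1, hw.trans h2, ?_⟩
    have := Ideal.add_mem _ hm h3
    simpa using this
  by_cases c1 : 1 ≤ b ∧ 1 ≤ c
  · obtain ⟨b, rfl⟩ := Nat.exists_eq_add_of_le' c1.1
    obtain ⟨c, rfl⟩ := Nat.exists_eq_add_of_le' c1.2
    exact key (a + 1) b c (d + 1) (by omega) (by simp only [wt]; ring) (shift hg2 a b c d)
  by_cases c2 : n ≤ d
  · obtain ⟨d, rfl⟩ := Nat.exists_eq_add_of_le' c2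
    exact key (a + (n + 1)) b c d (by omega) (by simp only [wt]; ring) (shift hg1 a b c d)
  by_cases c3 : n + 1 ≤ c + d
  · obtain ⟨m, hm⟩ : ∃ m, n = d + m := ⟨n - d, by omega⟩
    obtain ⟨c, rfl⟩ := Nat.exists_eq_add_of_le' (show m + 1 ≤ c by omega)
    have := shift (hf d (by omega)) a b c 0
    have e : n + 1 - d = m + 1 := by omega
    rw [e] at this
    simp only [add_zero, zero_add] at this
    exact key (a + (m + 1)) (b + (d + 1)) c 0 (by omega)
      (by rw [hm]; simp only [wt]; ring) this
  by_cases c4 : n + 1 ≤ b + d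
  · obtain ⟨m, hm⟩ : ∃ m, n = d + m := ⟨n - d, by omega⟩
    obtain ⟨b, rfl⟩ := Nat.exists_eq_add_of_le' (show m + 1 ≤ b by omega)
    have := shift (hh d (by omega)) a b c 0
    have e : n + 1 - d = m + 1 := by omega
    have e' : n - d = m := by omega
    rw [e, e'] at this
    simp only [add_zero, zero_add] at this
    exact key (a + m) b (c + (d + 1)) 0 (by omega)
      (by rw [hm]; simp only [wt]; ring) this
  exact ⟨a, b, c, d, ⟨by omega, by omega, by omega, by omega⟩, rfl, by simp⟩

theorem aeval_mon (n a b c d : ℕ) :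
    (aeval (![(Polynomial.X : Polynomial k) ^ (n ^ 2 + 2 * n),
            Polynomial.X ^ (n ^ 2 + 2 * n + 1), Polynomial.X ^ (n ^ 2 + 3 * n + 1),
            Polynomial.X ^ (n ^ 2 + 3 * n + 2)]) :
          MvPolynomial (Fin 4) k →ₐ[k] Polynomial k) (mon k a b c d)
      = Polynomial.X ^ wt n a b c d := by
  simp [mon, wt, pow_add, pow_mul]

theorem ker_le (φ : MvPolynomial (Fin 4) k →ₐ[k] Polynomial k)
    (hφ : ∀ a b c d, φ (mon k a b c d) = Polynomial.X ^ wt n a b c d)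
    (h : ∀ a b c d a' b' c' d', wt n a b c d = wt n a' b' c' d' →
      mon k a b c d - mon k a' b' c' d' ∈ I) : RingHom.ker φ ≤ I := by
  classical
  let r : ℕ → MvPolynomial (Fin 4) k := fun w =>
    if hw : ∃ x : ℕ × ℕ × ℕ × ℕ, wt n x.1 x.2.1 x.2.2.1 x.2.2.2 = w then
      mon k hw.choose.1 hw.choose.2.1 hw.choose.2.2.1 hw.choose.2.2.2 else 0
  have hr : ∀ a b c d, mon k a b c d - r (wt n a b c d) ∈ I := by
    intro a b c d
    have hw : ∃ x : ℕ × ℕ × ℕ × ℕ, wt n x.1 x.2.1 x.2.2.1 x.2.2.2 = wt n a b c d :=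
      ⟨(a, b, c, d), rfl⟩
    simp only [r, dif_pos hw]
    exact h _ _ _ _ _ _ _ _ hw.choose_spec.symm
  let ψ : Polynomial k →ₗ[k] MvPolynomial (Fin 4) k :=
    (Polynomial.basisMonomials k).constr k r
  have hψ : ∀ w, ψ (Polynomial.X ^ w) = r w := by
    intro w
    have := (Polynomial.basisMonomials k).constr_basis k r w
    rw [Polynomial.coe_basisMonomials] at this
    beta_reduce at this
    rwa [Polynomial.monomial_one_right_eq_X_pow] at this
  have main : ∀ p, p - ψ (φ p) ∈ I := by
    intro p
    induction p using MvPolynomial.induction_on' with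
    | monomial u c =>
      have hu : u = ex (u 0) (u 1) (u 2) (u 3) := by
        ext i; fin_cases i <;> simp [ex]
      have e : monomial u c = C c * mon k (u 0) (u 1) (u 2) (u 3) := by
        rw [mon_eq, ← hu, C_mul_monomial, mul_one]
      rw [e, ← smul_eq_C_mul, map_smul, map_smul, ← smul_sub, hφ, hψ, smul_eq_C_mul]
      exact Ideal.mul_mem_left _ _ (hr _ _ _ _)
    | add p q hp hq =>
      rw [map_add, map_add, add_sub_add_comm]
      exact Ideal.add_mem _ hp hq
  intro p hp
  have := main p
  rw [RingHom.mem_ker] at hp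
  rwa [hp, map_zero, sub_zero] at this

end

theorem statement5 (k : Type*) [Field k] (n : ℕ) (hn : 5 ≤ n)
    (G : Set (MvPolynomial (Fin 4) k))
    (hG : G = {p : MvPolynomial (Fin 4) k | ∃ μ : ℕ, 1 ≤ μ ∧ μ ≤ n - 1 ∧
            p = X 2 ^ (n + 1 - μ) * X 3 ^ μ - X 0 ^ (n + 1 - μ) * X 1 ^ (μ + 1)} ∪
          {p : MvPolynomial (Fin 4) k | ∃ t : ℕ, t ≤ n ∧
            p = X 1 ^ (n + 1 - t) * X 3 ^ t - X 0 ^ (n - t) * X 2 ^ (t + 1)} ∪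
          {X 0 ^ (n + 1) - X 3 ^ n, X 1 * X 2 - X 0 * X 3}) :
    Ideal.span G =
      RingHom.ker
        (aeval (![(Polynomial.X : Polynomial k) ^ (n ^ 2 + 2 * n),
            Polynomial.X ^ (n ^ 2 + 2 * n + 1), Polynomial.X ^ (n ^ 2 + 3 * n + 1),
            Polynomial.X ^ (n ^ 2 + 3 * n + 2)]) :
          MvPolynomial (Fin 4) k →ₐ[k] Polynomial k) ∧
    ∀ p ∈ G, p ∉ Ideal.span (G \ {p}) := by
  have hmem : ∀ p, p ∈ G ↔ ((∃ μ : ℕ, 1 ≤ μ ∧ μ + 1 ≤ n ∧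
      p = mon k 0 0 (n + 1 - μ) μ - mon k (n + 1 - μ) (μ + 1) 0 0) ∨
      (∃ t : ℕ, t ≤ n ∧ p = mon k 0 (n + 1 - t) 0 t - mon k (n - t) 0 (t + 1) 0) ∨
      p = mon k (n + 1) 0 0 0 - mon k 0 0 0 n ∨ p = mon k 0 1 1 0 - mon k 1 0 0 1) := by
    intro p
    have e : ∀ μ, μ + 1 ≤ n ↔ μ ≤ n - 1 := by intro μ; omega
    rw [hG]
    simp [mon, e]
    have aux : ∀ A B C D : Prop, (A ∨ B ∨ C ∨ D) ↔ (C ∨ D ∨ A ∨ B) := by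
      intros; tauto
    exact aux _ _ _ _
  clear hG
  constructor
  · apply le_antisymm
    · rw [Ideal.span_le]
      intro p hp
      rw [SetLike.mem_coe, RingHom.mem_ker]
      rcases (hmem p).1 hp with ⟨μ, h1, h2, rfl⟩ | ⟨t, h2, rfl⟩ | rfl | rfl
      · rw [map_sub, aeval_mon, aeval_mon, sub_eq_zero]
        congr 1
        obtain ⟨m, rfl⟩ := Nat.exists_eq_add_of_le' h2
        rw [show m + (μ + 1) + 1 - μ = m + 2 by omega]
        simp only [wt]; ring
      · rw [map_sub, aeval_mon, aeval_mon, sub_eq_zero]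
        congr 1
        obtain ⟨m, rfl⟩ := Nat.exists_eq_add_of_le' h2
        rw [show m + t + 1 - t = m + 1 by omega, show m + t - t = m by omega]
        simp only [wt]; ring
      · rw [map_sub, aeval_mon, aeval_mon, sub_eq_zero]
        congr 1
        simp only [wt]; ring
      · rw [map_sub, aeval_mon, aeval_mon, sub_eq_zero]
        congr 1
        simp only [wt]; ring
    · have hg1' : mon k (n + 1) 0 0 0 - mon k 0 0 0 n ∈ Ideal.span G :=
        Ideal.subset_span ((hmem _).2 (by tauto))
      have hg1 : mon k 0 0 0 n - mon k (n + 1) 0 0 0 ∈ Ideal.span G := by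
        rw [← neg_sub]; exact neg_mem hg1'
      have hg2 : mon k 0 1 1 0 - mon k 1 0 0 1 ∈ Ideal.span G :=
        Ideal.subset_span ((hmem _).2 (by tauto))
      have hh : ∀ t, t ≤ n → mon k 0 (n + 1 - t) 0 t - mon k (n - t) 0 (t + 1) 0
          ∈ Ideal.span G :=
        fun t ht => Ideal.subset_span ((hmem _).2 (Or.inr (Or.inl ⟨t, ht, rfl⟩)))
      have hf : ∀ μ, μ + 1 ≤ n → mon k 0 0 (n + 1 - μ) μ - mon k (n + 1 - μ) (μ + 1) 0 0
          ∈ Ideal.span G := by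
        intro μ hμ
        rcases Nat.eq_zero_or_pos μ with rfl | h0
        · have h1 := hh n le_rfl
          have h2 := shift hg1 0 1 0 0
          rw [show n + 1 - n = 1 by omega, Nat.sub_self] at h1
          simp only [add_zero, zero_add] at h2
          have := sub_mem h2 h1
          simpa using this
        · exact Ideal.subset_span ((hmem _).2 (Or.inl ⟨μ, h0, hμ, rfl⟩))
      apply ker_le _ (aeval_mon n)
      intro a b c d a' b' c' d' hw
      obtain ⟨a₁, b₁, c₁, d₁, n1, w1, m1⟩ := exists_nrm hn hf hh hg1 hg2 _ a b c d rfl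
      obtain ⟨a₂, b₂, c₂, d₂, n2, w2, m2⟩ := exists_nrm hn hf hh hg1 hg2 _ a' b' c' d' rfl
      obtain ⟨rfl, rfl, rfl, rfl⟩ := nrm_uniq n1 n2 (w1.symm.trans (hw.trans w2))
      have := sub_mem m1 m2
      simpa using this
  · intro p hp
    rcases (hmem p).1 hp with ⟨μ, h1, h2, hpe⟩ | ⟨t, h2, hpe⟩ | hpe | hpe
    · refine notin k G p _ _ _ _ _ _ _ _ hpe (by omega) ?_
      intro q hq hne
      rcases (hmem q).1 hq with ⟨ν, g1, g2, hqe⟩ | ⟨s, g2, hqe⟩ | hqe | hqe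
      · have hne' : ν ≠ μ := by rintro rfl; exact hne (hqe.trans hpe.symm)
        rw [hqe]
        exact sub_mem (mon_mem_nd _ _ _ _ _ _ _ _ _ (by omega))
          (mon_mem_nd _ _ _ _ _ _ _ _ _ (by omega))
      all_goals
        rw [hqe]
        exact sub_mem (mon_mem_nd _ _ _ _ _ _ _ _ _ (by omega))
          (mon_mem_nd _ _ _ _ _ _ _ _ _ (by omega))
    · rcases Nat.lt_or_ge t n with ht | ht
      · refine notin k G p _ _ _ _ _ _ _ _ hpe (by omega) ?_
        intro q hq hne
        rcases (hmem q).1 hq with ⟨ν, g1, g2, hqe⟩ | ⟨s, g2, hqe⟩ | hqe | hqe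
        · rw [hqe]
          exact sub_mem (mon_mem_nd _ _ _ _ _ _ _ _ _ (by omega))
            (mon_mem_nd _ _ _ _ _ _ _ _ _ (by omega))
        · have hne' : s ≠ t := by rintro rfl; exact hne (hqe.trans hpe.symm)
          rw [hqe]
          exact sub_mem (mon_mem_nd _ _ _ _ _ _ _ _ _ (by omega))
            (mon_mem_nd _ _ _ _ _ _ _ _ _ (by omega))
        all_goals
          rw [hqe]
          exact sub_mem (mon_mem_nd _ _ _ _ _ _ _ _ _ (by omega))
            (mon_mem_nd _ _ _ _ _ _ _ _ _ (by omega))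
      · -- here `t = n`, use the other monomial
        refine notin' k G p _ _ _ _ _ _ _ _ hpe (by omega) ?_
        intro q hq hne
        rcases (hmem q).1 hq with ⟨ν, g1, g2, hqe⟩ | ⟨s, g2, hqe⟩ | hqe | hqe
        · rw [hqe]
          exact sub_mem (mon_mem_nd _ _ _ _ _ _ _ _ _ (by omega))
            (mon_mem_nd _ _ _ _ _ _ _ _ _ (by omega))
        · have hne' : s ≠ t := by rintro rfl; exact hne (hqe.trans hpe.symm)
          rw [hqe]
          exact sub_mem (mon_mem_nd _ _ _ _ _ _ _ _ _ (by omega))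
            (mon_mem_nd _ _ _ _ _ _ _ _ _ (by omega))
        · rw [hqe]
          exact sub_mem (mon_mem_nd _ _ _ _ _ _ _ _ _ (by omega))
            (mon_mem_nd _ _ _ _ _ _ _ _ _ (by omega))
        · rw [hqe]
          exact sub_mem (mon_mem_nd _ _ _ _ _ _ _ _ _ (by omega))
            (mon_mem_nd _ _ _ _ _ _ _ _ _ (by omega))
    · refine notin' k G p _ _ _ _ _ _ _ _ hpe (by omega) ?_
      intro q hq hne
      rcases (hmem q).1 hq with ⟨ν, g1, g2, hqe⟩ | ⟨s, g2, hqe⟩ | hqe | hqe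
      · rw [hqe]
        exact sub_mem (mon_mem_nd _ _ _ _ _ _ _ _ _ (by omega))
          (mon_mem_nd _ _ _ _ _ _ _ _ _ (by omega))
      · rw [hqe]
        exact sub_mem (mon_mem_nd _ _ _ _ _ _ _ _ _ (by omega))
          (mon_mem_nd _ _ _ _ _ _ _ _ _ (by omega))
      · exact absurd (hqe.trans hpe.symm) hne
      · rw [hqe]
        exact sub_mem (mon_mem_nd _ _ _ _ _ _ _ _ _ (by omega))
          (mon_mem_nd _ _ _ _ _ _ _ _ _ (by omega))
    · refine notin k G p _ _ _ _ _ _ _ _ hpe (by omega) ?_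
      intro q hq hne
      rcases (hmem q).1 hq with ⟨ν, g1, g2, hqe⟩ | ⟨s, g2, hqe⟩ | hqe | hqe
      · rw [hqe]
        exact sub_mem (mon_mem_nd _ _ _ _ _ _ _ _ _ (by omega))
          (mon_mem_nd _ _ _ _ _ _ _ _ _ (by omega))
      · rw [hqe]
        exact sub_mem (mon_mem_nd _ _ _ _ _ _ _ _ _ (by omega))
          (mon_mem_nd _ _ _ _ _ _ _ _ _ (by omega))
      · rw [hqe]
        exact sub_mem (mon_mem_nd _ _ _ _ _ _ _ _ _ (by omega))
          (mon_mem_nd _ _ _ _ _ _ _ _ _ (by omega))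
      · exact absurd (hqe.trans hpe.symm) hne
end

section
/- Let k be a field and n ≥ 5 an integer, and let 𝒬_{(n,4,0)} ⊂ k[x_0, x_1, x_2, x_3] be the kernel of the k-algebra homomorphism sending x_0 ↦ t^{n²+2n}, x_1 ↦ t^{n²+2n+1}, x_2 ↦ t^{n²+3n+1}, x_3 ↦ t^{n²+3n+2}. Then the minimal number of generators of 𝒬_{(n,4,0)} equals 2(n+1); that is, 2(n+1) is the least cardinality of a set of polynomials generating the ideal 𝒬_{(n,4,0)}. -/
open MvPolynomial

namespace QIdeal

/-- Exponent vector with given entries. -/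
noncomputable def ex (a b c d : ℕ) : Fin 4 →₀ ℕ := Finsupp.equivFunOnFinite.symm ![a, b, c, d]

@[simp] lemma ex_zero (a b c d : ℕ) : ex a b c d 0 = a := rfl
@[simp] lemma ex_one (a b c d : ℕ) : ex a b c d 1 = b := rfl
@[simp] lemma ex_two (a b c d : ℕ) : ex a b c d 2 = c := rfl
@[simp] lemma ex_three (a b c d : ℕ) : ex a b c d 3 = d := rfl

lemma ext4 {u v : Fin 4 →₀ ℕ} (h0 : u 0 = v 0) (h1 : u 1 = v 1) (h2 : u 2 = v 2)
    (h3 : u 3 = v 3) : u = v := by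
  ext i
  fin_cases i <;> assumption

lemma le4 {u v : Fin 4 →₀ ℕ} : u ≤ v ↔ u 0 ≤ v 0 ∧ u 1 ≤ v 1 ∧ u 2 ≤ v 2 ∧ u 3 ≤ v 3 := by
  constructor
  · intro h
    exact ⟨h 0, h 1, h 2, h 3⟩
  · rintro ⟨h0, h1, h2, h3⟩ i
    fin_cases i <;> assumption

/-- Weighted degree. -/
def deg (n : ℕ) (u : Fin 4 →₀ ℕ) : ℕ :=
  (n ^ 2 + 2 * n) * u 0 + (n ^ 2 + 2 * n + 1) * u 1 + (n ^ 2 + 3 * n + 1) * u 2 +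
    (n ^ 2 + 3 * n + 2) * u 3

lemma deg_add (n : ℕ) (u v : Fin 4 →₀ ℕ) : deg n (u + v) = deg n u + deg n v := by
  simp only [deg, Finsupp.add_apply]
  ring

lemma le_deg (n : ℕ) (hn : 5 ≤ n) (u : Fin 4 →₀ ℕ) : u 0 ≤ deg n u := by
  unfold deg
  have : 1 * u 0 ≤ (n ^ 2 + 2 * n) * u 0 := Nat.mul_le_mul_right _ (by nlinarith)
  omega

/-- Normal exponents. -/
def Normal (n : ℕ) (u : Fin 4 →₀ ℕ) : Prop :=
  (u 1 = 0 ∨ u 2 = 0) ∧ u 3 < n ∧ u 1 + u 2 + u 3 ≤ n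

/-- Index type of the generators. -/
abbrev Idx (n : ℕ) := Bool ⊕ (Fin n ⊕ Fin n)

/-- Leading exponents. -/
noncomputable def lead (n : ℕ) : Idx n → (Fin 4 →₀ ℕ)
  | .inl true => ex 0 1 1 0
  | .inl false => ex 0 0 0 n
  | .inr (.inl i) => ex 0 (n + 1 - i) 0 i
  | .inr (.inr i) => ex 0 0 (n + 1 - i) i

/-- Trailing exponents. -/
noncomputable def trail (n : ℕ) : Idx n → (Fin 4 →₀ ℕ)
  | .inl true => ex 1 0 0 1
  | .inl false => ex (n + 1) 0 0 0
  | .inr (.inl i) => ex (n - i) 0 (i + 1) 0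
  | .inr (.inr i) => ex (n + 1 - i) (i + 1) 0 0

lemma lead_zero (n : ℕ) (g : Idx n) : lead n g 0 = 0 := by
  rcases g with (_ | _) | (i | i) <;> simp [lead]

lemma trail_pos (n : ℕ) (g : Idx n) : 0 < trail n g 0 := by
  rcases g with (_ | _) | (i | i) <;> simp [trail] <;> omega

lemma deg_lead (n : ℕ) (g : Idx n) : deg n (lead n g) = deg n (trail n g) := by
  rcases g with (_ | _) | (i | i)
  · simp [lead, trail, deg]; ring
  · simp [lead, trail, deg]; ring
  · obtain ⟨j, hj⟩ := Nat.exists_eq_add_of_lt i.2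
    have h1 : n + 1 - (i : ℕ) = j + 2 := by omega
    have h2 : n - (i : ℕ) = j + 1 := by omega
    simp only [lead, trail, deg, ex_zero, ex_one, ex_two, ex_three, h1, h2]
    generalize (i : ℕ) = i at *
    subst hj
    ring
  · obtain ⟨j, hj⟩ := Nat.exists_eq_add_of_lt i.2
    have h1 : n + 1 - (i : ℕ) = j + 2 := by omega
    simp only [lead, trail, deg, ex_zero, ex_one, ex_two, ex_three, h1]
    generalize (i : ℕ) = i at *
    subst hj
    ring

lemma lead_inj (n : ℕ) (hn : 5 ≤ n) : Function.Injective (lead n) := by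
  intro g h e
  have e1 := DFunLike.congr_fun e 1
  have e2 := DFunLike.congr_fun e 2
  have e3 := DFunLike.congr_fun e 3
  rcases g with (_ | _) | (i | i) <;> rcases h with (_ | _) | (j | j) <;>
    simp [lead, Fin.ext_iff] at e1 e2 e3 ⊢ <;> omega

lemma exists_lead (n : ℕ) (u : Fin 4 →₀ ℕ) (h : ¬ Normal n u) : ∃ g, lead n g ≤ u := by
  unfold Normal at h
  by_cases h1 : u 1 = 0 ∨ u 2 = 0
  · by_cases h2 : u 3 < n
    · by_cases h3 : u 2 = 0
      · refine ⟨.inr (.inl ⟨u 3, h2⟩), ?_⟩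
        rw [le4]; simp [lead]; omega
      · refine ⟨.inr (.inr ⟨u 3, h2⟩), ?_⟩
        rw [le4]; simp [lead]; omega
    · refine ⟨.inl false, ?_⟩
      rw [le4]; simp [lead]; omega
  · refine ⟨.inl true, ?_⟩
    rw [le4]; simp [lead]; omega

lemma normal_of_lt (n : ℕ) (hn : 5 ≤ n) (g : Idx n) (v : Fin 4 →₀ ℕ) (hv : v ≤ lead n g)
    (hne : v ≠ lead n g) : Normal n v := by
  rw [le4] at hv
  have : ¬ (v 0 = lead n g 0 ∧ v 1 = lead n g 1 ∧ v 2 = lead n g 2 ∧ v 3 = lead n g 3) := by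
    rintro ⟨a, b, c, d⟩
    exact hne (ext4 a b c d)
  unfold Normal
  rcases g with (_ | _) | (i | i) <;> simp [lead] at hv this ⊢ <;> omega

lemma divmod_unique {m q s q' s' : ℕ} (h : q * m + s = q' * m + s') (hs : s < m) (hs' : s' < m) :
    q = q' ∧ s = s' := by
  have h1 : (q * m + s) / m = q := by
    rw [add_comm, Nat.add_mul_div_right _ _ (by omega), Nat.div_eq_of_lt hs, zero_add]
  have h2 : (q' * m + s') / m = q' := by
    rw [add_comm, Nat.add_mul_div_right _ _ (by omega), Nat.div_eq_of_lt hs', zero_add]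
  have : q = q' := by rw [← h1, ← h2, h]
  subst this
  exact ⟨rfl, by omega⟩

/-- Shape of the residue of a normal exponent. -/
lemma normal_shape (n : ℕ) (u : Fin 4 →₀ ℕ) (h : Normal n u) :
    ∃ q s, q < n ∧ s < n + 2 ∧
      deg n u = (u 0 + u 1 + u 2 + u 3) * (n * (n + 2)) + (q * (n + 2) + s) ∧
      ((u 2 = 0 ∧ q = u 3 ∧ s = u 1 ∧ s + q ≤ n) ∨
        (u 1 = 0 ∧ q + 1 = u 2 + u 3 ∧ s + u 2 = n + 2 ∧ n < s + q)) := by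
  obtain ⟨h1, h2, h3⟩ := h
  by_cases h0 : u 2 = 0
  · refine ⟨u 3, u 1, h2, by omega, ?_, Or.inl ⟨h0, rfl, rfl, by omega⟩⟩
    rw [deg, h0]; ring
  · have h1 : u 1 = 0 := by tauto
    obtain ⟨c, hc⟩ := Nat.exists_eq_succ_of_ne_zero h0
    obtain ⟨e, he⟩ : ∃ e, n = c + e := ⟨n - c, by omega⟩
    refine ⟨c + u 3, e + 1, by omega, by omega, ?_, Or.inr ⟨h1, by omega, by omega, by omega⟩⟩
    rw [deg, h1, hc, he, Nat.succ_eq_add_one]; ring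

lemma normal_unique (n : ℕ) (u v : Fin 4 →₀ ℕ) (hu : Normal n u) (hv : Normal n v)
    (h : deg n u = deg n v) : u = v := by
  obtain ⟨q, s, hq, hs, hd, hc⟩ := normal_shape n u hu
  obtain ⟨q', s', hq', hs', hd', hc'⟩ := normal_shape n v hv
  rw [hd, hd'] at h
  have b1 : q * (n + 2) + s < n * (n + 2) := by nlinarith
  have b2 : q' * (n + 2) + s' < n * (n + 2) := by nlinarith
  obtain ⟨e1, e2⟩ := divmod_unique h b1 b2
  obtain ⟨e3, e4⟩ := divmod_unique e2 hs hs'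
  apply ext4 <;> omega

section
variable (k : Type*) [Field k]

/-- The generators. -/
noncomputable def gen (n : ℕ) (g : Idx n) : MvPolynomial (Fin 4) k :=
  monomial (lead n g) 1 - monomial (trail n g) 1

/-- The ideal they generate. -/
noncomputable def J (n : ℕ) : Ideal (MvPolynomial (Fin 4) k) :=
  Ideal.span (Set.range (gen k n))

/-- The parametrization. -/
noncomputable def phi (n : ℕ) : MvPolynomial (Fin 4) k →ₐ[k] Polynomial k :=
  aeval (![(Polynomial.X : Polynomial k) ^ (n ^ 2 + 2 * n),
                Polynomial.X ^ (n ^ 2 + 2 * n + 1), Polynomial.X ^ (n ^ 2 + 3 * n + 1),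
                Polynomial.X ^ (n ^ 2 + 3 * n + 2)])

lemma phi_monomial (n : ℕ) (u : Fin 4 →₀ ℕ) (a : k) :
    phi k n (monomial u a) = Polynomial.monomial (deg n u) a := by
  rw [phi, aeval_monomial, Finsupp.prod_fintype _ _ (by simp), Fin.prod_univ_four,
    ← Polynomial.C_mul_X_pow_eq_monomial]
  simp only [Matrix.cons_val, ← pow_mul, ← pow_add, deg, Polynomial.algebraMap_eq]

lemma gen_mem (n : ℕ) (g : Idx n) : phi k n (gen k n g) = 0 := by
  rw [gen, map_sub, phi_monomial, phi_monomial, deg_lead, sub_self]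

lemma reduce (n : ℕ) (hn : 5 ≤ n) (N : ℕ) : ∀ u : Fin 4 →₀ ℕ, deg n u - u 0 ≤ N →
    ∃ v, Normal n v ∧ deg n v = deg n u ∧
      (monomial u (1 : k) - monomial v 1) ∈ J k n ∧ (u = v ∨ u 0 < v 0) := by
  induction N with
  | zero =>
    intro u hu
    by_cases h : Normal n u
    · exact ⟨u, h, rfl, by simp, Or.inl rfl⟩
    · obtain ⟨g, hg⟩ := exists_lead n u h
      exfalso
      obtain ⟨r, rfl⟩ := exists_add_of_le hg
      have := le_deg n hn (trail n g + r)
      have h1 := deg_add n (trail n g) r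
      have h2 := deg_add n (lead n g) r
      have h3 := deg_lead n g
      have h4 := trail_pos n g
      have h5 := lead_zero n g
      simp only [Finsupp.add_apply] at *
      omega
  | succ N ih =>
    intro u hu
    by_cases h : Normal n u
    · exact ⟨u, h, rfl, by simp, Or.inl rfl⟩
    · obtain ⟨g, hg⟩ := exists_lead n u h
      obtain ⟨r, rfl⟩ := exists_add_of_le hg
      have h1 := deg_add n (trail n g) r
      have h2 := deg_add n (lead n g) r
      have h3 := deg_lead n g
      have h4 := trail_pos n g
      have h5 := lead_zero n g
      have h0 : (lead n g + r) 0 < (trail n g + r) 0 := by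
        simp only [Finsupp.add_apply]; omega
      obtain ⟨v, hv, hd, hm, hlt⟩ := ih (trail n g + r) (by omega)
      refine ⟨v, hv, by omega, ?_, Or.inr ?_⟩
      · have e : (monomial (lead n g + r) (1 : k) - monomial v 1) =
            monomial r 1 * gen k n g + (monomial (trail n g + r) (1 : k) - monomial v 1) := by
          rw [gen, mul_sub, monomial_mul, monomial_mul, one_mul, add_comm r, add_comm r]
          ring
        rw [e]
        exact Ideal.add_mem _ (Ideal.mul_mem_left _ _ (Ideal.subset_span ⟨g, rfl⟩)) hm
      · rcases hlt with rfl | hlt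
        · exact h0
        · omega

lemma ker_le (n : ℕ) (hn : 5 ≤ n) (f : MvPolynomial (Fin 4) k) (hf : phi k n f = 0) :
    f ∈ J k n := by
  classical
  let nf : ℕ → (Fin 4 →₀ ℕ) := fun d =>
    if h : ∃ v, Normal n v ∧ deg n v = d then h.choose else 0
  have hnf : ∀ v, Normal n v → nf (deg n v) = v := by
    intro v hv
    have h : ∃ w, Normal n w ∧ deg n w = deg n v := ⟨v, hv, rfl⟩
    have : nf (deg n v) = h.choose := dif_pos h
    rw [this]
    exact normal_unique n _ _ h.choose_spec.1 hv h.choose_spec.2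
  let psi : Polynomial k →ₗ[k] MvPolynomial (Fin 4) k :=
    (Polynomial.basisMonomials k).constr k (fun d => monomial (nf d) (1 : k))
  have hpsi : ∀ d a, psi (Polynomial.monomial d a) = a • monomial (nf d) (1 : k) := by
    intro d a
    have h1 : Polynomial.monomial d a = a • Polynomial.basisMonomials k d := by
      simp [Polynomial.smul_monomial]
    rw [h1, map_smul]
    congr 1
    exact Module.Basis.constr_basis _ _ _ _
  have key : ∀ f : MvPolynomial (Fin 4) k, f - psi (phi k n f) ∈ J k n := by
    intro f
    induction f using MvPolynomial.induction_on' with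
    | monomial u a =>
      obtain ⟨v, hv, hd, hm, -⟩ := reduce k n hn _ u le_rfl
      rw [phi_monomial, hpsi, ← hd, hnf v hv]
      have : monomial u a - a • monomial v (1 : k) =
          C a * (monomial u (1 : k) - monomial v 1) := by
        rw [mul_sub, C_mul_monomial, C_mul_monomial, smul_monomial]
        simp
      rw [this]
      exact Ideal.mul_mem_left _ _ hm
    | add p q hp hq =>
      have := Ideal.add_mem _ hp hq
      rw [map_add, map_add]
      convert this using 1
      ring
  have := key f
  rwa [hf, map_zero, sub_zero] at this

lemma J_eq (n : ℕ) (hn : 5 ≤ n) : J k n = RingHom.ker (phi k n) := by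
  apply le_antisymm
  · rw [J, Ideal.span_le]
    rintro _ ⟨g, rfl⟩
    exact gen_mem k n g
  · intro f hf
    exact ker_le k n hn f hf

lemma coeff_zero_of_normal (n : ℕ) (hn : 5 ≤ n) (w : Fin 4 →₀ ℕ) (hw : Normal n w)
    (h0 : w 0 = 0) (f : MvPolynomial (Fin 4) k) (hf : phi k n f = 0) : coeff w f = 0 := by
  classical
  have hu : ∀ v, deg n v = deg n w → v = w := by
    intro v hv
    obtain ⟨v', hv', hd, -, h⟩ := reduce k n hn _ v le_rfl
    have := normal_unique n v' w hv' hw (hd.trans hv)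
    subst this
    rcases h with h | h
    · exact h
    · omega
  have key : ∀ f : MvPolynomial (Fin 4) k, (phi k n f).coeff (deg n w) = coeff w f := by
    intro f
    induction f using MvPolynomial.induction_on' with
    | monomial u a =>
      rw [phi_monomial, Polynomial.coeff_monomial, coeff_monomial]
      by_cases h : u = w
      · simp [h]
      · rw [if_neg h, if_neg (fun e => h (hu u e))]
    | add p q hp hq => rw [map_add, Polynomial.coeff_add, hp, hq, coeff_add]
  rw [← key, hf, Polynomial.coeff_zero]

lemma coeff_lead_mul (n : ℕ) (hn : 5 ≤ n) (g : Idx n) (r f : MvPolynomial (Fin 4) k)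
    (hf : phi k n f = 0) : coeff (lead n g) (r * f) = coeff 0 r * coeff (lead n g) f := by
  classical
  rw [coeff_mul, Finset.sum_eq_single (0, lead n g)]
  · rintro ⟨a, b⟩ hab hne
    rw [Finset.HasAntidiagonal.mem_antidiagonal] at hab
    have hab' : a + b = lead n g := hab
    have hb : b ≤ lead n g := by rw [← hab']; exact le_add_self
    have hbn : b ≠ lead n g := by
      rintro rfl
      apply hne
      have : a = 0 := by simpa using hab'
      rw [this]
    have h0 : b 0 = 0 := by
      have := hb 0
      rw [lead_zero] at this
      omega
    rw [coeff_zero_of_normal k n hn b (normal_of_lt n hn g b hb hbn) h0 f hf, mul_zero]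
  · intro h
    exact absurd (by simp) h

/-- Coefficients at all leading exponents. -/
noncomputable def lam (n : ℕ) : MvPolynomial (Fin 4) k →ₗ[k] (Idx n → k) :=
  LinearMap.pi fun g => lcoeff k (lead n g)

lemma lam_apply (n : ℕ) (f : MvPolynomial (Fin 4) k) (g : Idx n) :
    lam k n f g = coeff (lead n g) f := rfl

lemma lam_gen (n : ℕ) (hn : 5 ≤ n) (g : Idx n) : lam k n (gen k n g) = Pi.single g 1 := by
  classical
  ext h
  rw [lam_apply, gen, coeff_sub, coeff_monomial, coeff_monomial, if_neg (c := trail n g = _),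
    sub_zero, Pi.single_apply]
  · by_cases e : g = h
    · simp [e]
    · rw [if_neg (fun e' => e (lead_inj n hn e')), if_neg (fun e' => e e'.symm)]
  · intro e
    have := trail_pos n g
    rw [e, lead_zero] at this
    omega

lemma card_idx (n : ℕ) : Fintype.card (Idx n) = 2 * (n + 1) := by
  simp; ring

lemma lower (n : ℕ) (hn : 5 ≤ n) (S : Finset (MvPolynomial (Fin 4) k))
    (hS : Ideal.span (S : Set (MvPolynomial (Fin 4) k)) = RingHom.ker (phi k n)) :
    2 * (n + 1) ≤ S.card := by
  classical
  let T : Finset (Idx n → k) := S.image (lam k n)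
  have hker : ∀ f, f ∈ Ideal.span (S : Set (MvPolynomial (Fin 4) k)) → phi k n f = 0 := by
    intro f hf
    rw [hS] at hf
    exact hf
  have key : ∀ f, f ∈ Ideal.span (S : Set (MvPolynomial (Fin 4) k)) →
      lam k n f ∈ Submodule.span k (T : Set (Idx n → k)) := by
    intro f hf
    induction hf using Submodule.span_induction with
    | mem x hx => exact Submodule.subset_span (Finset.mem_image_of_mem _ hx)
    | zero => simp
    | add x y _ _ hx hy => rw [map_add]; exact Submodule.add_mem _ hx hy
    | smul a x hx' hx =>
      have : lam k n (a • x) = coeff 0 a • lam k n x := by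
        ext g
        rw [lam_apply, smul_eq_mul, coeff_lead_mul k n hn g a x (hker x hx')]
        rfl
      rw [this]
      exact Submodule.smul_mem _ _ hx
  have htop : Submodule.span k (T : Set (Idx n → k)) = ⊤ := by
    rw [eq_top_iff, ← (Pi.basisFun k (Idx n)).span_eq, Submodule.span_le]
    rintro _ ⟨g, rfl⟩
    rw [Pi.basisFun_apply, ← lam_gen k n hn g]
    apply key
    rw [hS]
    exact gen_mem k n g
  have h1 := finrank_span_finset_le_card (R := k) T
  rw [Set.finrank, htop, finrank_top, Module.finrank_fintype_fun_eq_card, card_idx] at h1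
  exact h1.trans Finset.card_image_le

lemma upper (n : ℕ) (hn : 5 ≤ n) : ∃ S : Finset (MvPolynomial (Fin 4) k), S.card = 2 * (n + 1) ∧
    Ideal.span (S : Set (MvPolynomial (Fin 4) k)) = RingHom.ker (phi k n) := by
  classical
  refine ⟨Finset.univ.image (gen k n), ?_, ?_⟩
  · rw [Finset.card_image_of_injective, Finset.card_univ, card_idx]
    intro g h e
    have e' := congrArg (lam k n) e
    rw [lam_gen k n hn, lam_gen k n hn] at e'
    by_contra hne
    have := congrFun e' g
    simp [hne] at this
  · rw [← J_eq k n hn, J, Finset.coe_image, Finset.coe_univ, Set.image_univ]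

end

end QIdeal

theorem statement6 (k : Type*) [Field k] (n : ℕ) (hn : 5 ≤ n) :
    IsLeast
      {c : ℕ | ∃ S : Finset (MvPolynomial (Fin 4) k), S.card = c ∧
        Ideal.span (S : Set (MvPolynomial (Fin 4) k)) =
          RingHom.ker
            (aeval (![(Polynomial.X : Polynomial k) ^ (n ^ 2 + 2 * n),
                Polynomial.X ^ (n ^ 2 + 2 * n + 1), Polynomial.X ^ (n ^ 2 + 3 * n + 1),
                Polynomial.X ^ (n ^ 2 + 3 * n + 2)]) :
              MvPolynomial (Fin 4) k →ₐ[k] Polynomial k)}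
      (2 * (n + 1)) := by
  refine ⟨QIdeal.upper k n hn, ?_⟩
  rintro c ⟨S, rfl, hS⟩
  exact QIdeal.lower k n hn S hS
end

section
/- Let e ≥ 4 be an integer, q a positive integer, m = e + 2q + 1, and d a positive integer with gcd(m, d) = 1. Let 𝒮 = {m, m+d} ∪ {(q+1)m + (q+i)d : 2 ≤ i ≤ e−1}. Then 𝒮 is a minimal generating set for the additive submonoid Γ_{(e,q,d)}(𝒮) of ℕ that it generates; that is, no element of 𝒮 lies in the additive submonoid of ℕ generated by the remaining elements of 𝒮. -/
theorem statement7 (e q d m : ℕ) (he : 4 ≤ e) (hq : 0 < q) (hm : m = e + 2 * q + 1)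
    (hd : 0 < d) (hgcd : Nat.gcd m d = 1)
    (S : Set ℕ)
    (hS : S = {m, m + d} ∪
      {x : ℕ | ∃ i : ℕ, 2 ≤ i ∧ i ≤ e - 1 ∧ x = (q + 1) * m + (q + i) * d}) :
    ∀ s ∈ S, s ∉ AddSubmonoid.closure (S \ {s}) := by
  have hbig : ∀ i, 2 ≤ i → m + d < (q + 1) * m + (q + i) * d := by
    intro i hi
    have h1 : 2 * m ≤ (q + 1) * m := Nat.mul_le_mul_right _ (by omega)
    have h2 : 1 * d ≤ (q + i) * d := Nat.mul_le_mul_right _ (by omega)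
    omega
  intro s hs hc
  have hs' := hs
  simp only [hS, Set.mem_union, Set.mem_insert_iff, Set.mem_singleton_iff,
    Set.mem_setOf_eq] at hs'
  rcases hs' with (rfl | rfl) | ⟨j, hj2, hje, hsj⟩
  · have key : ∀ x ∈ AddSubmonoid.closure (S \ {s}), x = 0 ∨ s < x := by
      intro x hx
      induction hx using AddSubmonoid.closure_induction with
      | mem x hx =>
        obtain ⟨hx, hne⟩ := hx
        simp only [hS, Set.mem_union, Set.mem_insert_iff, Set.mem_singleton_iff,
          Set.mem_setOf_eq] at hx hne
        rcases hx with (h | h) | ⟨i, hi, _, h⟩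
        · exact absurd h hne
        · omega
        · have := hbig i hi
          omega
      | zero => simp
      | add x y _ _ h1 h2 => omega
    have := key s hc
    omega
  · have key : ∀ x ∈ AddSubmonoid.closure (S \ {m + d}), m ∣ x ∨ m + d < x := by
      intro x hx
      induction hx using AddSubmonoid.closure_induction with
      | mem x hx =>
        obtain ⟨hx, hne⟩ := hx
        simp only [hS, Set.mem_union, Set.mem_insert_iff, Set.mem_singleton_iff,
          Set.mem_setOf_eq] at hx hne
        rcases hx with (h | h) | ⟨i, hi, _, h⟩
        · left; rw [h]
        · exact absurd h hne
        · have := hbig i hi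
          omega
      | zero => simp
      | add x y _ _ h1 h2 =>
        rcases h1 with h1 | h1
        · rcases h2 with h2 | h2
          · exact Or.inl (dvd_add h1 h2)
          · omega
        · omega
    rcases key _ hc with h | h
    · have h3 : m ∣ d := (Nat.dvd_add_right (dvd_refl m)).1 h
      have h4 : m = 1 := by rw [← hgcd]; exact (Nat.gcd_eq_left h3).symm
      omega
    · omega
  · have key : ∀ x ∈ AddSubmonoid.closure (S \ {s}), ∃ a b, x = a * m + b * d ∧
        (b ≤ a ∨ q + 2 ≤ a ∨ (a = q + 1 ∧ b ≠ q + j)) := by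
      intro x hx
      induction hx using AddSubmonoid.closure_induction with
      | mem x hx =>
        obtain ⟨hx, hne⟩ := hx
        simp only [hS, Set.mem_union, Set.mem_insert_iff, Set.mem_singleton_iff,
          Set.mem_setOf_eq] at hx hne
        rcases hx with (h | h) | ⟨i, hi, _, h⟩
        · exact ⟨1, 0, by omega, by omega⟩
        · exact ⟨1, 1, by omega, by omega⟩
        · refine ⟨q + 1, q + i, h, Or.inr (Or.inr ⟨rfl, ?_⟩)⟩
          intro hij
          apply hne
          rw [h, hsj, hij]
      | zero => exact ⟨0, 0, by simp, by simp⟩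
      | add x y _ _ h1 h2 =>
        obtain ⟨a, b, rfl, h1⟩ := h1
        obtain ⟨a', b', rfl, h2⟩ := h2
        exact ⟨a + a', b + b', by ring, by omega⟩
    obtain ⟨a, b, hab, h⟩ := key s hc
    rw [hsj] at hab
    by_cases ha : q + 2 ≤ a
    · obtain ⟨k, rfl⟩ : ∃ k, a = q + 1 + k := ⟨a - (q + 1), by omega⟩
      have hk : 0 < k := by omega
      have h5 : (q + j) * d = k * m + b * d := by
        have : (q + 1 + k) * m = (q + 1) * m + k * m := by ring
        omega
      have h6 : 0 < k * m := Nat.mul_pos hk (by omega)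
      have hb : b < q + j := by
        by_contra hb
        have := Nat.mul_le_mul_right d (not_lt.1 hb)
        omega
      obtain ⟨c, hcb⟩ : ∃ c, q + j = b + c := ⟨q + j - b, by omega⟩
      have h7 : c * d = k * m := by
        rw [hcb, add_mul] at h5
        omega
      have h8 : m ∣ c := Nat.Coprime.dvd_of_dvd_mul_right hgcd ⟨k, by rw [h7, mul_comm]⟩
      have := Nat.le_of_dvd (by omega) h8
      omega
    · rcases h with h | h | ⟨rfl, h⟩
      · have h1 : a * m ≤ (q + 1) * m := Nat.mul_le_mul_right _ (by omega)
        have h2 : b * d < (q + j) * d := Nat.mul_lt_mul_of_pos_right (by omega) hd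
        omega
      · exact ha h
      · exact h (Nat.eq_of_mul_eq_mul_right hd (by omega))
end

section
/- Let e ≥ 4 be an even integer, q a positive even integer with q ≥ e−4, m = e + 2q, and d an odd positive integer with gcd(m, d) = 1. Let 𝒯 = {m, m+d} ∪ {q(m+1) + (q − (e−4)/2 + k)d + e/2 : 0 ≤ k ≤ e−3}. Then 𝒯 is a minimal generating set for the additive submonoid Γ_{(e,q,d)}(𝒯) of ℕ that it generates; that is, no element of 𝒯 lies in the additive submonoid of ℕ generated by the remaining elements of 𝒯. -/
theorem core8 (n d A D A' D' : ℕ) (hg : Nat.Coprime n d) (hd : 0 < d) (hn : 0 < n)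
    (h : A' * n + D' * d = A * n + D * d) (hA : A < A') : D' + n ≤ D := by
  obtain ⟨t, rfl⟩ := Nat.exists_eq_add_of_lt hA
  have h1 : D' < D := by
    by_contra hc
    have := Nat.mul_le_mul_right d (not_lt.mp hc)
    nlinarith
  obtain ⟨u, rfl⟩ := Nat.exists_eq_add_of_lt h1
  have h2 : (t + 1) * n = (u + 1) * d := by nlinarith
  have h3 : n ∣ (u + 1) * d := ⟨t + 1, by rw [← h2, mul_comm]⟩
  have h4 := Nat.le_of_dvd (by omega) (hg.dvd_of_dvd_mul_right h3)
  omega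

theorem statement8 (e q d m : ℕ) (he : 4 ≤ e) (heven : Even e) (hq : 0 < q) (hqeven : Even q)
    (hqe : e - 4 ≤ q) (hm : m = e + 2 * q) (hd : 0 < d) (hdodd : Odd d)
    (hgcd : Nat.gcd m d = 1)
    (T : Set ℕ)
    (hT : T = {m, m + d} ∪
      {x : ℕ | ∃ kk : ℕ, kk ≤ e - 3 ∧
        x = q * (m + 1) + (q - (e - 4) / 2 + kk) * d + e / 2}) :
    ∀ s ∈ T, s ∉ AddSubmonoid.closure (T \ {s}) := by
  obtain ⟨f, hf⟩ := heven
  obtain ⟨r, hr⟩ := hqeven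
  obtain ⟨n, hn⟩ : ∃ n, n = f + q := ⟨_, rfl⟩
  obtain ⟨c, hc⟩ : ∃ c, c = q - (e - 4) / 2 := ⟨_, rfl⟩
  have hcf : c + f = q + 2 := by omega
  have hc1 : 1 ≤ c := by omega
  have hmn : m = 2 * n := by omega
  have hnd : Nat.Coprime n d := by
    have : Nat.Coprime (2 * n) d := by rw [← hmn]; exact hgcd
    exact this.coprime_mul_left
  have hg : ∀ k, q * (m + 1) + (q - (e - 4) / 2 + k) * d + e / 2
      = (2 * q + 1) * n + (c + k) * d := by
    intro k
    rw [← hc, hmn]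
    have : e / 2 = f := by omega
    rw [this]
    have : q * (2 * n + 1) + f = (2 * q + 1) * n := by rw [hn]; ring
    linarith
  have hgbig : ∀ k, m + d < (2 * q + 1) * n + (c + k) * d := by
    intro k
    have h1 : 1 * d ≤ (c + k) * d := Nat.mul_le_mul_right d (by omega)
    have h2 : 3 * n ≤ (2 * q + 1) * n := Nat.mul_le_mul_right n (by omega)
    omega
  simp only [hg] at hT
  have hmem : ∀ x, x ∈ T ↔ (x = m ∨ x = m + d) ∨
      ∃ k, k ≤ e - 3 ∧ x = (2 * q + 1) * n + (c + k) * d := by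
    intro x; rw [hT]; rfl
  intro s hs hcl
  rcases (hmem s).1 hs with (rfl | rfl) | ⟨k, hk, rfl⟩
  · have key : ∀ x ∈ AddSubmonoid.closure (T \ {s}), x = 0 ∨ s < x := by
      intro x hx
      induction hx using AddSubmonoid.closure_induction with
      | mem x hx =>
        obtain ⟨hx, hne⟩ := hx
        rcases (hmem x).1 hx with (h | h) | ⟨j, hj, h⟩
        · exact absurd h hne
        · omega
        · have := hgbig j; omega
      | zero => left; rfl
      | add x y _ _ h1 h2 => omega
    have := key s hcl
    omega
  · have key : ∀ x ∈ AddSubmonoid.closure (T \ {m + d}), m ∣ x ∨ m + d < x := by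
      intro x hx
      induction hx using AddSubmonoid.closure_induction with
      | mem x hx =>
        obtain ⟨hx, hne⟩ := hx
        rcases (hmem x).1 hx with (h | h) | ⟨j, hj, h⟩
        · left; rw [h]
        · exact absurd h hne
        · have := hgbig j; right; omega
      | zero => left; exact dvd_zero _
      | add x y _ _ h1 h2 =>
        rcases h1 with h1 | h1
        · rcases h2 with h2 | h2
          · left; exact dvd_add h1 h2
          · right; omega
        · right; omega
    rcases key _ hcl with h | h
    · have h1 : m ∣ d := (Nat.dvd_add_right (dvd_refl m)).1 h
      have h2 := Nat.gcd_eq_left h1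
      omega
    · omega
  · have key : ∀ x ∈ AddSubmonoid.closure (T \ {(2 * q + 1) * n + (c + k) * d}),
        ∃ A D, x = A * n + D * d ∧ ((A % 2 = 0 ∧ D * 2 ≤ A) ∨
          (∃ j, j ≠ k ∧ A = 2 * q + 1 ∧ D = c + j) ∨ 2 * q + 2 ≤ A) := by
      intro x hx
      induction hx using AddSubmonoid.closure_induction with
      | mem x hx =>
        obtain ⟨hx, hne⟩ := hx
        rcases (hmem x).1 hx with (h | h) | ⟨j, hj, h⟩
        · exact ⟨2, 0, by omega, by omega⟩
        · exact ⟨2, 1, by omega, by omega⟩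
        · refine ⟨2 * q + 1, c + j, h, Or.inr (Or.inl ⟨j, ?_, rfl, rfl⟩)⟩
          rintro rfl
          exact hne h
      | zero => exact ⟨0, 0, by simp, by simp⟩
      | add x y _ _ h1 h2 =>
        obtain ⟨A, D, hx, h1⟩ := h1
        obtain ⟨B, E, hy, h2⟩ := h2
        refine ⟨A + B, D + E, by rw [hx, hy]; ring, ?_⟩
        rcases h1 with h1 | ⟨i, hi, h1⟩ | h1
        · rcases h2 with h2 | ⟨j, hj, h2⟩ | h2
          · left; omega
          · by_cases hA : A = 0
            · right; left; exact ⟨j, hj, by omega, by omega⟩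
            · right; right; omega
          · right; right; omega
        · rcases h2 with h2 | ⟨j, hj, h2⟩ | h2
          · by_cases hB : B = 0
            · right; left; exact ⟨i, hi, by omega, by omega⟩
            · right; right; omega
          · right; right; omega
          · right; right; omega
        · right; right; omega
    obtain ⟨A, D, h, hAD⟩ := key _ hcl
    have big : ¬ 2 * q + 1 < A := by
      intro hlt
      have := core8 n d _ _ _ _ hnd hd (by omega) h.symm hlt
      omega
    rcases hAD with ⟨h1, h2⟩ | ⟨j, hj, rfl, rfl⟩ | h1
    · have := core8 n d _ _ _ _ hnd hd (by omega) h (by omega)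
      omega
    · have h3 : (c + k) * d = (c + j) * d := by omega
      have := Nat.eq_of_mul_eq_mul_right hd h3
      omega
    · omega
end

section
/- Let e ≥ 4 be an integer, q a positive integer, m = e + 2q + 1, d a positive integer with gcd(m, d) = 1, and let Γ = Γ_{(e,q,d)}(𝒮) be the additive submonoid of ℕ generated by 𝒮 = {m, m+d} ∪ {(q+1)m + (q+i)d : 2 ≤ i ≤ e−1}. Then the Frobenius number of Γ, i.e., the greatest integer not belonging to Γ, equals 4q² + (2e + 2d + 4)q + e(d+1) + 1. -/
theorem statement10 (e q d m : ℕ) (he : 4 ≤ e) (hq : 0 < q) (hm : m = e + 2 * q + 1)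
    (hd : 0 < d) (hgcd : Nat.gcd m d = 1)
    (Γ : AddSubmonoid ℕ)
    (hΓ : Γ = AddSubmonoid.closure ({m, m + d} ∪
      {x : ℕ | ∃ i : ℕ, 2 ≤ i ∧ i ≤ e - 1 ∧ x = (q + 1) * m + (q + i) * d})) :
    IsGreatest {x : ℕ | x ∉ Γ} (4 * q ^ 2 + (2 * e + 2 * d + 4) * q + e * (d + 1) + 1) := by
  have hF : 4 * q ^ 2 + (2 * e + 2 * d + 4) * q + e * (d + 1) + 1
      = (2 * q + 1) * m + (e + 2 * q) * d := by subst hm; ring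
  rw [hF]
  have h1 : m ∈ Γ := by
    rw [hΓ]; exact AddSubmonoid.subset_closure (Or.inl (Or.inl rfl))
  have h2 : m + d ∈ Γ := by
    rw [hΓ]; exact AddSubmonoid.subset_closure (Or.inl (Or.inr rfl))
  have h3 : ∀ i, 2 ≤ i → i ≤ e - 1 → (q + 1) * m + (q + i) * d ∈ Γ := by
    intro i hi hi'
    rw [hΓ]; exact AddSubmonoid.subset_closure (Or.inr ⟨i, hi, hi', rfl⟩)
  have hmul : ∀ (n x : ℕ), x ∈ Γ → n * x ∈ Γ := by
    intro n x hx
    simpa using Γ.nsmul_mem hx n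
  have hinv : ∀ x ∈ Γ, ∃ a b n : ℕ, x = a * m + b * d ∧ n * (q + 1) ≤ a ∧
      b ≤ a + n * (e - 2) := by
    intro x hx
    rw [hΓ] at hx
    induction hx using AddSubmonoid.closure_induction with
    | mem x hx =>
      rcases hx with (rfl | rfl) | ⟨i, hi, hi', rfl⟩
      · exact ⟨1, 0, 0, by ring, by omega, by omega⟩
      · exact ⟨1, 1, 0, by ring, by omega, by omega⟩
      · exact ⟨q + 1, q + i, 1, rfl, by omega, by omega⟩
    | zero => exact ⟨0, 0, 0, by ring, by omega, by omega⟩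
    | add x y _ _ hx hy =>
      obtain ⟨a, b, n, rfl, h, h'⟩ := hx
      obtain ⟨a', b', n', rfl, k, k'⟩ := hy
      exact ⟨a + a', b + b', n + n', by ring, by rw [add_mul]; omega, by rw [add_mul]; omega⟩
  have hcop : Nat.Coprime m d := hgcd
  constructor
  · intro hx
    obtain ⟨a, b, n, hab, hn, hb⟩ := hinv _ hx
    have hmod : (e + 2 * q) * d ≡ b * d [MOD m] := by
      have : ((2 * q + 1) * m + (e + 2 * q) * d) % m = (a * m + b * d) % m := by rw [hab]
      simpa [Nat.ModEq, Nat.add_mod] using this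
    have hmod2 : e + 2 * q ≡ b [MOD m] := Nat.ModEq.cancel_right_of_coprime hcop hmod
    have hble : e + 2 * q ≤ b := by
      have h4 : (e + 2 * q) % m = b % m := hmod2
      rw [Nat.mod_eq_of_lt (by omega)] at h4
      rw [h4]; exact Nat.mod_le _ _
    have hale : a ≤ 2 * q + 1 := by
      by_contra hcon
      have h5 : (2 * q + 2) * m ≤ a * m := Nat.mul_le_mul_right _ (by omega)
      have h6 : (e + 2 * q) * d ≤ b * d := Nat.mul_le_mul_right _ hble
      have : (2 * q + 2) * m = (2 * q + 1) * m + m := by ring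
      omega
    have hn1 : n ≤ 1 := by
      by_contra hcon
      have : 2 * (q + 1) ≤ n * (q + 1) := Nat.mul_le_mul_right _ (by omega)
      omega
    have : n * (e - 2) ≤ 1 * (e - 2) := Nat.mul_le_mul_right _ hn1
    omega
  · intro x hx
    by_contra hlt
    apply hx
    push Not at hlt
    have hap : ∀ k, k ≤ e + 2 * q → ∃ a ≤ 2 * q + 2, a * m + k * d ∈ Γ := by
      intro k hk
      by_cases hk2 : k ≤ 2 * q + 2
      · refine ⟨k, hk2, ?_⟩
        rw [← mul_add]; exact hmul _ _ h2
      · refine ⟨2 * q + 2, le_rfl, ?_⟩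
        obtain ⟨i, rfl⟩ : ∃ i, k = 2 * q + 1 + i := ⟨k - (2 * q + 1), by omega⟩
        have := Γ.add_mem (hmul (q + 1) _ h2) (h3 i (by omega) (by omega))
        convert this using 1
        ring
    obtain ⟨k, hk, hkx⟩ : ∃ k, k ≤ e + 2 * q ∧ k * d ≡ x [MOD m] := by
      have hm0 : 0 < m := by omega
      obtain ⟨c, hc⟩ := Nat.exists_mul_mod_eq_of_coprime x hcop.symm (by omega)
      refine ⟨c % m, ?_, ?_⟩
      · have := Nat.mod_lt c hm0
        omega
      · have h7 : (d * c) % m = x % m := hc.2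
        rw [Nat.ModEq, ← h7, mul_comm d c]
        exact (Nat.mod_modEq c m).mul_right d
    obtain ⟨a, ha, hmem⟩ := hap k hk
    have hmod : a * m + k * d ≡ x [MOD m] := by
      have : (k * d) % m = x % m := hkx
      simpa [Nat.ModEq, Nat.add_mod] using this
    have hle : a * m + k * d ≤ x := by
      have h5 : a * m ≤ (2 * q + 2) * m := Nat.mul_le_mul_right _ ha
      have h6 : k * d ≤ (e + 2 * q) * d := Nat.mul_le_mul_right _ hk
      have h7 : (2 * q + 2) * m = (2 * q + 1) * m + m := by ring
      by_contra hcon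
      push Not at hcon
      have hdvd := (Nat.modEq_iff_dvd' hcon.le).mp hmod.symm
      have := Nat.le_of_dvd (by omega) hdvd
      omega
    obtain ⟨s, hs⟩ := (Nat.modEq_iff_dvd' hle).mp hmod
    have hxe : x = (a * m + k * d) + s * m := by
      rw [mul_comm s m, ← hs]; omega
    rw [hxe]
    exact Γ.add_mem hmem (hmul _ _ h1)
end

section
/- Let e ≥ 4 be an even integer, q a positive even integer with q ≥ e−4, m = e + 2q, d an odd positive integer with gcd(m, d) = 1, and let Γ = Γ_{(e,q,d)}(𝒯) be the additive submonoid of ℕ generated by 𝒯 = {m, m+d} ∪ {q(m+1) + (q − (e−4)/2 + k)d + e/2 : 0 ≤ k ≤ e−3}. Then the Apéry set Ap(Γ, m) = {s ∈ Γ : s − m ∉ Γ} equals γ_1 ∪ γ_2, where γ_1 = {q(m+1) + (q − (e−4)/2 + k)d + e/2 : 0 ≤ k ≤ e−3} and γ_2 = {k(m+d) : 0 ≤ k ≤ 2q+1}. -/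
theorem statement11 (e q d m : ℕ) (he : 4 ≤ e) (heven : Even e) (hq : 0 < q) (hqeven : Even q)
    (hqe : e - 4 ≤ q) (hm : m = e + 2 * q) (hd : 0 < d) (hdodd : Odd d)
    (hgcd : Nat.gcd m d = 1)
    (Γ : AddSubmonoid ℕ)
    (hΓ : Γ = AddSubmonoid.closure ({m, m + d} ∪
      {x : ℕ | ∃ kk : ℕ, kk ≤ e - 3 ∧
        x = q * (m + 1) + (q - (e - 4) / 2 + kk) * d + e / 2})) :
    {s : ℕ | s ∈ Γ ∧ ¬ ∃ t ∈ Γ, s = t + m} =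
      {x : ℕ | ∃ kk : ℕ, kk ≤ e - 3 ∧
        x = q * (m + 1) + (q - (e - 4) / 2 + kk) * d + e / 2} ∪
      {x : ℕ | ∃ kk : ℕ, kk ≤ 2 * q + 1 ∧ x = kk * (m + d)} := by
  obtain ⟨f, rfl⟩ := heven
  obtain ⟨c, rfl⟩ := hdodd
  -- values of the long generators
  have hgen : ∀ kk : ℕ, ((q * (m + 1) + (q - (f + f - 4) / 2 + kk) * (2 * c + 1) + (f + f) / 2 : ℕ) : ℤ)
      = ((q : ℤ) - c) * m + ((2 * q + 2 + kk : ℕ) : ℤ) * (2 * c + 1) := by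
    intro kk
    obtain ⟨u, hu⟩ : ∃ u, u = q - (f + f - 4) / 2 := ⟨_, rfl⟩
    have h1 : (u : ℤ) = q - f + 2 := by omega
    have h2 : (f + f) / 2 = f := by omega
    rw [← hu, h2]
    subst hm
    push_cast
    rw [h1]
    ring
  have key : ∀ n ∈ Γ, ∃ a : ℤ, ∃ j : ℕ, j < m ∧
      ((j ≤ 2 * q + 1 ∧ (j : ℤ) ≤ a) ∨ (2 * q + 2 ≤ j ∧ (q : ℤ) - c ≤ a)) ∧
      (n : ℤ) = a * m + j * (2 * c + 1) := by
    intro n hn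
    rw [hΓ] at hn
    induction hn using AddSubmonoid.closure_induction with
    | mem x hx =>
      rcases hx with (rfl | hx) | ⟨kk, hkk, rfl⟩
      · exact ⟨1, 0, by omega, by omega, by push_cast; ring⟩
      · rw [Set.mem_singleton_iff] at hx
        subst hx
        exact ⟨1, 1, by omega, by omega, by push_cast; ring⟩
      · exact ⟨(q : ℤ) - c, 2 * q + 2 + kk, by omega, by omega, hgen kk⟩
    | zero => exact ⟨0, 0, by omega, by omega, by simp⟩
    | add x y _ _ hx hy =>
      obtain ⟨a, i, hi, hai, hx⟩ := hx
      obtain ⟨b, j, hj, hbj, hy⟩ := hy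
      by_cases h : i + j < m
      · refine ⟨a + b, i + j, h, by omega, ?_⟩
        push_cast
        rw [hx, hy]
        ring
      · obtain ⟨t, ht⟩ : ∃ t, i + j = t + m := ⟨i + j - m, by omega⟩
        refine ⟨a + b + (2 * c + 1), t, by omega, by omega, ?_⟩
        have ht' : (i : ℤ) + j = t + m := by exact_mod_cast ht
        push_cast
        rw [hx, hy]
        linear_combination (2 * (c : ℤ) + 1) * ht'
  have hcop : IsCoprime (m : ℤ) (2 * c + 1 : ℤ) := by
    have := Nat.isCoprime_iff_coprime.mpr hgcd
    exact_mod_cast this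
  have uniq : ∀ (a b : ℤ) (i j : ℕ), i < m → j < m →
      a * m + i * (2 * c + 1) = b * m + j * (2 * c + 1) → i = j ∧ a = b := by
    intro a b i j hi hj h
    have hdvd : (m : ℤ) ∣ ((i : ℤ) - j) * (2 * c + 1) := ⟨b - a, by linear_combination h⟩
    have h2 : (m : ℤ) ∣ (i : ℤ) - j := hcop.dvd_of_dvd_mul_right hdvd
    have h3 : (i : ℤ) - j = 0 := by
      apply Int.eq_zero_of_abs_lt_dvd h2
      rw [abs_lt]
      constructor <;> omega
    have hij : i = j := by omega
    subst hij
    refine ⟨rfl, ?_⟩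
    have hm0 : (m : ℤ) ≠ 0 := by omega
    exact mul_right_cancel₀ hm0 (by linear_combination h)
  have memm : m ∈ Γ := by
    rw [hΓ]; exact AddSubmonoid.subset_closure (by simp)
  have memd : m + (2 * c + 1) ∈ Γ := by
    rw [hΓ]; exact AddSubmonoid.subset_closure (by simp)
  have memk : ∀ kk ≤ f + f - 3,
      q * (m + 1) + (q - (f + f - 4) / 2 + kk) * (2 * c + 1) + (f + f) / 2 ∈ Γ := by
    intro kk hkk
    rw [hΓ]; exact AddSubmonoid.subset_closure (Or.inr ⟨kk, hkk, rfl⟩)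
  have memj : ∀ k : ℕ, k * (m + (2 * c + 1)) ∈ Γ := by
    intro k
    simpa using Γ.nsmul_mem memd k
  have memadd : ∀ w ∈ Γ, ∀ r : ℕ, w + r * m ∈ Γ := by
    intro w hw r
    exact Γ.add_mem hw (by simpa using Γ.nsmul_mem memm r)
  -- an element exceeding its Apery representative is not in the Apery set
  have red : ∀ s w : ℕ, w ∈ Γ → (¬ ∃ t ∈ Γ, s = t + m) → ∀ r : ℤ, 0 ≤ r →
      (s : ℤ) = w + r * m → s = w := by
    intro s w hw hs r hr h
    obtain ⟨r, rfl⟩ := Int.eq_ofNat_of_zero_le hr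
    have h' : s = w + r * m := by exact_mod_cast h
    cases r with
    | zero => simpa using h'
    | succ r => exact absurd ⟨w + r * m, memadd w hw r, by rw [h']; ring⟩ hs
  ext s
  simp only [Set.mem_setOf_eq, Set.mem_union]
  constructor
  · rintro ⟨hs, hns⟩
    obtain ⟨a, j, hj, haj, hval⟩ := key s hs
    rcases haj with ⟨h1, h2⟩ | ⟨h1, h2⟩
    · right
      refine ⟨j, h1, red s _ (memj j) hns (a - j) (by omega) ?_⟩
      rw [hval]; push_cast; ring
    · left
      obtain ⟨kk, rfl⟩ := Nat.exists_eq_add_of_le h1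
      have hkk : kk ≤ f + f - 3 := by omega
      refine ⟨kk, hkk, red s _ (memk kk hkk) hns (a - (q - c)) (by omega) ?_⟩
      rw [hgen kk, hval]; ring
  · rintro (⟨kk, hkk, rfl⟩ | ⟨kk, hkk, rfl⟩)
    · refine ⟨memk kk hkk, ?_⟩
      rintro ⟨t, ht, h⟩
      obtain ⟨a, j, hj, haj, hval⟩ := key t ht
      have h' := hgen kk
      rw [h, Nat.cast_add, hval] at h'
      obtain ⟨h1, h2⟩ := uniq (a + 1) (q - c) j (2 * q + 2 + kk) hj (by omega)
        (by linear_combination h')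
      omega
    · refine ⟨memj kk, ?_⟩
      rintro ⟨t, ht, h⟩
      obtain ⟨a, j, hj, haj, hval⟩ := key t ht
      have h' : (kk : ℤ) * (m + (2 * c + 1)) = t + m := by exact_mod_cast h
      rw [hval] at h'
      obtain ⟨h1, h2⟩ := uniq (a + 1) kk j kk hj (by omega)
        (by linear_combination -h')
      omega
end

section
/- Let e ≥ 4 be an even integer, q a positive even integer with q ≥ e−4, m = e + 2q, d an odd positive integer with gcd(m, d) = 1, and let Γ = Γ_{(e,q,d)}(𝒯) be the additive submonoid of ℕ generated by 𝒯 = {m, m+d} ∪ {q(m+1) + (q − (e−4)/2 + k)d + e/2 : 0 ≤ k ≤ e−3}. Then the Frobenius number of Γ, i.e., the greatest integer not belonging to Γ, equals 2q(e + 2q + d) + d. -/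
theorem aux_mem (h p q s M : ℕ) (hh : 2 ≤ h) (hp : q + 2 = p + h) (hM : M = h + q) (hph : h ≤ p + 2)
    (x : ℕ)
    (hx : x ∈ AddSubmonoid.closure ({2 * M, 2 * M + (2 * s + 1)} ∪
      {x : ℕ | ∃ kk : ℕ, kk + 3 ≤ 2 * h ∧
        x = (2 * q + 1) * M + (p + kk) * (2 * s + 1)})) :
    ∃ A B : ℕ, x = A * M + B * (2 * s + 1) ∧
      ((A % 2 = 0 ∧ 2 * B ≤ A) ∨
       (A % 2 = 1 ∧ 2 * q + 1 ≤ A ∧ p ≤ B ∧ 2 * B + (2 * q + 1) + 2 ≤ A + 2 * (q + h)) ∨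
       (4 * q + 2 ≤ A ∧ 2 * p ≤ B)) := by
  induction hx using AddSubmonoid.closure_induction with
  | mem x hx =>
    rcases hx with (rfl | hx) | ⟨k, hk, rfl⟩
    · exact ⟨2, 0, by ring, by omega⟩
    · exact ⟨2, 1, by rw [hx]; ring, by omega⟩
    · exact ⟨2 * q + 1, p + k, rfl, by omega⟩
  | zero => exact ⟨0, 0, by simp, by omega⟩
  | add x y _ _ hx hy =>
    obtain ⟨A, B, rfl, h1⟩ := hx
    obtain ⟨A', B', rfl, h2⟩ := hy
    refine ⟨A + A', B + B', by ring, ?_⟩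
    rcases h1 with h1 | h1 | h1 <;> rcases h2 with h2 | h2 | h2 <;> omega

theorem aux_main (h p q s M : ℕ) (hh : 2 ≤ h) (hp : q + 2 = p + h) (hM : M = h + q)
    (hph : h ≤ p + 2) (hg : Nat.Coprime (2 * M) (2 * s + 1)) (Γ : AddSubmonoid ℕ)
    (hΓ : Γ = AddSubmonoid.closure ({2 * M, 2 * M + (2 * s + 1)} ∪
      {x : ℕ | ∃ kk : ℕ, kk + 3 ≤ 2 * h ∧
        x = (2 * q + 1) * M + (p + kk) * (2 * s + 1)})) :
    IsGreatest {x : ℕ | x ∉ Γ} (4 * q * M + (2 * q + 1) * (2 * s + 1)) := by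
  constructor
  · intro hx
    rw [hΓ] at hx
    obtain ⟨A, B, hAB, hc⟩ := aux_mem h p q s M hh hp hM hph _ hx
    have hco : IsCoprime (M : ℤ) ((2 * s + 1 : ℕ) : ℤ) :=
      Nat.isCoprime_iff_coprime.2 (Nat.Coprime.coprime_mul_left hg)
    have hz : ((A : ℤ) - 4 * q) * M = (2 * q + 1 - B) * ((2 * s + 1 : ℕ) : ℤ) := by
      zify at hAB; push_cast; linarith
    obtain ⟨t, ht⟩ : (M : ℤ) ∣ (2 * q + 1 - B) :=
      hco.dvd_of_dvd_mul_right ⟨(A : ℤ) - 4 * q, by rw [← hz]; ring⟩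
    have hM0 : (M : ℤ) ≠ 0 := by omega
    have hA : (A : ℤ) - 4 * q = t * (2 * s + 1) := by
      apply mul_right_cancel₀ hM0
      rw [hz, ht]; push_cast; ring
    have hcases : t ≤ -1 ∨ t = 0 ∨ t = 1 ∨ 2 ≤ t := by omega
    rcases hcases with h1 | rfl | rfl | h1
    · have h2 : t * (2 * s + 1 : ℤ) ≤ -1 := by nlinarith
      have h3 : (M : ℤ) * t ≤ -M := by nlinarith
      omega
    · omega
    · omega
    · have h3 : (M : ℤ) * 2 ≤ M * t := by nlinarith
      omega
  · intro x hx
    by_contra hlt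
    push Not at hlt
    apply hx
    have hm1 : 1 < 2 * M := by omega
    have g1 : 2 * M ∈ Γ := by rw [hΓ]; exact AddSubmonoid.subset_closure (by simp)
    have g2 : 2 * M + (2 * s + 1) ∈ Γ := by
      rw [hΓ]; exact AddSubmonoid.subset_closure (by simp)
    have g3 : ∀ k, k + 3 ≤ 2 * h → (2 * q + 1) * M + (p + k) * (2 * s + 1) ∈ Γ := by
      intro k hk
      rw [hΓ]; exact AddSubmonoid.subset_closure (Or.inr ⟨k, hk, rfl⟩)
    obtain ⟨B, hB, hBx⟩ : ∃ B < 2 * M, (B * (2 * s + 1)) ≡ x [MOD 2 * M] := by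
      obtain ⟨u, hu⟩ := Nat.exists_mul_mod_eq_one_of_coprime hg.symm hm1
      have hu' : (2 * s + 1) * u ≡ 1 [MOD 2 * M] := by
        unfold Nat.ModEq; rw [Nat.mod_eq_of_lt hm1]; exact hu.2
      refine ⟨(x * u) % (2 * M), Nat.mod_lt _ (by omega), ?_⟩
      calc (x * u) % (2 * M) * (2 * s + 1) ≡ x * u * (2 * s + 1) [MOD 2 * M] :=
            (Nat.mod_modEq _ _).mul_right _
        _ = x * ((2 * s + 1) * u) := by ring
        _ ≡ x * 1 [MOD 2 * M] := hu'.mul_left _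
        _ = x := by ring
    have key : ∀ w ∈ Γ, w ≤ 4 * q * M + (2 * q + 1) * (2 * s + 1) + 2 * M →
        w ≡ x [MOD 2 * M] → x ∈ Γ := by
      intro w hw hle hmod
      obtain ⟨j, hj⟩ := hmod.dvd
      have hj0 : 0 ≤ j := by
        by_contra hneg
        have : ((2 * M : ℕ) : ℤ) * j ≤ -((2 * M : ℕ) : ℤ) := by nlinarith
        omega
      lift j to ℕ using hj0
      have : x = w + j • (2 * M) := by
        zify; simp only [smul_eq_mul]; push_cast at hj ⊢; linarith
      rw [this]
      exact Γ.add_mem hw (Γ.nsmul_mem g1 j)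
    by_cases hB2 : B ≤ 2 * q + 1
    · refine key (B • (2 * M + (2 * s + 1))) (Γ.nsmul_mem g2 B) ?_ ?_
      · have := Nat.mul_le_mul_right (2 * M + (2 * s + 1)) hB2
        simp only [smul_eq_mul]; linarith
      · refine Nat.ModEq.trans ?_ hBx
        simp only [smul_eq_mul, mul_add B]
        simp [Nat.ModEq]
    · obtain ⟨k, rfl⟩ : ∃ k, B = 2 * q + 2 + k := ⟨B - (2 * q + 2), by omega⟩
      refine key _ (g3 k (by omega)) ?_ ?_
      · have h1 : p + k ≤ 2 * q + 1 := by omega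
        have := Nat.mul_le_mul_right (2 * s + 1) h1
        nlinarith
      · refine Nat.ModEq.trans ?_ hBx
        rw [Nat.modEq_iff_dvd]
        refine ⟨(s : ℤ) - q, ?_⟩
        have : 2 * q + 2 + k = p + k + M := by omega
        rw [this]; push_cast; ring

theorem statement12 (e q d m : ℕ) (he : 4 ≤ e) (heven : Even e) (hq : 0 < q) (hqeven : Even q)
    (hqe : e - 4 ≤ q) (hm : m = e + 2 * q) (hd : 0 < d) (hdodd : Odd d)
    (hgcd : Nat.gcd m d = 1)
    (Γ : AddSubmonoid ℕ)
    (hΓ : Γ = AddSubmonoid.closure ({m, m + d} ∪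
      {x : ℕ | ∃ kk : ℕ, kk ≤ e - 3 ∧
        x = q * (m + 1) + (q - (e - 4) / 2 + kk) * d + e / 2})) :
    IsGreatest {x : ℕ | x ∉ Γ} (2 * q * (e + 2 * q + d) + d) := by
  obtain ⟨h, rfl⟩ := heven
  obtain ⟨s, rfl⟩ := hdodd
  obtain ⟨p, hp⟩ : ∃ p, q + 2 = p + h := ⟨q + 2 - h, by omega⟩
  have hm' : m = 2 * (h + q) := by omega
  subst hm'
  have h1 : q - (h + h - 4) / 2 = p := by omega
  have h2 : (h + h) / 2 = h := by omega
  have key := aux_main h p q s (h + q) (by omega) hp rfl (by omega) hgcd Γ (by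
    rw [hΓ, h1, h2]
    congr 2
    ext x
    constructor
    · rintro ⟨k, hk, rfl⟩
      exact ⟨k, by omega, by ring⟩
    · rintro ⟨k, hk, rfl⟩
      exact ⟨k, by omega, by ring⟩)
  convert key using 1
  ring
end

section
/- Let e ≥ 4 be an integer, q a positive integer, m = e + 2q + 1, d a positive integer with gcd(m, d) = 1, and let Γ = Γ_{(e,q,d)}(𝒮) be the additive submonoid of ℕ generated by 𝒮 = {m, m+d} ∪ {(q+1)m + (q+i)d : 2 ≤ i ≤ e−1}. Then Γ is symmetric: its Frobenius number F(Γ) is odd, and for every integer x with x ∉ Γ, the integer F(Γ) − x belongs to Γ. -/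
/-- Minimal number of copies of `m` needed for `d`-coordinate `j`. -/
def apc (e q j : ℕ) : ℕ := min (min j (q + 1 + (j - (q + e - 1)))) (2 * q + 2)

theorem apc_add (e q i j : ℕ) (he : 4 ≤ e) : apc e q (i + j) ≤ apc e q i + apc e q j := by
  unfold apc; omega

theorem apc_mono (e q i j : ℕ) (h : i ≤ j) : apc e q i ≤ apc e q j := by
  unfold apc; omega

theorem apc_symm (e q j : ℕ) (he : 4 ≤ e) (h : j ≤ 2 * q + e) :
    apc e q j + apc e q (2 * q + e - j) = 2 * q + 2 := by
  unfold apc; omega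

theorem exists_rep (m d : ℕ) (hm : 0 < m) (hgcd : Nat.gcd m d = 1) (x : ℤ) :
    ∃ (j : ℕ) (k : ℤ), j < m ∧ x = k * m + j * d := by
  have hb := Nat.gcd_eq_gcd_ab m d
  rw [hgcd] at hb
  set a := Nat.gcdA m d
  set b := Nat.gcdB m d
  have hm' : (0 : ℤ) < m := by exact_mod_cast hm
  have h0 := Int.emod_nonneg (x * b) hm'.ne'
  have h1 := Int.emod_lt_of_pos (x * b) hm'
  have h2 := Int.emod_add_mul_ediv (x * b) m
  refine ⟨((x * b) % m).toNat, x * a + d * ((x * b) / m), by omega, ?_⟩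
  rw [Int.toNat_of_nonneg h0]
  push_cast at hb
  linear_combination x * hb - d * h2

theorem rep_unique (m d j j' : ℕ) (k k' : ℤ) (hgcd : Nat.gcd m d = 1) (hj : j < m) (hj' : j' < m)
    (h : k * m + j * d = k' * m + j' * d) : j = j' ∧ k = k' := by
  have hc : IsCoprime (m : ℤ) (d : ℤ) := Nat.isCoprime_iff_coprime.mpr hgcd
  have h1 : (m : ℤ) ∣ (d : ℤ) * ((j : ℤ) - j') := ⟨k' - k, by linear_combination h⟩
  have h2 := hc.dvd_of_dvd_mul_left h1
  have h3 : (j : ℤ) - j' = 0 := by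
    apply Int.eq_zero_of_abs_lt_dvd h2
    rw [abs_lt]; omega
  have h4 : j = j' := by omega
  subst h4
  refine ⟨rfl, ?_⟩
  have : (m : ℤ) ≠ 0 := by omega
  apply mul_right_cancel₀ this
  linarith

theorem mem_iff (e q d m : ℕ) (he : 4 ≤ e) (hm : m = e + 2 * q + 1) (x : ℕ) :
    x ∈ AddSubmonoid.closure ({m, m + d} ∪
      {x : ℕ | ∃ i : ℕ, 2 ≤ i ∧ i ≤ e - 1 ∧ x = (q + 1) * m + (q + i) * d}) ↔
    ∃ j k : ℕ, j < m ∧ apc e q j ≤ k ∧ x = k * m + j * d := by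
  constructor
  · intro hx
    have hT : ∃ j k : ℕ, apc e q j ≤ k ∧ x = k * m + j * d := by
      induction hx using AddSubmonoid.closure_induction with
      | mem x hx =>
        rcases hx with (rfl | rfl) | ⟨i, h2, hi, rfl⟩
        · exact ⟨0, 1, by unfold apc; omega, by ring⟩
        · exact ⟨1, 1, by unfold apc; omega, by ring⟩
        · exact ⟨q + i, q + 1, by unfold apc; omega, rfl⟩
      | zero => exact ⟨0, 0, by unfold apc; omega, by ring⟩
      | add x y _ _ hx hy =>
        obtain ⟨j, k, h, rfl⟩ := hx
        obtain ⟨j', k', h', rfl⟩ := hy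
        exact ⟨j + j', k + k', (apc_add e q j j' he).trans (by omega), by ring⟩
    obtain ⟨j, k, h, rfl⟩ := hT
    refine ⟨j % m, k + d * (j / m), Nat.mod_lt _ (by omega), ?_, ?_⟩
    · exact (apc_mono e q _ _ (Nat.mod_le j m)).trans (by omega)
    · have := Nat.mod_add_div j m
      conv_lhs => rw [← this]
      ring
  · rintro ⟨j, k, hj, hk, rfl⟩
    set Γ := AddSubmonoid.closure ({m, m + d} ∪
      {x : ℕ | ∃ i : ℕ, 2 ≤ i ∧ i ≤ e - 1 ∧ x = (q + 1) * m + (q + i) * d}) with hΓ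
    have g0 : ∀ n, n * m ∈ Γ := fun n => by
      have : m ∈ Γ := AddSubmonoid.subset_closure (by simp)
      simpa using Γ.nsmul_mem this n
    have g1 : ∀ n, n * (m + d) ∈ Γ := fun n => by
      have : m + d ∈ Γ := AddSubmonoid.subset_closure (by simp)
      simpa using Γ.nsmul_mem this n
    have g2 : ∀ i, 2 ≤ i → i ≤ e - 1 → (q + 1) * m + (q + i) * d ∈ Γ := fun i h h' =>
      AddSubmonoid.subset_closure (Or.inr ⟨i, h, h', rfl⟩)
    unfold apc at hk
    by_cases h1 : j ≤ q + 1
    · obtain ⟨t, rfl⟩ : ∃ t, k = j + t := ⟨k - j, by omega⟩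
      convert Γ.add_mem (g1 j) (g0 t) using 1
      ring
    · by_cases h2 : j ≤ q + e - 1
      · obtain ⟨i, rfl⟩ : ∃ i, j = q + i := ⟨j - q, by omega⟩
        obtain ⟨t, rfl⟩ : ∃ t, k = q + 1 + t := ⟨k - (q + 1), by omega⟩
        convert Γ.add_mem (g2 i (by omega) (by omega)) (g0 t) using 1
        ring
      · obtain ⟨s, rfl⟩ : ∃ s, j = q + (e - 1) + s := ⟨j - (q + (e - 1)), by omega⟩
        obtain ⟨t, rfl⟩ : ∃ t, k = q + 1 + s + t := ⟨k - (q + 1 + s), by omega⟩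
        convert Γ.add_mem (Γ.add_mem (g2 (e - 1) (by omega) (by omega)) (g1 s)) (g0 t) using 1
        ring

theorem statement13 (e q d m : ℕ) (he : 4 ≤ e) (hq : 0 < q) (hm : m = e + 2 * q + 1)
    (hd : 0 < d) (hgcd : Nat.gcd m d = 1)
    (Γ : AddSubmonoid ℕ)
    (hΓ : Γ = AddSubmonoid.closure ({m, m + d} ∪
      {x : ℕ | ∃ i : ℕ, 2 ≤ i ∧ i ≤ e - 1 ∧ x = (q + 1) * m + (q + i) * d}))
    (F : ℕ) (hF : IsGreatest {x : ℕ | x ∉ Γ} F) :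
    Odd F ∧
      ∀ x : ℤ, x ∉ (Nat.cast '' (Γ : Set ℕ) : Set ℤ) →
        (F : ℤ) - x ∈ (Nat.cast '' (Γ : Set ℕ) : Set ℤ) := by
  have hmem : ∀ x : ℕ, x ∈ Γ ↔ ∃ j k : ℕ, j < m ∧ apc e q j ≤ k ∧ x = k * m + j * d := by
    intro x; rw [hΓ]; exact mem_iff e q d m he hm x
  have key : ∀ x : ℤ, x ∉ (Nat.cast '' (Γ : Set ℕ) : Set ℤ) →
      (((2 * q + 1) * m + (2 * q + e) * d : ℕ) : ℤ) - x ∈ (Nat.cast '' (Γ : Set ℕ) : Set ℤ) := by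
    intro x hx
    obtain ⟨j, k, hj, rfl⟩ := exists_rep m d (by omega) hgcd x
    have hk : k < apc e q j := by
      by_contra hk
      push Not at hk
      obtain ⟨k', rfl⟩ := Int.eq_ofNat_of_zero_le (show 0 ≤ k by omega)
      exact hx ⟨k' * m + j * d, (hmem _).2 ⟨j, k', hj, by exact_mod_cast hk, rfl⟩, by push_cast; rfl⟩
    have hs := apc_symm e q j he (by omega)
    obtain ⟨t, ht⟩ := Int.eq_ofNat_of_zero_le (show 0 ≤ 2 * q + 1 - k by omega)
    refine ⟨t * m + (2 * q + e - j) * d, (hmem _).2 ⟨2 * q + e - j, t, by omega, by omega, rfl⟩, ?_⟩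
    push_cast [Nat.cast_sub (show j ≤ 2 * q + e by omega)]
    linear_combination -(m : ℤ) * ht
  have hF0 : (2 * q + 1) * m + (2 * q + e) * d ∉ Γ := by
    rw [hmem]
    rintro ⟨j, k, hj, hk, h⟩
    obtain ⟨h1, h2⟩ := rep_unique m d (2 * q + e) j ((2 * q + 1 : ℕ) : ℤ) k hgcd (by omega) hj
      (by exact_mod_cast h)
    subst h1
    have : k = 2 * q + 1 := by omega
    unfold apc at hk
    omega
  have hFe : F = (2 * q + 1) * m + (2 * q + e) * d := by
    apply le_antisymm _ (hF.2 hF0)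
    have h := key F (by
      rintro ⟨y, hy, hyF⟩
      have : y = F := by exact_mod_cast hyF
      exact hF.1 (this ▸ hy))
    obtain ⟨y, -, hy⟩ := h
    omega
  rw [← hFe] at key
  refine ⟨?_, key⟩
  by_contra ho
  rw [Nat.not_odd_iff_even] at ho
  obtain ⟨r, hr⟩ := ho
  have hrn : r ∉ Γ := fun h => hF.1 (hr ▸ Γ.add_mem h h)
  obtain ⟨y, hy, hyr⟩ := key r (by
    rintro ⟨y, hy, hyF⟩
    have : y = r := by exact_mod_cast hyF
    exact hrn (this ▸ hy))
  have : y = r := by omega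
  exact hrn (this ▸ hy)
end

section
/- Let e ≥ 4 be an even integer, q a positive even integer with q ≥ e−4, m = e + 2q, d an odd positive integer with gcd(m, d) = 1, and let Γ = Γ_{(e,q,d)}(𝒯) be the additive submonoid of ℕ generated by 𝒯 = {m, m+d} ∪ {q(m+1) + (q − (e−4)/2 + k)d + e/2 : 0 ≤ k ≤ e−3}. Then Γ is symmetric: its Frobenius number F(Γ) is odd, and for every integer x with x ∉ Γ, the integer F(Γ) − x belongs to Γ. -/
/-- Normal form of elements of the monoid. -/
theorem mem_form (b r d : ℕ) (x : ℕ)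
    (hx : x ∈ AddSubmonoid.closure (({2*(2*b+r+2), 2*(2*b+r+2) + d} : Set ℕ) ∪
      {x : ℕ | ∃ kk : ℕ, kk ≤ 2*b+1 ∧
        x = (b+r)*(2*(2*b+r+2)) + (2*b+r+2) + (r+kk)*d})) :
    ∃ A B C K : ℕ, K ≤ C*(2*b+1) ∧
      x = A*(2*(2*b+r+2)) + B*(2*(2*b+r+2)+d) + C*((b+r)*(2*(2*b+r+2)) + (2*b+r+2) + r*d)
        + K*d := by
  induction hx using AddSubmonoid.closure_induction with
  | mem x h =>
    rcases h with (h | h) | ⟨k, hk, h⟩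
    · exact ⟨1, 0, 0, 0, by simp, by rw [h]; ring⟩
    · exact ⟨0, 1, 0, 0, by simp, by rw [Set.mem_singleton_iff.1 h]; ring⟩
    · exact ⟨0, 0, 1, k, by omega, by rw [h]; ring⟩
  | zero => exact ⟨0, 0, 0, 0, by simp, by simp⟩
  | add x y _ _ h1 h2 =>
    obtain ⟨A, B, C, K, hK, h⟩ := h1
    obtain ⟨A', B', C', K', hK', h'⟩ := h2
    exact ⟨A+A', B+B', C+C', K+K', by rw [add_mul]; omega, by rw [h, h']; ring⟩

set_option maxHeartbeats 2000000 in
/-- The candidate Frobenius number is a gap. -/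
theorem gap (b r d : ℕ) (hbr : b ≤ r) (hq : 0 < b + r) (hdodd : Odd d)
    (hg : Nat.gcd (2*(2*b+r+2)) d = 1) (A B C K : ℕ) (hK : K ≤ C*(2*b+1))
    (h : 2*(b+r)*(2*(2*b+r+2)) + (2*(b+r)+1)*d
      = A*(2*(2*b+r+2)) + B*(2*(2*b+r+2)+d) + C*((b+r)*(2*(2*b+r+2)) + (2*b+r+2) + r*d)
        + K*d) : False := by
  obtain ⟨c, hc⟩ := hdodd
  obtain ⟨H, hH⟩ : ∃ H : ℤ, H = 2*b+r+2 := ⟨_, rfl⟩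
  have hHpos : 0 < H := by omega
  have hco : IsCoprime (2*H) (d:ℤ) := by
    have := Nat.isCoprime_iff_coprime.2 hg
    rw [hH]; push_cast at this; exact this
  have hz : 2*((b:ℤ)+r)*(2*H) + (2*(b+r)+1)*d
      = A*(2*H) + B*(2*H+d) + C*((b+r)*(2*H) + H + r*d) + K*d := by
    rw [hH]; exact_mod_cast h
  have hd : (d:ℤ) = 2*c+1 := by exact_mod_cast hc
  obtain ⟨S, hS⟩ : ∃ S : ℤ, S = B + C*r + K := ⟨_, rfl⟩
  have hS0 : 0 ≤ S := by rw [hS]; positivity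
  have hBS : (B:ℤ) ≤ S := by
    have : (0:ℤ) ≤ C*r + K := by positivity
    linarith
  rcases Nat.even_or_odd' C with ⟨n, hn | hn⟩
  · have hCz : (C:ℤ) = 2*n := by exact_mod_cast hn
    have hdvd : 2*H ∣ (d:ℤ) * (S - (2*(b+r)+1)) := by
      refine ⟨2*(b+r) - A - B - n*(2*(b+r)+1), ?_⟩
      rw [hS]; rw [hCz] at hz ⊢; linear_combination -hz
    obtain ⟨t, ht⟩ := hco.dvd_of_dvd_mul_left hdvd
    have ht0 : 0 ≤ t := by
      by_contra hneg
      have : t ≤ -1 := by omega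
      nlinarith
    have key : (A:ℤ) + B + n*(2*(b+r)+1) + t*d = 2*(b+r) := by
      have : (2*H) * ((A:ℤ) + B + n*(2*(b+r)+1) + t*d) = (2*H) * (2*(b+r)) := by
        rw [hCz] at hz hS; linear_combination (-1:ℤ)*hz - d*ht + d*hS
      exact mul_left_cancel₀ (by omega) this
    have htd : 0 ≤ t*d := by positivity
    have htH : 0 ≤ 2*H*t := by positivity
    rcases Nat.eq_zero_or_pos n with h0 | h0
    · subst h0
      have hC0 : C = 0 := by omega
      subst hC0
      have hK0 : K = 0 := by omega
      subst hK0
      push_cast at *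
      linarith
    · have : (1:ℤ) ≤ n := by exact_mod_cast h0
      nlinarith
  · have hCz : (C:ℤ) = 2*n+1 := by exact_mod_cast hn
    have hdvd : 2*H ∣ (d:ℤ) * (S - (r-1)) := by
      refine ⟨(b+r) - A - B - n*(2*(b+r)+1) + c, ?_⟩
      rw [hS]; rw [hCz] at hz ⊢
      linear_combination -hz + H * hd - d * hH
    obtain ⟨t, ht⟩ := hco.dvd_of_dvd_mul_left hdvd
    have hSr : (r:ℤ) ≤ S := by
      rw [hS, hCz]
      have : (0:ℤ) ≤ B + 2*n*r + K := by positivity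
      linarith
    have ht1 : 1 ≤ t := by
      by_contra hneg
      have : t ≤ 0 := by omega
      nlinarith
    have key : (A:ℤ) + B + n*(2*(b+r)+1) + t*d = (b+r) + c := by
      have : (2*H) * ((A:ℤ) + B + n*(2*(b+r)+1) + t*d) = (2*H) * ((b+r)+c) := by
        rw [hCz] at hz hS
        linear_combination (-1:ℤ)*hz - d*ht + d*hS + H*hd - d*hH
      exact mul_left_cancel₀ (by omega) this
    have htd : (d:ℤ) ≤ t*d := by nlinarith
    have htH : 2*H ≤ 2*H*t := by nlinarith
    rcases Nat.eq_zero_or_pos n with h0 | h0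
    · subst h0
      have hC1 : C = 1 := by omega
      subst hC1
      have hK0 : (K:ℤ) ≤ 2*b+1 := by exact_mod_cast (by omega : K ≤ 2*b+1)
      push_cast at *
      linarith
    · have : (1:ℤ) ≤ n := by exact_mod_cast h0
      nlinarith

/-- Symmetry about the candidate Frobenius number. -/
theorem symm_form (b r d : ℕ) (hdodd : Odd d)
    (hg : Nat.gcd (2*(2*b+r+2)) d = 1) (Γ : AddSubmonoid ℕ)
    (h1 : 2*(2*b+r+2) ∈ Γ) (h2 : 2*(2*b+r+2) + d ∈ Γ)
    (h3 : ∀ k ≤ 2*b+1, (b+r)*(2*(2*b+r+2)) + (2*b+r+2) + (r+k)*d ∈ Γ) (x : ℤ) :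
    (∃ y ∈ Γ, (y:ℤ) = x) ∨
    ∃ y ∈ Γ, (y:ℤ) = 2*(b+r)*(2*(2*b+r+2)) + (2*(b+r)+1)*d - x := by
  obtain ⟨c, hc⟩ := hdodd
  have hd : (d:ℤ) = 2*c+1 := by exact_mod_cast hc
  have aux : ∀ w ∈ Γ, ∀ w' ∈ Γ, ∀ t : ℤ,
      (w:ℤ) + w' = (2*(b+r)+1)*(2*(2*b+r+2)+d) → x = w + t*(2*(2*b+r+2)) →
      (∃ y ∈ Γ, (y:ℤ) = x) ∨
      ∃ y ∈ Γ, (y:ℤ) = 2*(b+r)*(2*(2*b+r+2)) + (2*(b+r)+1)*d - x := by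
    intro w hw w' hw' t hs hx
    rcases le_or_gt 0 t with ht | ht
    · left
      obtain ⟨n, rfl⟩ := Int.eq_ofNat_of_zero_le ht
      exact ⟨w + n • (2*(2*b+r+2)), Γ.add_mem hw (Γ.nsmul_mem h1 n), by
        rw [hx]; simp⟩
    · right
      obtain ⟨n, hn⟩ := Int.eq_ofNat_of_zero_le (show 0 ≤ -t-1 by omega)
      refine ⟨w' + n • (2*(2*b+r+2)), Γ.add_mem hw' (Γ.nsmul_mem h1 n), ?_⟩
      rw [hx]; simp only [smul_eq_mul]; push_cast; rw [← hn]; linear_combination hs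
  have hco : IsCoprime (2*(2*b+r+2) : ℤ) (d:ℤ) := by
    have := Nat.isCoprime_iff_coprime.2 hg
    push_cast at this; exact this
  obtain ⟨u, v, huv⟩ := hco
  have hM : (0:ℤ) < 2*(2*b+r+2) := by positivity
  obtain ⟨j, hj⟩ := Int.eq_ofNat_of_zero_le (Int.emod_nonneg (x*v) hM.ne')
  have hlt := Int.emod_lt_of_pos (x*v) hM
  have hdm := Int.emod_add_mul_ediv (x*v) (2*(2*b+r+2) : ℤ)
  rw [hj] at hlt hdm
  set s := (x*v) / (2*(2*b+r+2) : ℤ)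
  have hx : x = j*d + (x*u + s*d) * (2*(2*b+r+2)) := by
    linear_combination (-x)*huv - d*hdm
  rcases le_or_gt j (2*(b+r)+1) with hle | hgt
  · obtain ⟨j', hj'⟩ := Nat.exists_eq_add_of_le hle
    refine aux _ (Γ.nsmul_mem h2 j) _ (Γ.nsmul_mem h2 j') (x*u+s*d-j) ?_ ?_
    · have : (2*(b+r)+1:ℤ) = j + j' := by exact_mod_cast hj'
      rw [this]; push_cast; simp only [smul_eq_mul]; push_cast; ring
    · simp only [smul_eq_mul]; push_cast; linear_combination hx
  · obtain ⟨k, hk⟩ := Nat.exists_eq_add_of_lt hgt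
    have hk1 : k ≤ 2*b+1 := by omega
    obtain ⟨k', hk'⟩ := Nat.exists_eq_add_of_le hk1
    have hkz : (2*b+1:ℤ) = k + k' := by exact_mod_cast hk'
    have hjz : (j:ℤ) = 2*(b+r)+1+k+1 := by exact_mod_cast hk
    refine aux _ (h3 k hk1) _ (h3 k' (by omega)) (x*u+s*d+c-(b+r)) ?_ ?_
    · push_cast; linear_combination (-d:ℤ)*hkz
    · push_cast; linear_combination hx + d*hjz + (2*b+r+2)*hd


theorem statement14 (e q d m : ℕ) (he : 4 ≤ e) (heven : Even e) (hq : 0 < q) (hqeven : Even q)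
    (hqe : e - 4 ≤ q) (hm : m = e + 2 * q) (hd : 0 < d) (hdodd : Odd d)
    (hgcd : Nat.gcd m d = 1)
    (Γ : AddSubmonoid ℕ)
    (hΓ : Γ = AddSubmonoid.closure ({m, m + d} ∪
      {x : ℕ | ∃ kk : ℕ, kk ≤ e - 3 ∧
        x = q * (m + 1) + (q - (e - 4) / 2 + kk) * d + e / 2}))
    (F : ℕ) (hF : IsGreatest {x : ℕ | x ∉ Γ} F) :
    Odd F ∧
      ∀ x : ℤ, x ∉ (Nat.cast '' (Γ : Set ℕ) : Set ℤ) →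
        (F : ℤ) - x ∈ (Nat.cast '' (Γ : Set ℕ) : Set ℤ) := by


  obtain ⟨a, ha⟩ := heven
  obtain ⟨b, rfl⟩ := Nat.exists_eq_add_of_le (show 2 ≤ a by omega)
  obtain ⟨r, rfl⟩ := Nat.exists_eq_add_of_le (show b ≤ q by omega)
  have hbr : b ≤ r := by omega
  have hm' : m = 2*(2*b+r+2) := by omega
  subst hm'
  have e1 : e - 3 = 2*b+1 := by omega
  have e2 : b + r - (e-4)/2 = r := by omega
  have e3 : e/2 = b+2 := by omega
  have hgen : ∀ k : ℕ, (b+r)*(2*(2*b+r+2)+1) + (r+k)*d + (b+2)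
      = (b+r)*(2*(2*b+r+2)) + (2*b+r+2) + (r+k)*d := fun k => by ring
  rw [e1, e2, e3] at hΓ
  simp only [hgen] at hΓ
  have hsym := symm_form b r d hdodd hgcd Γ
    (by rw [hΓ]; exact AddSubmonoid.subset_closure (by simp))
    (by rw [hΓ]; exact AddSubmonoid.subset_closure (by simp))
    (fun k hk => by rw [hΓ]; exact AddSubmonoid.subset_closure (Or.inr ⟨k, hk, rfl⟩))
  have hgap : 2*(b+r)*(2*(2*b+r+2)) + (2*(b+r)+1)*d ∉ Γ := by
    intro hmem
    rw [hΓ] at hmem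
    obtain ⟨A, B, C, K, hK, h⟩ := mem_form b r d _ hmem
    exact gap b r d hbr hq hdodd hgcd A B C K hK h
  have hle := hF.2 hgap
  have hFeq : F = 2*(b+r)*(2*(2*b+r+2)) + (2*(b+r)+1)*d := by
    rcases hsym F with ⟨y, hy, hyF⟩ | ⟨y, hy, hyF⟩
    · have : y = F := by exact_mod_cast hyF
      exact absurd (this ▸ hy) hF.1
    · have : y + F = 2*(b+r)*(2*(2*b+r+2)) + (2*(b+r)+1)*d := by
        have : (y:ℤ) + F = 2*(b+r)*(2*(2*b+r+2)) + (2*(b+r)+1)*d := by linarith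
        exact_mod_cast this
      omega
  refine ⟨?_, ?_⟩
  · rw [hFeq]
    refine Even.add_odd ⟨(b+r)*(2*(2*b+r+2)), by ring⟩ (Odd.mul ⟨_, rfl⟩ hdodd)
  · intro x hx
    rcases hsym x with ⟨y, hy, hyx⟩ | ⟨y, hy, hyx⟩
    · exact absurd ⟨y, hy, hyx⟩ hx
    · exact ⟨y, hy, by rw [hyx, hFeq]; push_cast; ring⟩
end

section
/- Let e ≥ 4 be an integer, q a positive integer, m = e + 2q + 1, d a positive integer with gcd(m, d) = 1, and let Γ = Γ_{(e,q,d)}(𝒮) be the additive submonoid of ℕ generated by 𝒮 = {m, m+d} ∪ {(q+1)m + (q+i)d : 2 ≤ i ≤ e−1}. For 2 ≤ i ≤ e−2 set n_i = (q+1)m + (q+i)d. Then for every i with 2 ≤ i ≤ e−2 and every k with 1 ≤ k ≤ q, there is no nonzero element α of the Apéry set Ap(Γ, m) = {s ∈ Γ : s − m ∉ Γ} satisfying α + n_i = k(m+d) + (q+1)m + (q+e−1)d. -/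
theorem statement15 (e q d m : ℕ) (he : 4 ≤ e) (hq : 0 < q) (hm : m = e + 2 * q + 1)
    (hd : 0 < d) (hgcd : Nat.gcd m d = 1)
    (Γ : AddSubmonoid ℕ)
    (hΓ : Γ = AddSubmonoid.closure ({m, m + d} ∪
      {x : ℕ | ∃ i : ℕ, 2 ≤ i ∧ i ≤ e - 1 ∧ x = (q + 1) * m + (q + i) * d})) :
    ∀ i : ℕ, 2 ≤ i → i ≤ e - 2 → ∀ kk : ℕ, 1 ≤ kk → kk ≤ q →
      ¬ ∃ α : ℕ, α ≠ 0 ∧ (α ∈ Γ ∧ ¬ ∃ t ∈ Γ, α = t + m) ∧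
        α + ((q + 1) * m + (q + i) * d) =
          kk * (m + d) + (q + 1) * m + (q + e - 1) * d := by
  have key : ∀ x ∈ Γ, ∃ a b : ℕ, x = a * m + b * d ∧ (a ≤ q → b ≤ a) := by
    intro x hx
    rw [hΓ] at hx
    induction hx using AddSubmonoid.closure_induction with
    | mem x hx =>
      rcases hx with (rfl | hx) | ⟨i, _, _, rfl⟩
      · exact ⟨1, 0, by ring, by omega⟩
      · rw [Set.mem_singleton_iff] at hx
        exact ⟨1, 1, by rw [hx]; ring, by omega⟩
      · exact ⟨q + 1, q + i, rfl, by omega⟩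
    | zero => exact ⟨0, 0, by ring, by omega⟩
    | add x y _ _ hx hy =>
      obtain ⟨a, b, rfl, h⟩ := hx
      obtain ⟨a', b', rfl, h'⟩ := hy
      exact ⟨a + a', b + b', by ring, by omega⟩
  rintro i hi2 hie kk hk1 hkq ⟨α, _, ⟨hα, _⟩, heq⟩
  obtain ⟨a, b, rfl, hab⟩ := key α hα
  obtain ⟨r, hr⟩ : ∃ r, e = i + 1 + r := ⟨e - i - 1, by omega⟩
  have h1 : q + e - 1 = q + i + r := by omega
  rw [h1] at heq
  have h2 : a * m + b * d = kk * m + (kk + r) * d := by nlinarith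
  rcases Nat.lt_or_ge kk a with hlt | hge
  · obtain ⟨c, rfl⟩ := Nat.exists_eq_add_of_lt hlt
    have h3 : (c + 1) * m + b * d = (kk + r) * d := by nlinarith
    have hbj : b < kk + r := by
      by_contra hcon
      have h4 : (kk + r) * d ≤ b * d := Nat.mul_le_mul_right _ (by omega)
      have h5 : 0 < (c + 1) * m := Nat.mul_pos (by omega) (by omega)
      omega
    obtain ⟨s, hs⟩ := Nat.exists_eq_add_of_lt hbj
    rw [hs] at h3
    have h4 : (s + 1) * d = (c + 1) * m := by nlinarith
    have h5 : m ∣ (s + 1) * d := ⟨c + 1, by rw [h4]; ring⟩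
    have h6 : m ∣ s + 1 := Nat.Coprime.dvd_of_dvd_mul_right hgcd h5
    have := Nat.le_of_dvd (by omega) h6
    omega
  · have hb := hab (by omega)
    have h4 : a * m ≤ kk * m := Nat.mul_le_mul_right _ hge
    have h5 : b * d < (kk + r) * d := Nat.mul_lt_mul_of_pos_right (by omega) hd
    omega
end

section
/- Let e ≥ 4 be an even integer, q a positive even integer with q ≥ e−4, m = e + 2q, d an odd positive integer with gcd(m, d) = 1, and let Γ = Γ_{(e,q,d)}(𝒯) be the additive submonoid of ℕ generated by 𝒯 = {m, m+d} ∪ {q(m+1) + (q − (e−4)/2 + i)d + e/2 : 0 ≤ i ≤ e−3}. For 0 ≤ i ≤ e−3 set n_i = q(m+1) + (q − (e−4)/2 + i)d + e/2. Then for every i with 0 ≤ i ≤ e−3 and every k with 2 ≤ k ≤ 2q, there is no nonzero element β of the Apéry set Ap(Γ, m) = {s ∈ Γ : s − m ∉ Γ} satisfying β + n_i = k(m+d). -/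
lemma aux_repr (m d N c b : ℕ) (Γ : AddSubmonoid ℕ)
    (hΓ : Γ = AddSubmonoid.closure ({m, m + d} ∪
      {x : ℕ | ∃ i : ℕ, i ≤ b ∧ x = N + (c + i) * d})) (β : ℕ) (hβ : β ∈ Γ) :
    (∃ t ∈ Γ, β = t + m) ∨
      ∃ y l I : ℕ, (l = 0 → I = 0) ∧ β = y * (m + d) + l * N + (l * c + I) * d := by
  have hβ' := hβ
  rw [hΓ] at hβ'
  induction hβ' using AddSubmonoid.closure_induction with
  | mem x hx =>
    rcases hx with (hx | hx) | ⟨i, hi, hx⟩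
    · left; exact ⟨0, Γ.zero_mem, by simpa using hx⟩
    · right; exact ⟨1, 0, 0, by simp, by simpa using hx⟩
    · right; exact ⟨0, 1, i, by simp, by rw [hx]; ring⟩
  | zero => right; exact ⟨0, 0, 0, by simp, by simp⟩
  | add x y hx hy ihx ihy =>
    have hx' : x ∈ Γ := by rw [hΓ]; exact hx
    have hy' : y ∈ Γ := by rw [hΓ]; exact hy
    rcases ihx hx' with ⟨t, ht, h⟩ | ⟨y1, l1, I1, h1, e1⟩
    · left; exact ⟨t + y, Γ.add_mem ht hy', by omega⟩
    rcases ihy hy' with ⟨t, ht, h⟩ | ⟨y2, l2, I2, h2, e2⟩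
    · left; exact ⟨x + t, Γ.add_mem hx' ht, by omega⟩
    right
    exact ⟨y1 + y2, l1 + l2, I1 + I2, by omega, by rw [e1, e2]; ring⟩

theorem statement16 (e q d m : ℕ) (he : 4 ≤ e) (heven : Even e) (hq : 0 < q) (hqeven : Even q)
    (hqe : e - 4 ≤ q) (hm : m = e + 2 * q) (hd : 0 < d) (hdodd : Odd d)
    (hgcd : Nat.gcd m d = 1)
    (Γ : AddSubmonoid ℕ)
    (hΓ : Γ = AddSubmonoid.closure ({m, m + d} ∪
      {x : ℕ | ∃ i : ℕ, i ≤ e - 3 ∧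
        x = q * (m + 1) + (q - (e - 4) / 2 + i) * d + e / 2})) :
    ∀ i : ℕ, i ≤ e - 3 → ∀ kk : ℕ, 2 ≤ kk → kk ≤ 2 * q →
      ¬ ∃ β : ℕ, β ≠ 0 ∧ (β ∈ Γ ∧ ¬ ∃ t ∈ Γ, β = t + m) ∧
        β + (q * (m + 1) + (q - (e - 4) / 2 + i) * d + e / 2) = kk * (m + d) := by
  rintro i hi k hk2 hkq ⟨β, hβ0, ⟨hβ, hap⟩, heq⟩
  obtain ⟨a, rfl⟩ := heven
  obtain ⟨c, hc⟩ : ∃ c, c = q - (a + a - 4) / 2 := ⟨_, rfl⟩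
  have hca : c + a = q + 2 := by omega
  have ha2 : (a + a) / 2 = a := by omega
  rw [← hc, ha2] at heq
  rw [← hc, ha2] at hΓ
  have hrep := aux_repr m d (q * (m + 1) + a) c (a + a - 3) Γ (by
    rw [hΓ]; congr 2; ext x
    simp only [Set.mem_setOf_eq]
    refine exists_congr fun j => and_congr_right fun _ => ?_
    rw [add_right_comm]) β hβ
  rcases hrep with h | ⟨y, l, I, hlI, hrep⟩
  · exact hap h
  have hN : 2 * (q * (m + 1) + a) = (2 * q + 1) * m := by rw [hm]; ring
  -- key integer equation
  have key : ((l + 1) * (2 * q + 1) + 2 * y - 2 * k : ℤ) * m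
      = 2 * (k - y - (l + 1) * c - (I + i)) * d := by
    zify at heq hrep hN
    linear_combination 2 * heq - 2 * hrep - (l + 1) * hN
  have hcop : IsCoprime (m : ℤ) (d : ℤ) := Nat.isCoprime_iff_coprime.mpr hgcd
  have hdvd : (m : ℤ) ∣ 2 * (k - y - (l + 1) * c - (I + i)) :=
    hcop.dvd_of_dvd_mul_right (Dvd.intro_left _ key)
  have hmpos : (0 : ℤ) < m := by omega
  have hdpos : (0 : ℤ) < d := by omega
  obtain ⟨s, hs⟩ := hdvd
  have key2 : ((l + 1) * (2 * q + 1) + 2 * y - 2 * k : ℤ) = s * d := by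
    rw [hs] at key
    apply mul_right_cancel₀ hmpos.ne'
    rw [key]; ring
  have hlc : (0 : ℤ) ≤ l * c := by positivity
  have hs2 : s < 2 := by
    by_contra h
    push Not at h
    have : (m : ℤ) * 2 ≤ m * s := by gcongr
    have : (2 : ℤ) * (k - y - (l + 1) * c - (I + i)) ≤ 4 * q := by
      push_cast at *
      nlinarith
    omega
  rcases Nat.eq_zero_or_pos l with rfl | hl
  · have hI := hlI rfl
    subst hI
    have hy : 0 < y := by
      rcases Nat.eq_zero_or_pos y with rfl | h
      · simp at hrep; omega
      · exact h
    simp only [Nat.cast_zero, zero_add, one_mul] at key2 hs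
    -- parity: s is odd
    have hsodd : s % 2 = 1 := by
      obtain ⟨r, hr⟩ := hdodd
      rcases Int.even_or_odd s with ⟨w, hw⟩ | ⟨w, hw⟩
      · exfalso
        have : (2 * q + 1 + 2 * y - 2 * k : ℤ) = 2 * (w * d) := by rw [key2, hw]; ring
        omega
      · omega
    have hlow : -3 < s := by
      by_contra h
      push Not at h
      have : (m : ℤ) * s ≤ m * (-3) := by gcongr
      have hyk : y ≤ k := by
        by_contra hh
        push Not at hh
        have : k * (m + d) ≤ y * (m + d) := by gcongr
        have : 0 < q * (m + 1) := by positivity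
        simp at hrep
        omega
      omega
    have : s = 1 ∨ s = -1 := by omega
    rcases this with rfl | rfl
    · have h1 : (2 * q + 1 + 2 * y - 2 * k : ℤ) = d := by rw [key2]; ring
      omega
    · have h1 : (2 * q + 1 + 2 * y - 2 * k : ℤ) = - d := by rw [key2]; ring
      omega
  · have hpos : (0 : ℤ) < s * d := by
      rw [← key2]
      have : (1 : ℤ) ≤ l := by exact_mod_cast hl
      nlinarith
    have hs0 : 0 < s := pos_of_mul_pos_left hpos hdpos.le
    have hs1 : s = 1 := by omega
    subst hs1
    have hl2 : 2 ≤ l := by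
      by_contra h
      have : l = 1 := by omega
      subst this
      obtain ⟨r, hr⟩ := hdodd
      push_cast at key2
      omega
    have : (2 : ℤ) * c ≤ l * c := by gcongr; exact_mod_cast hl2
    have e1 : ((l : ℤ) + 1) * c = l * c + c := by ring
    rw [e1] at hs
    omega
end

section
/- Let e ≥ 4 be an integer, q a positive integer, m = e + 2q + 1, d a positive integer with gcd(m, d) = 1, and let Γ = Γ_{(e,q,d)}(𝒮) be the additive submonoid of ℕ generated by the e elements a_0 = m, a_1 = m+d, a_i = (q+1)m + (q+i)d for 2 ≤ i ≤ e−1. Then every element w of the Apéry set Ap(Γ, m) = {s ∈ Γ : s − m ∉ Γ} other than its maximal element (q+1)(m+d) + (q+1)m + (q+e−1)d has a unique expression as a nonnegative integer combination of a_0, a_1, …, a_{e−1}: if w = ∑_{i=0}^{e−1} c_i a_i = ∑_{i=0}^{e−1} c'_i a_i with all c_i, c'_i ∈ ℕ, then c_i = c'_i for all i. -/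
lemma aux_single {n : ℕ} (f : Fin n → ℕ) (hS : ∑ i, f i ≤ 1) (i : Fin n) (hi : f i ≠ 0) :
    f = Pi.single i 1 := by
  have h1 : f i + ∑ j ∈ Finset.univ.erase i, f j = ∑ j, f j :=
    Finset.add_sum_erase _ _ (Finset.mem_univ i)
  have h2 : ∑ j ∈ Finset.univ.erase i, f j = 0 := by omega
  rw [Finset.sum_eq_zero_iff] at h2
  funext j
  by_cases hj : j = i
  · subst hj
    simp; omega
  · rw [h2 j (by simp [hj])]
    simp [hj]

lemma aux_uniq {n : ℕ} (f g : Fin n → ℕ) (hf : ∑ i, f i ≤ 1)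
    (hS : ∑ i, f i = ∑ i, g i) (hJ : ∑ i, f i * ((i : ℕ) + 2) = ∑ i, g i * ((i : ℕ) + 2)) :
    f = g := by
  by_cases h : ∃ i, f i ≠ 0
  · obtain ⟨i, hi⟩ := h
    have e1 := aux_single f hf i hi
    by_cases h' : ∃ i, g i ≠ 0
    · obtain ⟨k, hk⟩ := h'
      have e2 := aux_single g (hS ▸ hf) k hk
      rw [e1, e2] at hJ
      simp [Pi.single_apply] at hJ
      have : i = k := Fin.ext hJ
      rw [e1, e2, this]
    · push Not at h'
      rw [e1] at hS
      simp [h'] at hS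
  · push Not at h
    have : ∑ i, g i = 0 := by rw [← hS]; simp [h]
    rw [Finset.sum_eq_zero_iff] at this
    funext j
    rw [h j, this j (Finset.mem_univ j)]

lemma aux_core (n q d m : ℕ) (hm : m = (n + 2) + 2 * q + 1) (hn : 2 ≤ n)
    (hd : 0 < d) (G : AddSubmonoid ℕ) (g0 : m ∈ G) (g1 : m + d ∈ G)
    (g2 : ∀ i, i < n → (q + 1) * m + (q + (i + 2)) * d ∈ G)
    (w : ℕ) (hw : ¬ ∃ t ∈ G, w = t + m)
    (hne : w ≠ (q + 1) * (m + d) + (q + 1) * m + (q + (n + 2) - 1) * d)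
    (x S J : ℕ) (hJ : J ≤ (n + 1) * S)
    (e : w = (x + (q + 1) * S) * m + (x + q * S + J) * d) :
    S ≤ 1 ∧ x + q * S + J < m := by
  have key : ∀ r < m, ∃ M, M ≤ 2 * q + 2 ∧ (r + 1 < m → M ≤ 2 * q + 1) ∧ M * m + r * d ∈ G := by
    intro r hr
    by_cases h1 : r ≤ q + 1
    · refine ⟨r, by omega, by omega, ?_⟩
      have := G.nsmul_mem g1 r
      simpa [mul_add] using this
    by_cases h2 : r < q + n + 2
    · refine ⟨q + 1, by omega, by omega, ?_⟩
      have := g2 (r - q - 2) (by omega)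
      rwa [show q + (r - q - 2 + 2) = r by omega] at this
    · obtain ⟨k, hk⟩ : ∃ k, r = q + n + 1 + k := ⟨r - (q + n + 1), by omega⟩
      refine ⟨q + 1 + k, by omega, by omega, ?_⟩
      have := G.add_mem (g2 (n - 1) (by omega)) (G.nsmul_mem g1 k)
      rw [show q + (n - 1 + 2) = q + n + 1 by omega] at this
      convert this using 1
      rw [hk, smul_eq_mul]; ring
  have bnd : x + (q + 1) * S ≤ 2 * q + 1 → S ≤ 1 ∧ x + q * S + J + 2 ≤ m := by
    intro h
    have hS : S ≤ 1 := by
      by_contra h'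
      have : (q + 1) * 2 ≤ (q + 1) * S := Nat.mul_le_mul_left _ (by omega)
      omega
    refine ⟨hS, ?_⟩
    interval_cases S
    · simp at *; omega
    · simp at *; omega
  have hmpos : 0 < m := by omega
  set M := x + (q + 1) * S with hM
  set D := x + q * S + J with hD
  obtain ⟨N, hN1, hN2, hN3⟩ := key (D % m) (Nat.mod_lt _ hmpos)
  have hDm := Nat.mod_add_div D m
  set r := D % m with hr
  have hrm : r < m := Nat.mod_lt _ hmpos
  set t := D / m with ht
  have hle : M + t * d ≤ N := by
    by_contra h
    obtain ⟨k, hk⟩ : ∃ k, M + t * d = N + k + 1 := ⟨M + t * d - N - 1, by omega⟩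
    apply hw
    refine ⟨N * m + r * d + k * m, G.add_mem hN3 (by simpa using G.nsmul_mem g0 k), ?_⟩
    have : w = (M + t * d) * m + r * d := by
      rw [e, ← hDm]; ring
    rw [this, hk]; ring
  by_cases hM1 : M ≤ 2 * q + 1
  · have := bnd hM1
    exact ⟨this.1, by omega⟩
  · exfalso
    have htd : t * d = 0 := by omega
    have ht0 : t = 0 := by
      rcases Nat.mul_eq_zero.1 htd with h | h <;> omega
    rw [ht0] at hDm
    have hr1 : r + 1 = m := by
      by_contra h
      have := hN2 (by omega)
      omega
    apply hne
    have hDv : D = 2 * q + n + 2 := by simp at hDm; omega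
    have hMv : M = 2 * q + 2 := by omega
    rw [e, hDv, hMv, show q + (n + 2) - 1 = q + n + 1 by omega]
    ring

theorem statement17 (e q d m : ℕ) (he : 4 ≤ e) (hq : 0 < q) (hm : m = e + 2 * q + 1)
    (hd : 0 < d) (hgcd : Nat.gcd m d = 1)
    (a : Fin e → ℕ)
    (ha : ∀ i : Fin e, a i = if (i : ℕ) = 0 then m else if (i : ℕ) = 1 then m + d
      else (q + 1) * m + (q + (i : ℕ)) * d)
    (Γ : AddSubmonoid ℕ) (hΓ : Γ = AddSubmonoid.closure (Set.range a)) :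
    ∀ w : ℕ, (w ∈ Γ ∧ ¬ ∃ t ∈ Γ, w = t + m) →
      w ≠ (q + 1) * (m + d) + (q + 1) * m + (q + e - 1) * d →
      ∀ c c' : Fin e → ℕ, (∑ i, c i * a i) = w → (∑ i, c' i * a i) = w → c = c' := by
  obtain ⟨n, rfl⟩ : ∃ n, e = n + 2 := ⟨e - 2, by omega⟩
  intro w hw hne c c' hc hc'
  have hmem : ∀ i, a i ∈ Γ := fun i => hΓ ▸ AddSubmonoid.subset_closure ⟨i, rfl⟩
  have a0 : a 0 = m := by rw [ha]; simp
  have a1 : a (Fin.succ 0) = m + d := by rw [ha]; simp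
  have a2 : ∀ i : Fin n, a i.succ.succ = (q + 1) * m + (q + ((i : ℕ) + 2)) * d := by
    intro i; rw [ha]; simp
  have g0 : m ∈ Γ := a0 ▸ hmem 0
  have g1 : m + d ∈ Γ := a1 ▸ hmem _
  have g2 : ∀ i, i < n → (q + 1) * m + (q + (i + 2)) * d ∈ Γ :=
    fun i hi => a2 ⟨i, hi⟩ ▸ hmem _
  have ex : ∀ c : Fin (n + 2) → ℕ, (∑ i, c i * a i) = w → c 0 = 0 ∧
      w = (c (Fin.succ 0) + (q + 1) * ∑ i : Fin n, c i.succ.succ) * m +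
        (c (Fin.succ 0) + q * (∑ i : Fin n, c i.succ.succ)
          + ∑ i : Fin n, c i.succ.succ * ((i : ℕ) + 2)) * d := by
    intro c hc
    have z : c 0 = 0 := by
      by_contra h
      obtain ⟨k, hk⟩ := Nat.exists_eq_succ_of_ne_zero h
      apply hw.2
      refine ⟨k * m + ∑ i : Fin (n + 1), c i.succ * a i.succ, ?_, ?_⟩
      · refine Γ.add_mem (by simpa using Γ.nsmul_mem g0 k) (Γ.sum_mem fun i _ => ?_)
        simpa using Γ.nsmul_mem (hmem i.succ) (c i.succ)
      · rw [← hc, Fin.sum_univ_succ, hk, a0, Nat.succ_eq_add_one]; ring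
    refine ⟨z, ?_⟩
    rw [← hc, Fin.sum_univ_succ, Fin.sum_univ_succ, z, a1]
    have : ∑ i : Fin n, c i.succ.succ * a i.succ.succ
        = (q + 1) * m * (∑ i : Fin n, c i.succ.succ) + q * d * (∑ i : Fin n, c i.succ.succ)
          + d * ∑ i : Fin n, c i.succ.succ * ((i : ℕ) + 2) := by
      rw [Finset.mul_sum, Finset.mul_sum, Finset.mul_sum, ← Finset.sum_add_distrib,
        ← Finset.sum_add_distrib]
      refine Finset.sum_congr rfl fun i _ => ?_
      rw [a2]; ring
    rw [this]; ring
  have up : ∀ f : Fin n → ℕ, ∑ i, f i * ((i : ℕ) + 2) ≤ (n + 1) * ∑ i, f i := by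
    intro f
    rw [Finset.mul_sum]
    refine Finset.sum_le_sum fun i _ => ?_
    rw [mul_comm]
    exact Nat.mul_le_mul_right _ (by omega)
  have lo : ∀ f : Fin n → ℕ, 2 * ∑ i, f i ≤ ∑ i, f i * ((i : ℕ) + 2) := by
    intro f
    rw [Finset.mul_sum]
    refine Finset.sum_le_sum fun i _ => ?_
    rw [mul_comm]
    exact Nat.mul_le_mul_left _ (by omega)
  obtain ⟨z, E⟩ := ex c hc
  obtain ⟨z', E'⟩ := ex c' hc'
  have u := up fun i => c i.succ.succ
  have u' := up fun i => c' i.succ.succ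
  have l := lo fun i => c i.succ.succ
  have l' := lo fun i => c' i.succ.succ
  have fin := aux_uniq (fun i : Fin n => c i.succ.succ) (fun i => c' i.succ.succ)
  obtain ⟨S1, D1⟩ := aux_core n q d m hm (by omega) hd Γ g0 g1 g2 w hw.2 hne _ _ _ u E
  obtain ⟨S1', D1'⟩ := aux_core n q d m hm (by omega) hd Γ g0 g1 g2 w hw.2 hne _ _ _ u' E'
  generalize hS : (∑ i : Fin n, c i.succ.succ) = S at *
  generalize hS' : (∑ i : Fin n, c' i.succ.succ) = S' at *
  generalize hJ : (∑ i : Fin n, c i.succ.succ * ((i : ℕ) + 2)) = J at *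
  generalize hJ' : (∑ i : Fin n, c' i.succ.succ * ((i : ℕ) + 2)) = J' at *
  generalize hx : c (Fin.succ 0) = x at *
  generalize hx' : c' (Fin.succ 0) = x' at *
  have hDD : x + q * S + J = x' + q * S' + J' := by
    have h1 : (x + q * S + J) * d ≡ (x' + q * S' + J') * d [MOD m] := by
      have h2 := E.symm.trans E'
      have h3 := congrArg (· % m) h2
      simpa [Nat.ModEq, Nat.add_mod] using h3
    have h4 := Nat.ModEq.cancel_right_of_coprime hgcd h1
    exact Nat.ModEq.eq_of_lt_of_lt h4 D1 D1'
  have hMM : x + (q + 1) * S = x' + (q + 1) * S' := by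
    rw [E, hDD] at E'
    have := Nat.add_right_cancel E'
    exact Nat.eq_of_mul_eq_mul_right (by omega) this
  have fin3 : x = x' ∧ S = S' ∧ J = J' := by
    interval_cases S <;> interval_cases S' <;> simp at * <;> omega
  obtain ⟨hxx, hSS, hJJ⟩ := fin3
  have F := fin S1 hSS hJJ
  funext i
  refine Fin.cases (by rw [z, z']) (fun j => ?_) i
  refine Fin.cases (by rw [hx, hx', hxx]) (fun k => ?_) j
  exact congrFun F k
end

section
/- Let e ≥ 4 be an even integer, q a positive even integer with q ≥ e−4, m = e + 2q, d an odd positive integer with gcd(m, d) = 1, and let Γ = Γ_{(e,q,d)}(𝒯) be the additive submonoid of ℕ generated by the e elements b_0 = m, b_1 = m+d, b_{k+2} = q(m+1) + (q − (e−4)/2 + k)d + e/2 for 0 ≤ k ≤ e−3. Then every element w of the Apéry set Ap(Γ, m) = {s ∈ Γ : s − m ∉ Γ} other than its maximal element (2q+1)(m+d) has a unique expression as a nonnegative integer combination of b_0, b_1, …, b_{e−1}: if w = ∑_{i=0}^{e−1} c_i b_i = ∑_{i=0}^{e−1} c'_i b_i with all c_i, c'_i ∈ ℕ, then c_i = c'_i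 for all i. -/
theorem aux_shape (h q δ p m d : ℕ) (hh : 2 ≤ h) (hp : p + h = q + 2)
    (hm : m = 2 * h + 2 * q) (hd : d = 2 * δ + 1)
    (b : Fin (h + h) → ℕ) (i0 i1 : Fin (h + h)) (h0 : (i0 : ℕ) = 0) (h1 : (i1 : ℕ) = 1)
    (hb0 : b i0 = m) (hb1 : b i1 = m + d)
    (hB : ∀ i : Fin (h + h), ∀ k : ℕ, (i : ℕ) = k + 2 → b i = q * (m + 1) + (p + k) * d + h)
    (Γ : AddSubmonoid ℕ) (hΓ : ∀ i, b i ∈ Γ)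
    (w : ℕ) (hw : ∀ t ∈ Γ, w ≠ t + m) (hmax : w ≠ (2 * q + 1) * (m + d))
    (c : Fin (h + h) → ℕ) (hc : ∑ i, c i * b i = w) :
    (∃ n, n ≤ 2 * q + 1 ∧ c = Pi.single i1 n) ∨
      (∃ i : Fin (h + h), 2 ≤ (i : ℕ) ∧ c = Pi.single i 1) := by
  have hmul : ∀ (i : Fin (h + h)) (n : ℕ), n * b i ∈ Γ := fun i n => by
    have := Γ.nsmul_mem (hΓ i) n
    simpa using this
  have hP : ∀ u : Fin (h + h) → ℕ, ∑ i, u i * b i ∈ Γ := fun u =>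
    Γ.sum_mem (fun i _ => hmul i (u i))
  have hmm : ∀ n : ℕ, n * m ∈ Γ := fun n => by
    have := hmul i0 n
    rwa [hb0] at this
  have hmd : ∀ n : ℕ, n * (m + d) ∈ Γ := fun n => by
    have := hmul i1 n
    rwa [hb1] at this
  -- sub-expressions are in the Apery set too
  have forb : ∀ u : Fin (h + h) → ℕ, (∀ i, u i ≤ c i) → ∀ t ∈ Γ, ∑ i, u i * b i ≠ t + m := by
    intro u hu t ht hs
    apply hw (t + ∑ i, (c i - u i) * b i) (Γ.add_mem ht (hP _))
    have : ∑ i, c i * b i = ∑ i, u i * b i + ∑ i, (c i - u i) * b i := by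
      rw [← Finset.sum_add_distrib]
      refine Finset.sum_congr rfl fun i _ => ?_
      rw [← add_mul, Nat.add_sub_cancel' (hu i)]
    omega
  have s1 : ∀ (i : Fin (h + h)) (n : ℕ), ∑ j, (Pi.single i n : Fin (h + h) → ℕ) j * b j = n * b i := by
    intro i n
    simp [Pi.single_apply]
  have s2 : ∀ (i j : Fin (h + h)), ∑ l, ((Pi.single i 1 + Pi.single j 1 : Fin (h + h) → ℕ)) l * b l
      = b i + b j := by
    intro i j
    simp only [Pi.add_apply, add_mul, Finset.sum_add_distrib, s1, one_mul]
  have forb1 : ∀ i n, n ≤ c i → ∀ t ∈ Γ, n * b i ≠ t + m := by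
    intro i n hn t ht hs
    refine forb (Pi.single i n) (fun j => ?_) t ht (by rw [s1, hs])
    by_cases hj : j = i
    · subst hj; simpa using hn
    · simp [hj]
  have forb2 : ∀ i j, i ≠ j → 0 < c i → 0 < c j → ∀ t ∈ Γ, b i + b j ≠ t + m := by
    intro i j hij hi hj t ht hs
    refine forb (Pi.single i 1 + Pi.single j 1) (fun l => ?_) t ht (by rw [s2, hs])
    by_cases hl : l = i
    · subst hl; simp [hij]; omega
    · by_cases hl' : l = j
      · subst hl'; simp [hl]; omega
      · simp [hl, hl']
  have hc0 : c i0 = 0 := by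
    by_contra hne
    exact forb1 i0 1 (by omega) 0 Γ.zero_mem (by rw [hb0]; omega)
  -- pair of large generators
  have pair : ∀ i j : Fin (h + h), ∀ k l : ℕ, (i : ℕ) = k + 2 → (j : ℕ) = l + 2 →
      (∀ t ∈ Γ, b i + b j ≠ t + m) → k + l + 3 = 2 * h := by
    intro i j k l hi hj hf
    have hil := i.isLt
    have hjl := j.isLt
    by_contra hne
    rcases Nat.lt_or_gt_of_ne hne with hlt | hgt
    · obtain ⟨x, hx⟩ : ∃ x, 2 * h = k + l + 3 + (x + 1) := ⟨2 * h - (k + l + 3) - 1, by omega⟩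
      refine hf ((2 * p + k + l) * (m + d) + x * m) (Γ.add_mem (hmd _) (hmm _)) ?_
      rw [hB i k hi, hB j l hj]
      zify at *
      linear_combination m * hx - 2 * m * hp - hm
    · obtain ⟨x, hx⟩ : ∃ x, k + l + 2 = 2 * h + x := ⟨k + l + 2 - 2 * h, by omega⟩
      have hbx := hB ⟨x + 2, by omega⟩ x rfl
      refine hf (b ⟨x + 2, by omega⟩ + (q + δ) * m) (Γ.add_mem (hΓ _) (hmm _)) ?_
      rw [hB i k hi, hB j l hj, hbx]
      clear * - hx hp hm hd
      zify at *
      linear_combination (d : ℤ) * hx + d * hp - (δ + 1) * hm + (h + q) * hd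
  have one : ∀ j : Fin (h + h), 2 ≤ (j : ℕ) → 0 < c j → c i1 = 0 := by
    intro j hj hcj
    by_contra hne
    have hjl := j.isLt
    obtain ⟨k, hk⟩ : ∃ k, (j : ℕ) = k + 2 := ⟨j - 2, by omega⟩
    have hij : i1 ≠ j := by
      intro hx; rw [← hx] at hj; omega
    have hf := forb2 i1 j hij (by omega) hcj
    rcases Nat.lt_or_ge (k + 3) (h + h) with hlt | hge
    · have hbx := hB ⟨k + 3, by omega⟩ (k + 1) rfl
      refine hf (b ⟨k + 3, by omega⟩) (hΓ _) ?_
      rw [hb1, hB j k hk, hbx]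
      ring
    · refine hf ((q + 1 + δ) * m) (hmm _) ?_
      have hke : k + 3 = h + h := by omega
      rw [hb1, hB j k hk]
      zify at *
      linear_combination (d : ℤ) * hke + d * hp - (δ + 1) * hm + (h + q) * hd
  by_cases hex : ∃ j : Fin (h + h), 2 ≤ (j : ℕ) ∧ 0 < c j
  · right
    obtain ⟨i, hi, hci⟩ := hex
    have hc1 := one i hi hci
    have le1 : ∀ j : Fin (h + h), 2 ≤ (j : ℕ) → c j ≤ 1 := by
      intro j hj
      by_contra hgt
      have := pair j j (j - 2) (j - 2) (by omega) (by omega) (by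
        intro t ht hs
        exact forb1 j 2 (by omega) t ht (by omega))
      omega
    have uniq : ∀ j : Fin (h + h), j ≠ i → c j = 0 := by
      intro j hji
      by_contra hne
      have h2 : ∀ l : Fin (h + h), c l ≠ 0 → 2 ≤ (l : ℕ) := by
        intro l hl
        by_contra hlt
        have : (l : ℕ) = 0 ∨ (l : ℕ) = 1 := by omega
        rcases this with hl0 | hl0
        · exact hl (by rw [show l = i0 from Fin.ext (by omega)]; exact hc0)
        · exact hl (by rw [show l = i1 from Fin.ext (by omega)]; exact hc1)
      have hj2 := h2 j hne
      have e1 := pair i j (i - 2) (j - 2) (by omega) (by omega)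
        (forb2 i j (Ne.symm hji) hci (by omega))
      have hcc : c = Pi.single i 1 + Pi.single j 1 := by
        funext l
        by_cases hl : l = i
        · subst hl
          have := le1 l hi
          simp [Ne.symm hji]; omega
        · by_cases hl' : l = j
          · subst hl'
            have := le1 l hj2
            simp [hl]; omega
          · simp only [Pi.add_apply, Pi.single_apply, hl, hl', if_false]
            by_contra hcl
            have hl2 := h2 l hcl
            have e2 := pair i l (i - 2) (l - 2) (by omega) (by omega)
              (forb2 i l (Ne.symm hl) hci (by omega))
            exact hl' (Fin.ext (by omega))
      apply hmax
      rw [← hc, hcc, s2]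
      obtain ⟨k, hk⟩ : ∃ k, (i : ℕ) = k + 2 := ⟨i - 2, by omega⟩
      obtain ⟨l, hl⟩ : ∃ l, (j : ℕ) = l + 2 := ⟨j - 2, by omega⟩
      have e3 : k + l + 3 = 2 * h := by omega
      rw [hB i k hk, hB j l hl]
      clear * - e3 hp hm hd
      zify at *
      linear_combination (d : ℤ) * e3 + 2 * d * hp - hm
    refine ⟨i, hi, ?_⟩
    funext l
    by_cases hl : l = i
    · subst hl
      have := le1 l hi
      simp; omega
    · simp [hl, uniq l hl]
  · left
    push Not at hex
    refine ⟨c i1, ?_, ?_⟩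
    · by_contra hgt
      have hbx := hB ⟨2, by omega⟩ 0 rfl
      refine forb1 i1 (2 * q + 2) (by omega) (b ⟨2, by omega⟩ + (q + 1 + δ) * m)
        (Γ.add_mem (hΓ _) (hmm _)) ?_
      rw [hb1, hbx]
      clear * - hp hm hd
      zify at *
      linear_combination -(d : ℤ) * hp - (δ ) * hm + (h + q) * hd
    · funext l
      by_cases hl : l = i1
      · subst hl; simp
      · simp only [Pi.single_apply, hl, if_false]
        by_cases hl0 : l = i0
        · rw [hl0, hc0]
        · have : 2 ≤ (l : ℕ) := by
            have a1 : (l : ℕ) ≠ 0 := fun h' => hl0 (Fin.ext (by omega))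
            have a2 : (l : ℕ) ≠ 1 := fun h' => hl (Fin.ext (by omega))
            omega
          have := hex l this
          omega

theorem aux_ne (h q δ p m d : ℕ) (hp : p + h = q + 2)
    (hm : m = 2 * h + 2 * q) (hd : d = 2 * δ + 1) (hg : Nat.gcd m d = 1)
    (n k : ℕ) (hn : n ≤ 2 * q + 1) (hk : k + 2 < h + h) :
    n * (m + d) ≠ q * (m + 1) + (p + k) * d + h := by
  intro heq
  obtain ⟨x, hx⟩ : ∃ x, n + x = 2 * q + 2 + k := ⟨2 * q + 2 + k - n, by omega⟩
  have hdvd : (m : ℤ) ∣ (x : ℤ) * d := by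
    refine ⟨n - q + δ, ?_⟩
    zify at *
    linear_combination (d : ℤ) * hx - heq - d * hp - δ * hm + (h + q) * hd
  have h2 : m ∣ x * d := by exact_mod_cast hdvd
  have h3 : m ∣ x := (Nat.Coprime.dvd_of_dvd_mul_right hg h2)
  have := Nat.le_of_dvd (by omega) h3
  omega

theorem statement18 (e q d m : ℕ) (he : 4 ≤ e) (heven : Even e) (hq : 0 < q) (hqeven : Even q)
    (hqe : e - 4 ≤ q) (hm : m = e + 2 * q) (hd : 0 < d) (hdodd : Odd d)
    (hgcd : Nat.gcd m d = 1)
    (b : Fin e → ℕ)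
    (hb : ∀ i : Fin e, b i = if (i : ℕ) = 0 then m else if (i : ℕ) = 1 then m + d
      else q * (m + 1) + (q - (e - 4) / 2 + ((i : ℕ) - 2)) * d + e / 2)
    (Γ : AddSubmonoid ℕ) (hΓ : Γ = AddSubmonoid.closure (Set.range b)) :
    ∀ w : ℕ, (w ∈ Γ ∧ ¬ ∃ t ∈ Γ, w = t + m) →
      w ≠ (2 * q + 1) * (m + d) →
      ∀ c c' : Fin e → ℕ, (∑ i, c i * b i) = w → (∑ i, c' i * b i) = w → c = c' := by
  obtain ⟨h, rfl⟩ := heven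
  obtain ⟨δ, hδ⟩ := hdodd
  obtain ⟨p, hpd⟩ : ∃ p, p = q - (h + h - 4) / 2 := ⟨_, rfl⟩
  have hp : p + h = q + 2 := by omega
  have hm' : m = 2 * h + 2 * q := by omega
  have hl0 : 0 < h + h := by omega
  have hl1 : 1 < h + h := by omega
  have hb0 : b ⟨0, hl0⟩ = m := by rw [hb]; simp
  have hb1 : b ⟨1, hl1⟩ = m + d := by rw [hb]; simp
  have hB : ∀ i : Fin (h + h), ∀ k : ℕ, (i : ℕ) = k + 2 →
      b i = q * (m + 1) + (p + k) * d + h := by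
    intro i k hk
    rw [hb, if_neg (by omega), if_neg (by omega), ← hpd, hk, show k + 2 - 2 = k by omega,
      show (h + h) / 2 = h by omega]
  have hmem : ∀ i, b i ∈ Γ := fun i => by
    rw [hΓ]; exact AddSubmonoid.subset_closure ⟨i, rfl⟩
  intro w hw hmax c c' hc hc'
  have hw' : ∀ t ∈ Γ, w ≠ t + m := fun t ht hs => hw.2 ⟨t, ht, hs⟩
  have s1 : ∀ (i : Fin (h + h)) (n : ℕ), ∑ j, (Pi.single i n : Fin (h + h) → ℕ) j * b j = n * b i := by
    intro i n
    simp [Pi.single_apply]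
  have key := aux_shape h q δ p m d (by omega) hp hm' hδ b ⟨0, hl0⟩ ⟨1, hl1⟩ rfl rfl
    hb0 hb1 hB Γ hmem w hw' hmax
  have mixed : ∀ (n : ℕ) (i : Fin (h + h)), n ≤ 2 * q + 1 → 2 ≤ (i : ℕ) →
      n * (m + d) ≠ b i := by
    intro n i hn hi
    have hil := i.isLt
    rw [hB i (i - 2) (by omega)]
    exact aux_ne h q δ p m d hp hm' hδ hgcd n _ hn (by omega)
  rcases key c hc with ⟨n, hn, rfl⟩ | ⟨i, hi, rfl⟩ <;>
    rcases key c' hc' with ⟨n', hn', rfl⟩ | ⟨i', hi', rfl⟩ <;>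
    rw [s1] at hc hc'
  · rw [hb1] at hc hc'
    have : n = n' := Nat.eq_of_mul_eq_mul_right (show 0 < m + d by omega) (hc.trans hc'.symm)
    rw [this]
  · rw [hb1] at hc
    exact absurd (by omega) (mixed n i' hn hi')
  · rw [hb1] at hc'
    exact absurd (by omega) (mixed n' i hn' hi)
  · have heq : b i = b i' := by omega
    rw [hB i (i - 2) (by omega), hB i' (i' - 2) (by omega)] at heq
    have h5 : (p + ((i : ℕ) - 2)) * d = (p + ((i' : ℕ) - 2)) * d := by omega
    have h6 := Nat.eq_of_mul_eq_mul_right hd h5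
    have : i = i' := Fin.ext (by omega)
    rw [this]
end

section
/- Let k be a field, e ≥ 4 an integer, q a positive integer, m = e + 2q + 1, and d a positive integer with gcd(m, d) = 1. Let a_0 = m, a_1 = m+d, and a_i = (q+1)m + (q+i)d for 2 ≤ i ≤ e−1, and let 𝔭 ⊂ k[x_0, …, x_{e−1}] be the kernel of the k-algebra homomorphism ν : k[x_0, …, x_{e−1}] → k[t] with ν(x_i) = t^{a_i} for 0 ≤ i ≤ e−1. Then the minimal number of generators of the ideal 𝔭 equals e(e−1)/2 − 1; that is, e(e−1)/2 − 1 is the least cardinality of a set of polynomials generating 𝔭. -/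
namespace SymConcat

def W (q e r : ℕ) : ℕ := if r ≤ q + 1 then r else if r < q + e then q + 1 else r - (e - 2)

def aa (q d m i : ℕ) : ℕ :=
  if i = 0 then m else if i = 1 then m + d else (q + 1) * m + (q + i) * d

def rr (q m i j : ℕ) : ℕ := if m ≤ 2 * q + i + j then 2 * q + i + j - m else 2 * q + i + j

def cc (q e d m i j : ℕ) : ℕ :=
  2 * q + 2 + (if m ≤ 2 * q + i + j then d else 0) - W q e (rr q m i j)

section abstractPart
variable {A : Type*} [CommMonoid A]

def bb (q e : ℕ) (Y : ℕ → A) (r : ℕ) : A :=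
  if r ≤ q + 1 then Y 1 ^ r else if r < q + e then Y (r - q)
  else Y 1 ^ (r + 1 - (q + e)) * Y (e - 1)

def PP (q e d m : ℕ) (Y : ℕ → A) (z : A) (v : ℕ) : Prop :=
  ∃ c r, r < m ∧ z = Y 0 ^ c * bb q e Y r ∧ v = c * m + W q e r * m + r * d

/-- The right-hand sides. -/
def uu (q e d m : ℕ) (Y : ℕ → A) (i j : ℕ) : A :=
  if i = 0 then Y 1 ^ (q + 2) else if i = 1 then Y 0 * Y (j + 1) else
    Y 0 ^ (cc q e d m i j) * bb q e Y (rr q m i j)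

def TT (e i j : ℕ) : Prop :=
  (i = 0 ∧ j = 2) ∨ (i = 1 ∧ 2 ≤ j ∧ j + 2 ≤ e) ∨ (2 ≤ i ∧ i ≤ j ∧ j < e)

variable {q e d m : ℕ} {Y : ℕ → A}

lemma W_le (he : 4 ≤ e) (hm : m = e + 2 * q + 1) {r : ℕ} (hr : r < m) :
    W q e r ≤ 2 * q + 2 := by
  unfold W; split_ifs <;> omega

lemma rr_lt (hm : m = e + 2 * q + 1) {i j : ℕ} (hi : i < e) (hj : j < e) :
    rr q m i j < m := by
  unfold rr; split_ifs <;> omega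

lemma cc_val (he : 4 ≤ e) (hm : m = e + 2 * q + 1) {i j : ℕ} (hi : i < e) (hj : j < e) :
    (cc q e d m i j) * m + W q e (rr q m i j) * m + rr q m i j * d =
      (2 * q + 2) * m + (2 * q + i + j) * d := by
  have h1 := W_le he hm (rr_lt (q := q) hm hi hj)
  have h2 : cc q e d m i j + W q e (rr q m i j) =
      2 * q + 2 + (if m ≤ 2 * q + i + j then d else 0) := by
    unfold cc; omega
  rw [← add_mul, h2]
  unfold rr
  split_ifs with h
  · obtain ⟨s, hs⟩ := Nat.exists_eq_add_of_le h
    rw [hs, Nat.add_sub_cancel_left]; ring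
  · ring

lemma PP_zero {z : A} {v : ℕ} (h : PP q e d m Y z v) : PP q e d m Y (Y 0 * z) (m + v) := by
  obtain ⟨c, r, hr, rfl, rfl⟩ := h
  exact ⟨c + 1, r, hr, by rw [pow_succ', mul_assoc], by ring⟩

lemma PP_ij (he : 4 ≤ e) (hm : m = e + 2 * q + 1)
    (H : ∀ i j, TT e i j → Y i * Y j = uu q e d m Y i j) {i j : ℕ} (hi : 2 ≤ i) (hj : 2 ≤ j)
    (hie : i < e) (hje : j < e) :
    PP q e d m Y (Y i * Y j) ((2 * q + 2) * m + (2 * q + i + j) * d) := by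
  wlog hij : i ≤ j generalizing i j
  · have := this hj hi hje hie (by omega)
    rwa [mul_comm, show 2 * q + j + i = 2 * q + i + j by ring] at this
  refine ⟨cc q e d m i j, rr q m i j, rr_lt hm hie hje, ?_, (cc_val he hm hie hje).symm⟩
  rw [H i j (Or.inr (Or.inr ⟨hi, hij, hje⟩)), uu, if_neg (by omega), if_neg (by omega)]

lemma PP_one (he : 4 ≤ e) (hm : m = e + 2 * q + 1)
    (H : ∀ i j, TT e i j → Y i * Y j = uu q e d m Y i j) {z : A} {v : ℕ}
    (h : PP q e d m Y z v) : PP q e d m Y (Y 1 * z) (m + d + v) := by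
  have H02 : Y 1 ^ (q + 2) = Y 0 * Y 2 := by
    rw [H 0 2 (Or.inl ⟨rfl, rfl⟩), uu, if_pos rfl]
  have H1 : ∀ j, 2 ≤ j → j + 2 ≤ e → Y 1 * Y j = Y 0 * Y (j + 1) := by
    intro j h1 h2
    rw [H 1 j (Or.inr (Or.inl ⟨rfl, h1, h2⟩)), uu, if_neg (by omega), if_pos rfl]
  obtain ⟨c, r, hr, rfl, rfl⟩ := h
  rcases lt_trichotomy r (q + 1) with h | h | h
  · refine ⟨c, r + 1, by omega, ?_, ?_⟩
    · simp only [bb]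
      rw [if_pos (by omega), if_pos (by omega), pow_succ', mul_left_comm]
    · simp only [W]
      rw [if_pos (by omega), if_pos (by omega)]; ring
  · subst h
    refine ⟨c + 1, q + 2, by omega, ?_, ?_⟩
    · simp only [bb]
      rw [if_pos le_rfl, if_neg (by omega), if_pos (by omega), mul_left_comm, ← pow_succ', H02,
        pow_succ, mul_assoc, Nat.add_sub_cancel_left]
    · simp only [W]
      rw [if_pos le_rfl, if_neg (by omega), if_pos (by omega)]; ring
  rcases lt_trichotomy (r + 1) (q + e) with h' | h' | h'
  · refine ⟨c + 1, r + 1, by omega, ?_, ?_⟩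
    · simp only [bb]
      rw [if_neg (by omega), if_pos (by omega), if_neg (by omega), if_pos (by omega),
        mul_left_comm, H1 _ (by omega) (by omega), pow_succ, mul_assoc,
        show r + 1 - q = r - q + 1 by omega]
    · simp only [W]
      rw [if_neg (by omega), if_pos (by omega), if_neg (by omega), if_pos (by omega)]; ring
  · refine ⟨c, r + 1, by omega, ?_, ?_⟩
    · simp only [bb]
      rw [if_neg (by omega), if_pos (by omega), if_neg (by omega), if_neg (by omega),
        mul_left_comm, show r + 1 + 1 - (q + e) = 1 by omega, pow_one,
        show r - q = e - 1 by omega]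
    · simp only [W]
      rw [if_neg (by omega), if_pos (by omega), if_neg (by omega), if_neg (by omega),
        show r + 1 - (e - 2) = q + 2 by omega]; ring
  rcases eq_or_lt_of_le (show r + 1 ≤ m by omega) with h2 | h2
  · have hr' : r = e + 2 * q := by omega
    subst hr'
    obtain ⟨c', r', hr', e1, e2⟩ :=
      PP_ij (d := d) he hm H (i := 2) (j := e - 1) le_rfl (by omega) (by omega) (by omega)
    refine ⟨c + 1 + c', r', hr', ?_, ?_⟩
    · simp only [bb]
      rw [if_neg (by omega), if_neg (by omega), mul_left_comm, ← mul_assoc (Y 1), ← pow_succ',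
        show e + 2 * q + 1 - (q + e) + 1 = q + 2 by omega, H02, mul_assoc, e1, pow_add, pow_succ]
      simp only [bb, mul_assoc]
    · have : W q e (e + 2 * q) = 2 * q + 2 := by
        simp only [W]; rw [if_neg (by omega), if_neg (by omega)]; omega
      rw [this, show (c + 1 + c') * m + W q e r' * m + r' * d
        = (c + 1) * m + (c' * m + W q e r' * m + r' * d) by ring, ← e2,
        show 2 * q + 2 + (e - 1) = m by omega]
      rw [show (e + 2 * q) * d = e * d + 2 * q * d by ring]
      rw [show (2 * q + 2) * m + m * d = (2 * q + 2) * m + (e + 2 * q + 1) * d by rw [← hm]]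
      ring
  · refine ⟨c, r + 1, h2, ?_, ?_⟩
    · simp only [bb]
      rw [if_neg (by omega), if_neg (by omega), if_neg (by omega), if_neg (by omega),
        mul_left_comm, ← mul_assoc (Y 1), ← pow_succ',
        show r + 1 + 1 - (q + e) = r + 1 - (q + e) + 1 by omega]
    · simp only [W]
      rw [if_neg (by omega), if_neg (by omega), if_neg (by omega), if_neg (by omega),
        show r + 1 - (e - 2) = r - (e - 2) + 1 by omega]; ring

lemma PP_pow (he : 4 ≤ e) (hm : m = e + 2 * q + 1)
    (H : ∀ i j, TT e i j → Y i * Y j = uu q e d m Y i j) {z : A} {v : ℕ}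
    (h : PP q e d m Y z v) (c n : ℕ) :
    PP q e d m Y (Y 0 ^ c * (Y 1 ^ n * z)) (c * m + (n * (m + d) + v)) := by
  induction c with
  | zero =>
    induction n with
    | zero => simpa using h
    | succ n ih =>
      convert PP_one he hm H ih using 1
      · simp [pow_succ', mul_assoc]
      · ring
  | succ c ih =>
    convert PP_zero ih using 1
    · simp [pow_succ', mul_assoc]
    · ring

lemma PP_Y (he : 4 ≤ e) (hm : m = e + 2 * q + 1) {i : ℕ} (hi : 2 ≤ i) (hie : i < e) :
    PP q e d m Y (Y i) ((q + 1) * m + (q + i) * d) := by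
  refine ⟨0, q + i, by omega, ?_, ?_⟩
  · simp only [bb]
    rw [if_neg (by omega), if_pos (by omega), pow_zero, one_mul, Nat.add_sub_cancel_left]
  · simp only [W]
    rw [if_neg (by omega), if_pos (by omega)]; ring

lemma PP_mul (he : 4 ≤ e) (hm : m = e + 2 * q + 1)
    (H : ∀ i j, TT e i j → Y i * Y j = uu q e d m Y i j) {z : A} {v : ℕ}
    (h : PP q e d m Y z v) {i : ℕ} (hie : i < e) :
    PP q e d m Y (Y i * z) (aa q d m i + v) := by
  unfold aa
  split_ifs with h0 h1
  · subst h0; exact PP_zero h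
  · subst h1; exact PP_one he hm H h
  have hi : 2 ≤ i := by omega
  obtain ⟨c, r, hr, rfl, rfl⟩ := h
  simp only [bb, W]
  split_ifs with h2 h3
  · convert PP_pow he hm H (PP_Y (d := d) (Y := Y) he hm hi hie) c r using 1
    · rw [mul_left_comm, mul_comm (Y i)]
    · ring
  · convert PP_pow he hm H
      (PP_ij (d := d) he hm H hi (show 2 ≤ r - q by omega) hie (by omega)) c 0 using 1
    · rw [mul_left_comm, pow_zero, one_mul]
    · rw [show 2 * q + i + (r - q) = q + i + r by omega]; ring
  · convert PP_pow he hm H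
      (PP_ij (d := d) he hm H hi (show 2 ≤ e - 1 by omega) hie (by omega)) c
        (r + 1 - (q + e)) using 1
    · rw [mul_left_comm, mul_left_comm (Y i)]
    · obtain ⟨s, rfl⟩ := Nat.exists_eq_add_of_le (show q + e ≤ r by omega)
      obtain ⟨f, rfl⟩ := Nat.exists_eq_add_of_le he
      rw [show q + (4 + f) + s + 1 - (q + (4 + f)) = s + 1 by omega,
        show 4 + f - 1 = 3 + f by omega,
        show q + (4 + f) + s - (4 + f - 2) = q + s + 2 by omega]
      ring

lemma PP_unique (hgcd : Nat.gcd m d = 1) {z z' : A} {v : ℕ}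
    (h : PP q e d m Y z v) (h' : PP q e d m Y z' v) : z = z' := by
  obtain ⟨c, r, hr, rfl, h1⟩ := h
  obtain ⟨c', r', hr', rfl, h2⟩ := h'
  have hrr : r = r' := by
    have h3 : r * d ≡ r' * d [MOD m] := by
      have e1 : v ≡ r * d [MOD m] := by
        rw [h1, ← add_mul, Nat.ModEq, add_comm, Nat.add_mul_mod_self_right]
      have e2 : v ≡ r' * d [MOD m] := by
        rw [h2, ← add_mul, Nat.ModEq, add_comm, Nat.add_mul_mod_self_right]
      exact e1.symm.trans e2
    exact (Nat.ModEq.cancel_right_of_coprime hgcd h3).eq_of_lt_of_lt hr hr'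
  subst hrr
  have : c * m = c' * m := by omega
  rw [Nat.eq_of_mul_eq_mul_right (by omega) this]

end abstractPart

section concretePart
open MvPolynomial
variable {k : Type*} [Field k] {e q d m : ℕ}

noncomputable def XX (k : Type*) [Field k] (e : ℕ) (i : ℕ) : MvPolynomial (Fin e) k :=
  if h : i < e then X ⟨i, h⟩ else 0

noncomputable def gg (k : Type*) [Field k] (q e d m : ℕ) (p : ℕ × ℕ) : MvPolynomial (Fin e) k :=
  XX k e p.1 * XX k e p.2 - uu q e d m (XX k e) p.1 p.2

def Tset (e : ℕ) : Finset (ℕ × ℕ) :=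
  insert (0, 2) ((Finset.Icc 2 (e - 2)).image (fun j => (1, j)) ∪
    ((Finset.range (e - 2)).sigma (fun j => Finset.range (j + 1))).image
      (fun s => (s.2 + 2, s.1 + 2)))

lemma mem_Tset (he : 4 ≤ e) (p : ℕ × ℕ) : p ∈ Tset e ↔ TT e p.1 p.2 := by
  obtain ⟨i, j⟩ := p
  simp only [Tset, TT, Finset.mem_insert, Finset.mem_union, Finset.mem_image, Finset.mem_sigma,
    Finset.mem_range, Finset.mem_Icc, Prod.mk.injEq]
  constructor
  · rintro (h | ⟨j', h, rfl, rfl⟩ | ⟨⟨s, t⟩, h, h1, h2⟩)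
    · exact Or.inl h
    · right; left; omega
    · right; right; simp only at h h1 h2; omega
  · rintro (h | ⟨rfl, h⟩ | h)
    · exact Or.inl h
    · right; left; exact ⟨j, by omega, rfl, rfl⟩
    · right; right
      exact ⟨⟨j - 2, i - 2⟩, by simp only; omega, by simp only; omega, by simp only; omega⟩

lemma card_Tset (he : 4 ≤ e) : (Tset e).card = e * (e - 1) / 2 - 1 := by
  unfold Tset
  rw [Finset.card_insert_of_notMem, Finset.card_union_of_disjoint, Finset.card_image_of_injective,
    Finset.card_image_of_injective, Finset.card_sigma]
  · simp only [Finset.card_range, Nat.card_Icc]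
    obtain ⟨f, rfl⟩ := Nat.exists_eq_add_of_le he
    have h := Finset.sum_range_id_mul_two (4 + f - 2 + 1)
    rw [Finset.sum_range_succ'] at h
    rw [show 4 + f - 2 = f + 2 by omega] at *
    rw [show 4 + f - 1 = f + 3 by omega]
    have h2 : (4 + f) * (f + 3) = (f + 2 + 1) * (f + 2) + 2 * (f + 3) := by ring
    simp only [Nat.add_sub_cancel] at h
    omega
  · rintro ⟨a, b⟩ ⟨c, d⟩ h
    simp only [Prod.mk.injEq] at h
    obtain ⟨h1, h2⟩ := h
    have h1 : b = d := by omega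
    have h2 : a = c := by omega
    subst h1 h2; rfl
  · intro a b h
    simpa using h
  · rw [Finset.disjoint_left]
    intro p hp hp'
    simp only [Finset.mem_image] at hp hp'
    obtain ⟨x, -, rfl⟩ := hp
    obtain ⟨y, -, h⟩ := hp'
    simp only [Prod.mk.injEq] at h
    omega
  · simp

lemma XX_lt {i : ℕ} (h : i < e) : XX k e i = X ⟨i, h⟩ := dif_pos h

/-! ### Upper bound -/

lemma map_bb {A B F : Type*} [CommMonoid A] [CommMonoid B] [FunLike F A B] [MonoidHomClass F A B]
    (f : F) (Y : ℕ → A) (r : ℕ) : f (bb q e Y r) = bb q e (fun i => f (Y i)) r := by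
  unfold bb; split_ifs <;> simp

lemma map_uu {A B F : Type*} [CommMonoid A] [CommMonoid B] [FunLike F A B] [MonoidHomClass F A B]
    (f : F) (Y : ℕ → A) (i j : ℕ) :
    f (uu q e d m Y i j) = uu q e d m (fun i => f (Y i)) i j := by
  unfold uu; split_ifs <;> simp [map_bb]

lemma bb_congr {A : Type*} [CommMonoid A] (he : 4 ≤ e) {Y Z : ℕ → A} (h : ∀ i < e, Y i = Z i)
    (r : ℕ) : bb q e Y r = bb q e Z r := by
  unfold bb; split_ifs with h1 h2
  · rw [h 1 (by omega)]
  · rw [h _ (by omega)]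
  · rw [h 1 (by omega), h (e - 1) (by omega)]

lemma uu_congr {A : Type*} [CommMonoid A] (he : 4 ≤ e) {Y Z : ℕ → A} (h : ∀ i < e, Y i = Z i)
    {i j : ℕ} (hT : TT e i j) : uu q e d m Y i j = uu q e d m Z i j := by
  unfold TT at hT
  unfold uu; split_ifs with h1 h2
  · rw [h 1 (by omega)]
  · rw [h 0 (by omega), h (j + 1) (by omega)]
  · rw [h 0 (by omega), bb_congr he h]

lemma bb_pow {A : Type*} [CommMonoid A] (he : 4 ≤ e) (t : A) {r : ℕ} :
    bb q e (fun i => t ^ aa q d m i) r = t ^ (W q e r * m + r * d) := by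
  unfold bb W; split_ifs with h1 h2
  · rw [← pow_mul]; congr 1; simp [aa]; ring
  · simp only [aa]; rw [if_neg (by omega), if_neg (by omega)]
    rw [show q + (r - q) = r by omega]
  · simp only [aa, if_true]; rw [if_neg (by omega), if_neg (by omega), if_neg (by omega),
      ← pow_mul, ← pow_add]
    congr 1
    obtain ⟨s, rfl⟩ := Nat.exists_eq_add_of_le (show q + e ≤ r by omega)
    obtain ⟨f, rfl⟩ := Nat.exists_eq_add_of_le he
    rw [show q + (4 + f) + s + 1 - (q + (4 + f)) = s + 1 by omega,
        show 4 + f - 1 = 3 + f by omega,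
        show q + (4 + f) + s - (4 + f - 2) = q + s + 2 by omega]
    ring

lemma uu_pow {A : Type*} [CommMonoid A] (he : 4 ≤ e) (hm : m = e + 2 * q + 1) (t : A) {i j : ℕ}
    (hT : TT e i j) :
    uu q e d m (fun i => t ^ aa q d m i) i j = t ^ aa q d m i * t ^ aa q d m j := by
  rcases hT with ⟨rfl, rfl⟩ | ⟨rfl, h1, h2⟩ | ⟨h1, h2, h3⟩
  · simp only [uu, aa, if_true]
    rw [if_neg (by omega), if_neg (by omega), if_neg (by omega), ← pow_mul, ← pow_add]
    congr 1; ring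
  · simp only [uu, aa, if_true]
    rw [if_neg (by omega), if_neg (by omega), if_neg (by omega), if_neg (by omega),
      if_neg (by omega), if_neg (by omega), ← pow_add, ← pow_add]
    congr 1; ring
  · simp only [uu]
    rw [if_neg (by omega), if_neg (by omega), bb_pow he, ← pow_mul, ← pow_add, ← pow_add]
    congr 1
    have := cc_val (d := d) (q := q) he hm (show i < e by omega) h3
    simp only [aa, if_true]
    rw [if_neg (by omega), if_neg (by omega), if_neg (by omega), if_neg (by omega)]
    linarith

lemma gg_mem (he : 4 ≤ e) (hm : m = e + 2 * q + 1) (a : Fin e → ℕ)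
    (ha : ∀ i : Fin e, a i = aa q d m i) {p : ℕ × ℕ} (hp : TT e p.1 p.2) :
    aeval (fun i : Fin e => (Polynomial.X : Polynomial k) ^ a i) (gg k q e d m p) = 0 := by
  have h : ∀ i < e, aeval (fun i : Fin e => (Polynomial.X : Polynomial k) ^ a i) (XX k e i) =
      Polynomial.X ^ aa q d m i := by
    intro i hi
    rw [XX_lt hi, aeval_X, ha]
  obtain ⟨i, j⟩ := p
  have hi : i < e := by unfold TT at hp; omega
  have hj : j < e := by unfold TT at hp; omega
  simp only [gg, map_sub, map_mul, map_uu]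
  simp only at hp
  rw [uu_congr he h hp, uu_pow he hm _ hp, h i hi, h j hj, sub_self]

lemma monomial_PP (he : 4 ≤ e) (hm : m = e + 2 * q + 1) (a : Fin e → ℕ)
    (ha : ∀ i : Fin e, a i = aa q d m i) (I : Ideal (MvPolynomial (Fin e) k))
    (hI : ∀ p, TT e p.1 p.2 → gg k q e d m p ∈ I) (α : Fin e →₀ ℕ) :
    PP q e d m (fun i => Ideal.Quotient.mk I (XX k e i))
      (Ideal.Quotient.mk I (monomial α 1)) (α.sum fun i n => n * a i) := by
  have H : ∀ i j, TT e i j →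
      Ideal.Quotient.mk I (XX k e i) * Ideal.Quotient.mk I (XX k e j) =
        uu q e d m (fun i => Ideal.Quotient.mk I (XX k e i)) i j := by
    intro i j h
    rw [← map_uu, ← map_mul, Ideal.Quotient.eq]
    exact hI (i, j) h
  have key : ∀ n (α : Fin e →₀ ℕ), α.degree = n →
    PP q e d m (fun i => Ideal.Quotient.mk I (XX k e i))
      (Ideal.Quotient.mk I (monomial α 1)) (α.sum fun i n => n * a i) := by
    intro n
    induction n with
    | zero =>
      intro α h
      rw [Finsupp.degree_eq_zero_iff] at h
      subst h
      exact ⟨0, 0, by omega, by simp [bb], by simp [W]⟩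
    | succ n ih =>
      intro α h
      have : α ≠ 0 := by rintro rfl; simp at h
      obtain ⟨i, hi⟩ := Finsupp.ne_iff.1 this
      have hle : Finsupp.single i 1 ≤ α := by
        rw [Finsupp.single_le_iff]; simp at hi; omega
      obtain ⟨β, rfl⟩ := exists_add_of_le hle
      have hb : β.degree = n := by simp at h; omega
      convert PP_mul he hm H (ih β hb) i.2 using 1
      · rw [← map_mul, XX_lt i.2, X, monomial_mul, one_mul]
      · rw [Finsupp.sum_add_index' (by simp) (by intros; ring), ← ha]; simp
  exact key _ α rfl

lemma ker_le (he : 4 ≤ e) (hm : m = e + 2 * q + 1) (hgcd : Nat.gcd m d = 1) (a : Fin e → ℕ)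
    (ha : ∀ i : Fin e, a i = aa q d m i) (I : Ideal (MvPolynomial (Fin e) k))
    (hI : ∀ p, TT e p.1 p.2 → gg k q e d m p ∈ I) (f : MvPolynomial (Fin e) k)
    (hf : aeval (fun i : Fin e => (Polynomial.X : Polynomial k) ^ a i) f = 0) : f ∈ I := by
  classical
  let B := MvPolynomial (Fin e) k ⧸ I
  let Y : ℕ → B := fun i => Ideal.Quotient.mk I (XX k e i)
  let N : ℕ → B := fun v => if h : ∃ z, PP q e d m Y z v then h.choose else 0
  have hN : ∀ z v, PP q e d m Y z v → N v = z := by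
    intro z v h
    have hex : ∃ z, PP q e d m Y z v := ⟨z, h⟩
    simp only [N, dif_pos hex]
    exact PP_unique hgcd hex.choose_spec h
  let σ : Polynomial k →ₗ[k] B := Polynomial.lsum fun v => LinearMap.toSpanSingleton k B (N v)
  have hσ : σ ∘ₗ (aeval (fun i : Fin e => (Polynomial.X : Polynomial k) ^ a i)).toLinearMap =
      (Ideal.Quotient.mkₐ k I).toLinearMap := by
    ext α
    have h := hN _ _ (monomial_PP he hm a ha I hI α)
    have h2 : aeval (fun i : Fin e => (Polynomial.X : Polynomial k) ^ a i) (monomial α (1 : k)) =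
        Polynomial.monomial (α.sum fun i n => n * a i) 1 := by
      rw [aeval_monomial, map_one, one_mul, Polynomial.monomial_one_right_eq_X_pow,
        Finsupp.prod, Finsupp.sum, ← Finset.prod_pow_eq_pow_sum]
      refine Finset.prod_congr rfl fun i _ => ?_
      rw [← pow_mul, mul_comm]
    change σ (aeval (fun i : Fin e => (Polynomial.X : Polynomial k) ^ a i) (monomial α (1 : k))) =
      Ideal.Quotient.mk I (monomial α (1 : k))
    rw [← h, h2]
    simp [σ, Polynomial.lsum_apply]
  have := LinearMap.congr_fun hσ f
  simp only [LinearMap.comp_apply, AlgHom.toLinearMap_apply, hf, map_zero] at this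
  rw [Ideal.Quotient.mkₐ_eq_mk] at this
  exact Ideal.Quotient.eq_zero_iff_mem.1 this.symm

/-! ### Lower bound -/

lemma XX_mem (i : ℕ) : XX k e i ∈ idealOfVars (Fin e) k := by
  unfold XX
  split_ifs with h
  · exact Ideal.subset_span ⟨_, rfl⟩
  · exact zero_mem _

noncomputable def ee (e i : ℕ) : Fin e →₀ ℕ := if h : i < e then Finsupp.single ⟨i, h⟩ 1 else 0

lemma ee_lt {i : ℕ} (h : i < e) : ee e i = Finsupp.single ⟨i, h⟩ 1 := dif_pos h

lemma ee_inj {i j i' j' : ℕ} (hij : i ≤ j) (hj : j < e) (hij' : i' ≤ j') (hj' : j' < e)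
    (h : ee e i + ee e j = ee e i' + ee e j') : i = i' ∧ j = j' := by
  rw [ee_lt (show i < e by omega), ee_lt hj, ee_lt (show i' < e by omega), ee_lt hj',
    Finsupp.single_add_single_eq_single_add_single one_ne_zero one_ne_zero] at h
  simp only [Fin.mk.injEq] at h
  omega

lemma coeff_XX {i j : ℕ} (hij : i ≤ j) (hj : j < e) (s : Fin e →₀ ℕ) :
    coeff s (XX k e i * XX k e j) = if ee e i + ee e j = s then 1 else 0 := by
  classical
  rw [XX_lt (show i < e by omega), XX_lt hj, ee_lt (show i < e by omega), ee_lt hj, X, X,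
    monomial_mul, one_mul, coeff_monomial]

lemma uu_mem (he : 4 ≤ e) (hq : 0 < q) (hm : m = e + 2 * q + 1) {i j : ℕ}
    (hT : TT e i j) (hi : i ≠ 1) :
    uu q e d m (XX k e) i j ∈ idealOfVars (Fin e) k ^ 3 := by
  rcases hT with ⟨rfl, rfl⟩ | ⟨rfl, h1, h2⟩ | ⟨h1, h2, h3⟩
  · rw [uu, if_pos rfl]
    exact Ideal.pow_le_pow_right (by omega) (Ideal.pow_mem_pow (XX_mem 1) _)
  · exact absurd rfl hi
  · rw [uu, if_neg (by omega), if_neg (by omega)]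
    have hr := rr_lt (q := q) hm (show i < e by omega) h3
    have hc : 2 * q + 2 ≤ cc q e d m i j + W q e (rr q m i j) := by
      unfold cc; omega
    have hX := Ideal.pow_mem_pow (XX_mem (k := k) (e := e) 0) (cc q e d m i j)
    have hb : bb q e (XX k e) (rr q m i j) ∈
        idealOfVars (Fin e) k ^ (W q e (rr q m i j) - q) := by
      unfold bb W
      split_ifs with g1 g2
      · exact Ideal.pow_le_pow_right (by omega) (Ideal.pow_mem_pow (XX_mem 1) _)
      · rw [show q + 1 - q = 1 by omega, pow_one]; exact XX_mem _
      · have := Ideal.mul_mem_mul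
          (Ideal.pow_mem_pow (XX_mem (k := k) (e := e) 1) (rr q m i j + 1 - (q + e)))
          (XX_mem (k := k) (e := e) (e - 1))
        rw [← pow_succ] at this
        exact Ideal.pow_le_pow_right (by omega) this
    have := Ideal.mul_mem_mul hX hb
    rw [← pow_add] at this
    exact Ideal.pow_le_pow_right (by omega) this

lemma degree_ee {i j : ℕ} (hi : i < e) (hj : j < e) : (ee e i + ee e j).degree = 2 := by
  rw [ee_lt hi, ee_lt hj]; simp

lemma coeff_gg (he : 4 ≤ e) (hq : 0 < q) (hm : m = e + 2 * q + 1) {p s : ℕ × ℕ}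
    (hp : TT e p.1 p.2) (hs : TT e s.1 s.2) :
    coeff (ee e s.1 + ee e s.2) (gg k q e d m p) = if p = s then 1 else 0 := by
  obtain ⟨i, j⟩ := p
  obtain ⟨i', j'⟩ := s
  simp only at hp hs
  have hij : i ≤ j ∧ j < e := by unfold TT at hp; omega
  have hij' : i' ≤ j' ∧ j' < e := by unfold TT at hs; omega
  have hu : coeff (ee e i' + ee e j') (uu q e d m (XX k e) i j) = 0 := by
    by_cases h1 : i = 1
    · subst h1
      have hj : 2 ≤ j ∧ j + 2 ≤ e := by unfold TT at hp; omega
      rw [uu, if_neg one_ne_zero, if_pos rfl, coeff_XX (by omega) (by omega), if_neg]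
      intro h
      have := ee_inj (by omega) (by omega) (by omega) (by omega) h
      unfold TT at hs; omega
    · exact (mem_pow_idealOfVars_iff' 3 _).1 (uu_mem he hq hm hp h1) _
        (by rw [degree_ee (by omega) (by omega)]; omega)
  simp only [gg, coeff_sub, hu, sub_zero, coeff_XX hij.1 hij.2, Prod.mk.injEq]
  refine if_congr ⟨fun h => ee_inj hij.1 hij.2 hij'.1 hij'.2 h, ?_⟩ rfl rfl
  rintro ⟨rfl, rfl⟩; rfl

lemma gg_mem_sq (he : 4 ≤ e) (hq : 0 < q) (hm : m = e + 2 * q + 1) {p : ℕ × ℕ}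
    (hp : TT e p.1 p.2) : gg k q e d m p ∈ idealOfVars (Fin e) k ^ 2 := by
  refine sub_mem ?_ ?_
  · rw [pow_two]; exact Ideal.mul_mem_mul (XX_mem _) (XX_mem _)
  · by_cases h1 : p.1 = 1
    · rw [uu, if_neg (by omega), if_pos h1, pow_two]
      exact Ideal.mul_mem_mul (XX_mem _) (XX_mem _)
    · exact Ideal.pow_le_pow_right (by omega) (uu_mem he hq hm hp h1)

lemma sub_C_mem (h : MvPolynomial (Fin e) k) :
    h - C (coeff 0 h) ∈ idealOfVars (Fin e) k := by
  rw [← pow_one (idealOfVars (Fin e) k), mem_pow_idealOfVars_iff']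
  intro x hx
  have : x = 0 := by rw [← Finsupp.degree_eq_zero_iff]; omega
  subst this; simp

lemma lower (he : 4 ≤ e) (hq : 0 < q) (hm : m = e + 2 * q + 1)
    (I : Ideal (MvPolynomial (Fin e) k)) (hI : I ≤ idealOfVars (Fin e) k ^ 2)
    (hg : ∀ p, TT e p.1 p.2 → gg k q e d m p ∈ I)
    (S : Finset (MvPolynomial (Fin e) k))
    (hS : Ideal.span (S : Set (MvPolynomial (Fin e) k)) = I) : (Tset e).card ≤ S.card := by
  classical
  let φ : MvPolynomial (Fin e) k →ₗ[k] (Tset e → k) :=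
    LinearMap.pi fun t => lcoeff k (ee e t.1.1 + ee e t.1.2)
  have hφ : ∀ f t, φ f t = coeff (ee e t.1.1 + ee e t.1.2) f := fun _ _ => rfl
  have h3 : ∀ f ∈ idealOfVars (Fin e) k ^ 3, φ f = 0 := by
    intro f hf
    funext t
    have ht := (mem_Tset he t.1).1 t.2
    rw [hφ]
    refine (mem_pow_idealOfVars_iff' 3 _).1 hf _ ?_
    unfold TT at ht
    rw [degree_ee (by omega) (by omega)]; omega
  have hmul : ∀ h f, f ∈ I → φ (h * f) = coeff 0 h • φ f := by
    intro h f hf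
    have h1 : (h - C (coeff 0 h)) * f ∈ idealOfVars (Fin e) k ^ 3 := by
      rw [pow_succ']
      exact Ideal.mul_mem_mul (sub_C_mem h) (hI hf)
    have h2 := h3 _ h1
    rw [sub_mul, map_sub, sub_eq_zero, ← smul_eq_C_mul, map_smul] at h2
    exact h2
  have hspan : ∀ f ∈ I, φ f ∈ Submodule.span k ((S.image φ : Finset _) : Set (Tset e → k)) := by
    intro f hf
    rw [← hS] at hf
    refine Submodule.span_induction (p := fun f _ =>
      φ f ∈ Submodule.span k ((S.image φ : Finset _) : Set (Tset e → k))) ?_ ?_ ?_ ?_ hf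
    · intro x hx
      exact Submodule.subset_span (by simpa using ⟨x, hx, rfl⟩)
    · simp
    · intro x y _ _ hx hy
      rw [map_add]; exact add_mem hx hy
    · intro a x hx h
      rw [smul_eq_mul, hmul a x (hS ▸ hx)]
      exact Submodule.smul_mem _ _ h
  have htop : Submodule.span k ((S.image φ : Finset _) : Set (Tset e → k)) = ⊤ := by
    rw [eq_top_iff, ← (Pi.basisFun k (Tset e)).span_eq, Submodule.span_le]
    rintro _ ⟨t, rfl⟩
    have ht := (mem_Tset he t.1).1 t.2
    have : (Pi.basisFun k (Tset e)) t = φ (gg k q e d m t.1) := by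
      funext s
      rw [hφ, coeff_gg he hq hm ht ((mem_Tset he s.1).1 s.2), Pi.basisFun_apply, Pi.single_apply]
      exact if_congr ⟨fun h => by rw [h], fun h => (Subtype.ext h).symm⟩ rfl rfl
    rw [this]
    exact hspan _ (hg _ ht)
  have h1 := finrank_span_finset_le_card (R := k) (S.image φ)
  rw [Set.finrank, htop, finrank_top, Module.finrank_fintype_fun_eq_card, Fintype.card_coe] at h1
  exact h1.trans Finset.card_image_le

end concretePart

end SymConcat

open SymConcat in
theorem statement19 (k : Type*) [Field k] (e q d m : ℕ) (he : 4 ≤ e) (hq : 0 < q)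
    (hm : m = e + 2 * q + 1) (hd : 0 < d) (hgcd : Nat.gcd m d = 1)
    (a : Fin e → ℕ)
    (ha : ∀ i : Fin e, a i = if (i : ℕ) = 0 then m else if (i : ℕ) = 1 then m + d
      else (q + 1) * m + (q + (i : ℕ)) * d) :
    IsLeast
      {c : ℕ | ∃ S : Finset (MvPolynomial (Fin e) k), S.card = c ∧
        Ideal.span (S : Set (MvPolynomial (Fin e) k)) =
          RingHom.ker
            (MvPolynomial.aeval (fun i : Fin e => (Polynomial.X : Polynomial k) ^ a i) :
              MvPolynomial (Fin e) k →ₐ[k] Polynomial k)}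
      (e * (e - 1) / 2 - 1) := by
  classical
  have ha' : ∀ i : Fin e, a i = aa q d m i := ha
  have hspan : Ideal.span (((Tset e).image (gg k q e d m) : Finset _) :
      Set (MvPolynomial (Fin e) k)) = RingHom.ker
            (MvPolynomial.aeval (fun i : Fin e => (Polynomial.X : Polynomial k) ^ a i) :
              MvPolynomial (Fin e) k →ₐ[k] Polynomial k) := by
    apply le_antisymm
    · rw [Ideal.span_le]
      intro f hf
      simp only [Finset.coe_image, Set.mem_image, Finset.mem_coe] at hf
      obtain ⟨p, hp, rfl⟩ := hf
      exact gg_mem he hm a ha' ((mem_Tset he p).1 hp)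
    · intro f hf
      refine ker_le (q := q) (d := d) he hm hgcd a ha' _ ?_ f hf
      intro p hp
      exact Ideal.subset_span (Finset.mem_coe.2 (Finset.mem_image_of_mem _ ((mem_Tset he p).2 hp)))
  have hlow : ∀ S : Finset (MvPolynomial (Fin e) k),
      Ideal.span (S : Set (MvPolynomial (Fin e) k)) = RingHom.ker
            (MvPolynomial.aeval (fun i : Fin e => (Polynomial.X : Polynomial k) ^ a i) :
              MvPolynomial (Fin e) k →ₐ[k] Polynomial k) → (Tset e).card ≤ S.card := by
    intro S hS
    refine lower (k := k) (q := q) (d := d) he hq hm _ ?_ ?_ S hS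
    · rw [← hspan, Ideal.span_le]
      intro f hf
      simp only [Finset.coe_image, Set.mem_image, Finset.mem_coe] at hf
      obtain ⟨p, hp, rfl⟩ := hf
      exact gg_mem_sq he hq hm ((mem_Tset he p).1 hp)
    · intro p hp
      exact gg_mem he hm a ha' hp
  rw [← card_Tset he]
  constructor
  · exact ⟨_, le_antisymm Finset.card_image_le (hlow _ hspan), hspan⟩
  · rintro c ⟨S, rfl, hS⟩
    exact hlow S hS
end
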